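/- Let C ⊂ Gr(2,V) be an irreducible projective curve of degree d ≥ 2 which is not contained in any plane σ₂(p₀) of lines through a fixed point p₀ ∈ ℙ(V). Then the incidence variety S̃ := {(w̄, v̄) ∈ C × ℙ(V) : w ∧ v = 0} is an irreducible variety of dimension 2, its image S under the second projection pr₂ : S̃ → ℙ(V) is an irreducible surface of some degree e, and if through a general point of S there pass exactly f lines belonging to C, then d = e · f. -/

import Mathlib

namespace RQS

open MvPolynomial


open MvPolynomial

variable (K : Type) [Field K]

/-- Projective n-space modelled as the projectivization of `Fin n → K`
(so `PP K (n+1)` is ℙⁿ). -/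
abbrev PP (n : ℕ) : Type := Projectivization K (Fin n → K)

variable {K}

/-- Vanishing of a (homogeneous) polynomial at a projective point. -/
def vanishes {n : ℕ} (p : MvPolynomial (Fin n) K) (x : PP K n) : Prop :=
  ∀ (v : Fin n → K) (h : v ≠ 0), Projectivization.mk K v h = x → eval v p = 0

/-- Projective zero locus of a set of polynomials. -/
def zeroLocus {n : ℕ} (S : Set (MvPolynomial (Fin n) K)) : Set (PP K n) :=
  {x | ∀ p ∈ S, vanishes p x}

/-- Zariski closed subsets of projective space. -/
def ZClosed {n : ℕ} (X : Set (PP K n)) : Prop :=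
  ∃ S : Set (MvPolynomial (Fin n) K), (∀ p ∈ S, ∃ d, p.IsHomogeneous d) ∧ X = zeroLocus S

/-- Irreducibility with respect to the Zariski topology. -/
def ZIrred {n : ℕ} (X : Set (PP K n)) : Prop :=
  X.Nonempty ∧ ∀ A B : Set (PP K n), ZClosed A → ZClosed B → X ⊆ A ∪ B → X ⊆ A ∨ X ⊆ B

/-- `X` contains a chain of closed irreducible subsets of length `d+1`. -/
def dimGE {n : ℕ} (X : Set (PP K n)) (d : ℕ) : Prop :=
  ∃ f : Fin (d + 1) → Set (PP K n),
    (∀ i, ZClosed (f i) ∧ ZIrred (f i) ∧ f i ⊆ X) ∧ StrictMono f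

/-- `X` has (Krull) dimension exactly `d`. -/
def HasDim {n : ℕ} (X : Set (PP K n)) (d : ℕ) : Prop := dimGE X d ∧ ¬ dimGE X (d + 1)

/-- The hyperplane with coefficient vector `φ`. -/
def hyp {n : ℕ} (φ : Fin n → K) : Set (PP K n) :=
  {x | ∀ (v : Fin n → K) (h : v ≠ 0), Projectivization.mk K v h = x → ∑ i, φ i * v i = 0}

/-- Degree of a (reduced) curve: every hyperplane not containing it meets it in at most `d`
points, and some hyperplane meets it in exactly `d` points. -/
def HasCurveDeg {n : ℕ} (X : Set (PP K n)) (d : ℕ) : Prop :=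
  (∀ φ : Fin n → K, φ ≠ 0 → ¬ X ⊆ hyp φ →
    (X ∩ hyp φ).Finite ∧ (X ∩ hyp φ).ncard ≤ d) ∧
  (∃ φ : Fin n → K, φ ≠ 0 ∧ ¬ X ⊆ hyp φ ∧ (X ∩ hyp φ).ncard = d)

/-- An irreducible projective curve of degree `d`. -/
def IsCurveOfDeg {n : ℕ} (X : Set (PP K n)) (d : ℕ) : Prop :=
  ZClosed X ∧ ZIrred X ∧ HasDim X 1 ∧ HasCurveDeg X d

/-- A property holds at a general point of `S`. -/
def GenericPts {n : ℕ} (S : Set (PP K n)) (Q : PP K n → Prop) : Prop :=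
  ∃ T : Set (PP K n), ZClosed T ∧ ¬ S ⊆ T ∧ ∀ p ∈ S, p ∉ T → Q p

/-! ### Plücker coordinates: `p₁₂,p₁₃,p₁₄,p₂₃,p₂₄,p₃₄` indexed by `0,…,5` -/

/-- Plücker coordinates of the line through `u` and `v`, i.e. the bivector `u ∧ v`. -/
def plucker (u v : Fin 4 → K) : Fin 6 → K :=
  ![u 0 * v 1 - u 1 * v 0, u 0 * v 2 - u 2 * v 0, u 0 * v 3 - u 3 * v 0,
    u 1 * v 2 - u 2 * v 1, u 1 * v 3 - u 3 * v 1, u 2 * v 3 - u 3 * v 2]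

/-- The Plücker quadric `p₁₂p₃₄ - p₁₃p₂₄ + p₁₄p₂₃`, i.e. `½ w ∧ w`. -/
def plQuad (w : Fin 6 → K) : K := w 0 * w 5 - w 1 * w 4 + w 2 * w 3

/-- The wedge pairing `w ∧ z ∈ Λ⁴V ≅ K` of two bivectors. -/
def plPair (w z : Fin 6 → K) : K :=
  w 0 * z 5 + w 5 * z 0 - w 1 * z 4 - w 4 * z 1 + w 2 * z 3 + w 3 * z 2

/-- The wedge `w ∧ v ∈ Λ³V ≅ V*` of a bivector `w` with a vector `v`;
`w ∧ v = 0` expresses that the point `v̄` lies on the line `w̄`. -/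
def wedgePt (w : Fin 6 → K) (v : Fin 4 → K) : Fin 4 → K :=
  ![w 0 * v 2 - w 1 * v 1 + w 3 * v 0,
    w 0 * v 3 - w 2 * v 1 + w 4 * v 0,
    w 1 * v 3 - w 2 * v 2 + w 5 * v 0,
    w 3 * v 3 - w 4 * v 2 + w 5 * v 1]

/-- The set of points of ℙ³ on the line with Plücker vector `w`. -/
def lineOfRep (w : Fin 6 → K) : Set (PP K 4) :=
  {p | ∀ (v : Fin 4 → K) (h : v ≠ 0), Projectivization.mk K v h = p → wedgePt w v = 0}

/-- `w` represents a line of ℙ³: it is nonzero and decomposable. -/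
def IsLineRep (w : Fin 6 → K) : Prop := w ≠ 0 ∧ plQuad w = 0

variable (K) in
/-- The Grassmannian `Gr(2,4) ⊂ ℙ⁵` of lines in ℙ³. -/
def grass : Set (PP K 6) :=
  {x | ∃ (w : Fin 6 → K) (h : w ≠ 0), Projectivization.mk K w h = x ∧ plQuad w = 0}

/-- The line in ℙ³ corresponding to a point `x` of the Grassmannian. -/
def lineOf (x : PP K 6) : Set (PP K 4) :=
  {p | ∀ (w : Fin 6 → K) (h : w ≠ 0), Projectivization.mk K w h = x → p ∈ lineOfRep w}

/-- The set of (Grassmann points of) lines contained in a surface `S ⊂ ℙ³`. -/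
def linesOf (S : Set (PP K 4)) : Set (PP K 6) :=
  {x | x ∈ grass K ∧ lineOf x ⊆ S}

/-- A ruled surface: an irreducible closed surface which is a union of lines. -/
def IsRuled (S : Set (PP K 4)) : Prop :=
  ZClosed S ∧ ZIrred S ∧ HasDim S 2 ∧ ∀ p ∈ S, ∃ x ∈ linesOf S, p ∈ lineOf x

/-- Degree of a surface in ℙ³ via intersections with lines. -/
def HasSurfDeg (S : Set (PP K 4)) (d : ℕ) : Prop :=
  (∀ w : Fin 6 → K, IsLineRep w → ¬ lineOfRep w ⊆ S →
    (S ∩ lineOfRep w).Finite ∧ (S ∩ lineOfRep w).ncard ≤ d) ∧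
  (∃ w : Fin 6 → K, IsLineRep w ∧ ¬ lineOfRep w ⊆ S ∧ (S ∩ lineOfRep w).ncard = d)

/-- A cone: all lines of `S` pass through a common point. -/
def IsCone (S : Set (PP K 4)) : Prop :=
  ∃ p : PP K 4, ∀ x ∈ linesOf S, p ∈ lineOf x

/-- `σ₂(p₀)`: the 2-plane in the Grassmannian of all lines through `p₀`. -/
def sigma2 (p₀ : PP K 4) : Set (PP K 6) := {x | x ∈ grass K ∧ p₀ ∈ lineOf x}

/-- The projective tangent space `T_{Gr,x₀}` of the Plücker quadric at `x₀`,
namely the hyperplane `{z̄ : w₀ ∧ z = 0}`. -/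
def tangentGr (x₀ : PP K 6) : Set (PP K 6) :=
  {x | ∀ (w : Fin 6 → K) (h : w ≠ 0), Projectivization.mk K w h = x →
    ∀ (w₀ : Fin 6 → K) (h₀ : w₀ ≠ 0), Projectivization.mk K w₀ h₀ = x₀ → plPair w₀ w = 0}

/-- The linear span of (the representatives of) a subset of projective space. -/
def spanOfSet {n : ℕ} (X : Set (PP K n)) : Submodule K (Fin n → K) :=
  Submodule.span K {v | ∃ h : v ≠ 0, Projectivization.mk K v h ∈ X}

/-- The projective subspace associated to a linear subspace. -/
def projSub {n : ℕ} (U : Submodule K (Fin n → K)) : Set (PP K n) :=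
  {x | ∀ (v : Fin n → K) (h : v ≠ 0), Projectivization.mk K v h = x → v ∈ U}

/-- `P(C)`: the smallest projective subspace containing `C`. -/
def projSpanOf {n : ℕ} (X : Set (PP K n)) : Set (PP K n) := projSub (spanOfSet X)

/-! ### Smoothness via Jacobian criteria -/

/-- The homogeneous polynomials vanishing on `X`. -/
def homIdeal {n : ℕ} (X : Set (PP K n)) : Set (MvPolynomial (Fin n) K) :=
  {p | (∃ d, p.IsHomogeneous d) ∧ ∀ x ∈ X, vanishes p x}

/-- The span of the gradients at `v` of all homogeneous polynomials vanishing on `X`. -/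
def gradSpan {n : ℕ} (X : Set (PP K n)) (v : Fin n → K) : Submodule K (Fin n → K) :=
  Submodule.span K
    {g | ∃ p ∈ homIdeal X, g = fun i => eval v (pderiv i p)}

/-- Smooth point of a projective *curve* `X ⊂ ℙ(Kⁿ)` (Jacobian criterion:
the affine cone over `X` has a 2-dimensional tangent space there). -/
def CurveSmoothPt {n : ℕ} (X : Set (PP K n)) (x : PP K n) : Prop :=
  ∀ (v : Fin n → K) (h : v ≠ 0), Projectivization.mk K v h = x →
    Module.finrank K (gradSpan X v) = n - 2

/-- Smooth point of a *surface* `S ⊂ ℙ³` (Jacobian criterion). -/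
def SurfSmoothPt (S : Set (PP K 4)) (x : PP K 4) : Prop :=
  ∀ (v : Fin 4 → K) (h : v ≠ 0), Projectivization.mk K v h = x →
    Module.finrank K (gradSpan S v) = 1

/-- The singular locus of a surface `S ⊂ ℙ³`. -/
def singLocus (S : Set (PP K 4)) : Set (PP K 4) := {x ∈ S | ¬ SurfSmoothPt S x}


/-! ### Products of projective spaces -/

/-- Vanishing of a bihomogeneous polynomial at a point of `ℙ^(a-1) × ℙ^(b-1)`. -/
def vanishes2 {a b : ℕ} (p : MvPolynomial (Fin a ⊕ Fin b) K) (x : PP K a × PP K b) : Prop :=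
  ∀ (u : Fin a → K) (hu : u ≠ 0) (v : Fin b → K) (hv : v ≠ 0),
    Projectivization.mk K u hu = x.1 → Projectivization.mk K v hv = x.2 →
      eval (Sum.elim u v) p = 0

/-- Bihomogeneous polynomial (of some bidegree). -/
def IsBiHomog {a b : ℕ} (p : MvPolynomial (Fin a ⊕ Fin b) K) : Prop :=
  ∃ d e : ℕ, IsWeightedHomogeneous (Sum.elim (fun _ => (1:ℕ)) (fun _ => 0)) p d ∧
    IsWeightedHomogeneous (Sum.elim (fun _ => (0:ℕ)) (fun _ => 1)) p e

/-- Bihomogeneous polynomial of bidegree `(d,e)`. -/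
def IsBiHomogOf {a b : ℕ} (p : MvPolynomial (Fin a ⊕ Fin b) K) (d e : ℕ) : Prop :=
  IsWeightedHomogeneous (Sum.elim (fun _ => (1:ℕ)) (fun _ => 0)) p d ∧
    IsWeightedHomogeneous (Sum.elim (fun _ => (0:ℕ)) (fun _ => 1)) p e

def zeroLocus2 {a b : ℕ} (S : Set (MvPolynomial (Fin a ⊕ Fin b) K)) :
    Set (PP K a × PP K b) :=
  {x | ∀ p ∈ S, vanishes2 p x}

def ZClosed2 {a b : ℕ} (X : Set (PP K a × PP K b)) : Prop :=
  ∃ S : Set (MvPolynomial (Fin a ⊕ Fin b) K), (∀ p ∈ S, IsBiHomog p) ∧ X = zeroLocus2 S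

def ZIrred2 {a b : ℕ} (X : Set (PP K a × PP K b)) : Prop :=
  X.Nonempty ∧ ∀ A B : Set (PP K a × PP K b), ZClosed2 A → ZClosed2 B → X ⊆ A ∪ B →
    X ⊆ A ∨ X ⊆ B

def dimGE2 {a b : ℕ} (X : Set (PP K a × PP K b)) (d : ℕ) : Prop :=
  ∃ f : Fin (d + 1) → Set (PP K a × PP K b),
    (∀ i, ZClosed2 (f i) ∧ ZIrred2 (f i) ∧ f i ⊆ X) ∧ StrictMono f

def HasDim2 {a b : ℕ} (X : Set (PP K a × PP K b)) (d : ℕ) : Prop :=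
  dimGE2 X d ∧ ¬ dimGE2 X (d + 1)


/-! ### Affine cones and their ideals -/

/-- The nonzero representatives of the points of a set in projective space. -/
def cone {n : ℕ} (X : Set (PP K n)) : Set (Fin n → K) :=
  {v | ∃ h : v ≠ 0, Projectivization.mk K v h ∈ X}

/-- The ideal of polynomials vanishing on the affine cone over `X`. -/
def coneIdeal {n : ℕ} (X : Set (PP K n)) : Ideal (MvPolynomial (Fin n) K) :=
  vanishingIdeal K (cone X)

theorem mem_coneIdeal {n : ℕ} {X : Set (PP K n)} {p : MvPolynomial (Fin n) K} :
    p ∈ coneIdeal X ↔ ∀ v ∈ cone X, eval v p = 0 := by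
  simp [coneIdeal, mem_vanishingIdeal_iff, aeval_eq_eval]

theorem mk_mem_iff_mem_cone {n : ℕ} {X : Set (PP K n)} {v : Fin n → K} (h : v ≠ 0) :
    Projectivization.mk K v h ∈ X ↔ v ∈ cone X :=
  ⟨fun hx => ⟨h, hx⟩, fun ⟨_, hx⟩ => hx⟩

theorem mk_smul_eq {n : ℕ} {v : Fin n → K} (h : v ≠ 0) {c : K} (hc : c ≠ 0) :
    Projectivization.mk K (c • v) (smul_ne_zero hc h) = Projectivization.mk K v h :=
  (Projectivization.mk_eq_mk_iff' K _ _ _ _).2 ⟨c, rfl⟩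

theorem smul_mem_cone {n : ℕ} {X : Set (PP K n)} {v : Fin n → K} (hv : v ∈ cone X) {c : K}
    (hc : c ≠ 0) : c • v ∈ cone X := by
  obtain ⟨h, hx⟩ := hv
  exact ⟨smul_ne_zero hc h, by rwa [mk_smul_eq h hc]⟩

theorem exists_rep {n : ℕ} (x : PP K n) : ∃ (v : Fin n → K) (h : v ≠ 0),
    Projectivization.mk K v h = x :=
  ⟨x.rep, x.rep_nonzero, x.mk_rep⟩

theorem exists_mem_cone {n : ℕ} {X : Set (PP K n)} {x : PP K n} (hx : x ∈ X) :
    ∃ (v : Fin n → K) (h : v ≠ 0), Projectivization.mk K v h = x ∧ v ∈ cone X := by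
  obtain ⟨v, h, rfl⟩ := exists_rep x
  exact ⟨v, h, rfl, h, hx⟩

theorem cone_subset_iff {n : ℕ} {X Y : Set (PP K n)} : cone X ⊆ cone Y ↔ X ⊆ Y := by
  constructor
  · intro h x hx
    obtain ⟨v, hv, rfl, hvX⟩ := exists_mem_cone hx
    exact (h hvX).2
  · rintro h v ⟨hv, hx⟩
    exact ⟨hv, h hx⟩

/-! ### Weighted scaling -/

/-- The polynomial in `t` whose value at `t` is `p` evaluated at the point with coordinates
`t ^ ω k * x k`. -/
noncomputable def scalePoly {σ : Type} (ω : σ → ℕ) (x : σ → K) (p : MvPolynomial σ K) :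
    Polynomial K :=
  aeval (fun k => Polynomial.C (x k) * Polynomial.X ^ ω k) p

theorem eval_scalePoly {σ : Type} (ω : σ → ℕ) (x : σ → K) (p : MvPolynomial σ K) (t : K) :
    (scalePoly ω x p).eval t = eval (fun k => t ^ ω k * x k) p := by
  have : ((Polynomial.evalRingHom t).comp (aeval (R := K)
      (fun k => Polynomial.C (x k) * Polynomial.X ^ ω k)).toRingHom) =
      eval (fun k => t ^ ω k * x k) := by
    apply MvPolynomial.ringHom_ext
    · intro r; simp
    · intro i; simp; ring
  exact DFunLike.congr_fun this p

theorem coeff_scalePoly {σ : Type} (ω : σ → ℕ) (x : σ → K) (p : MvPolynomial σ K) (n : ℕ) :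
    (scalePoly ω x p).coeff n = eval x (weightedHomogeneousComponent ω n p) := by
  classical
  induction p using MvPolynomial.induction_on' with
  | monomial m c =>
    have h1 : scalePoly ω x (monomial m c) =
        Polynomial.C (eval x (monomial m c)) * Polynomial.X ^ (Finsupp.weight ω m) := by
      simp only [scalePoly, aeval_monomial, eval_monomial, Finsupp.prod, mul_pow,
        Finset.prod_mul_distrib, ← Polynomial.C_pow, ← pow_mul]
      rw [← map_prod, Finset.prod_pow_eq_pow_sum]
      simp [Finsupp.weight_apply, Finsupp.sum, mul_comm, mul_left_comm]
    rw [h1, Polynomial.coeff_C_mul_X_pow]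
    split_ifs with h
    · rw [weightedHomogeneousComponent_of_mem
        (isWeightedHomogeneous_monomial ω m c rfl), if_pos h]
    · rw [weightedHomogeneousComponent_of_mem
        (isWeightedHomogeneous_monomial ω m c rfl), if_neg h]
      simp
  | add p q hp hq =>
    simp only [scalePoly, map_add, Polynomial.coeff_add] at *
    rw [hp, hq]

theorem scalePoly_eq_zero [Infinite K] {σ : Type} {ω : σ → ℕ} {x : σ → K}
    {p : MvPolynomial σ K} (h : ∀ t : K, t ≠ 0 → eval (fun k => t ^ ω k * x k) p = 0) :
    scalePoly ω x p = 0 := by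
  apply Polynomial.eq_zero_of_infinite_isRoot
  apply Set.Infinite.mono (s := {0}ᶜ)
  · intro t ht
    rw [Set.mem_ofPred_eq, Polynomial.IsRoot, eval_scalePoly]
    exact h t ht
  · exact (Set.finite_singleton 0).infinite_compl

theorem eval_weightedHomogeneousComponent_eq_zero [Infinite K] {σ : Type} {ω : σ → ℕ}
    {x : σ → K} {p : MvPolynomial σ K}
    (h : ∀ t : K, t ≠ 0 → eval (fun k => t ^ ω k * x k) p = 0) (n : ℕ) :
    eval x (weightedHomogeneousComponent ω n p) = 0 := by
  rw [← coeff_scalePoly, scalePoly_eq_zero h, Polynomial.coeff_zero]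

theorem eval_smul_of_isWeightedHomogeneous {σ : Type} {ω : σ → ℕ} {x : σ → K}
    {p : MvPolynomial σ K} {n : ℕ} (hp : IsWeightedHomogeneous ω p n) (t : K) :
    eval (fun k => t ^ ω k * x k) p = t ^ n * eval x p := by
  classical
  rw [← eval_scalePoly]
  have : scalePoly ω x p = Polynomial.C (eval x p) * Polynomial.X ^ n := by
    ext m
    rw [coeff_scalePoly, weightedHomogeneousComponent_of_mem hp, Polynomial.coeff_C_mul_X_pow]
    split_ifs <;> simp
  rw [this, Polynomial.eval_C_mul, Polynomial.eval_X_pow, mul_comm]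

theorem eval_smul_of_isHomogeneous {σ : Type} {x : σ → K}
    {p : MvPolynomial σ K} {n : ℕ} (hp : p.IsHomogeneous n) (t : K) :
    eval (t • x) p = t ^ n * eval x p := by
  rw [← eval_smul_of_isWeightedHomogeneous (ω := 1) hp t]
  congr 1; congr 1; ext k; simp

theorem eval_homogeneousComponent_eq_zero [Infinite K] {σ : Type} {x : σ → K}
    {p : MvPolynomial σ K} (h : ∀ t : K, t ≠ 0 → eval (t • x) p = 0) (n : ℕ) :
    eval x (homogeneousComponent n p) = 0 := by
  apply eval_weightedHomogeneousComponent_eq_zero (ω := 1)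
  intro t ht
  rw [← h t ht]; congr 1; congr 1; ext k; simp

/-! ### Vanishing and closed sets -/

theorem vanishes_mk {n : ℕ} {p : MvPolynomial (Fin n) K} {v : Fin n → K} (h : v ≠ 0) :
    vanishes p (Projectivization.mk K v h) ↔ ∀ t : K, t ≠ 0 → eval (t • v) p = 0 := by
  constructor
  · intro hp t ht
    exact hp _ (smul_ne_zero ht h) (mk_smul_eq h ht)
  · intro hp u hu hux
    obtain ⟨a, rfl⟩ := (Projectivization.mk_eq_mk_iff' K _ _ hu h).1 hux
    exact hp a (by rintro rfl; simp at hu)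

theorem vanishes_of_isHomogeneous {n d : ℕ} {p : MvPolynomial (Fin n) K}
    (hp : p.IsHomogeneous d) {v : Fin n → K} (h : v ≠ 0) (hv : eval v p = 0) :
    vanishes p (Projectivization.mk K v h) := by
  rw [vanishes_mk]
  intro t _
  rw [eval_smul_of_isHomogeneous hp, hv, mul_zero]

theorem zClosed_zeroLocus [Infinite K] {n : ℕ} (S : Set (MvPolynomial (Fin n) K)) :
    ZClosed (zeroLocus S) := by
  refine ⟨{q | ∃ p ∈ S, ∃ d, q = homogeneousComponent d p}, ?_, ?_⟩
  · rintro _ ⟨p, _, d, rfl⟩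
    exact ⟨d, homogeneousComponent_isHomogeneous d p⟩
  · ext x
    obtain ⟨v, hv, rfl⟩ := exists_rep x
    constructor
    · rintro hx _ ⟨p, hp, d, rfl⟩
      exact vanishes_of_isHomogeneous (homogeneousComponent_isHomogeneous d p) hv
        (eval_homogeneousComponent_eq_zero ((vanishes_mk hv).1 (hx p hp)) d)
    · intro hx p hp u hu hux
      rw [← sum_homogeneousComponent p, map_sum]
      exact Finset.sum_eq_zero fun d _ => hx _ ⟨p, hp, d, rfl⟩ u hu hux

theorem ZClosed.mem_cone_iff {n : ℕ} {X : Set (PP K n)} (hX : ZClosed X) {v : Fin n → K}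
    (hv : v ≠ 0) : v ∈ cone X ↔ ∀ p ∈ coneIdeal X, eval v p = 0 := by
  refine ⟨fun h p hp => mem_coneIdeal.1 hp v h, fun h => ⟨hv, ?_⟩⟩
  obtain ⟨S, hS, hXS⟩ := hX
  rw [hXS]
  intro p hp
  obtain ⟨d, hd⟩ := hS p hp
  apply vanishes_of_isHomogeneous hd
  apply h
  rw [mem_coneIdeal]
  rintro u ⟨hu, huX⟩
  rw [hXS] at huX
  exact huX p hp u hu rfl

theorem ZClosed.exists_isHomogeneous {n : ℕ} {X : Set (PP K n)} (hX : ZClosed X) {v : Fin n → K}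
    (hv : v ≠ 0) (hvX : v ∉ cone X) :
    ∃ p ∈ coneIdeal X, (∃ d, p.IsHomogeneous d) ∧ eval v p ≠ 0 := by
  obtain ⟨S, hS, hXS⟩ := hX
  by_contra! hcon
  apply hvX
  refine ⟨hv, ?_⟩
  rw [hXS]
  intro p hp
  obtain ⟨d, hd⟩ := hS p hp
  refine vanishes_of_isHomogeneous hd hv (hcon p ?_ ⟨d, hd⟩)
  rw [mem_coneIdeal]
  rintro u ⟨hu, huX⟩
  rw [hXS] at huX
  exact huX p hp u hu rfl

theorem coneIdeal_anti {n : ℕ} {X Y : Set (PP K n)} (h : X ⊆ Y) : coneIdeal Y ≤ coneIdeal X :=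
  vanishingIdeal_anti_mono (cone_subset_iff.2 h)

theorem coneIdeal_lt {n : ℕ} {X Y : Set (PP K n)} (hX : ZClosed X) (h : X < Y) :
    coneIdeal Y < coneIdeal X := by
  refine lt_of_le_not_ge (coneIdeal_anti h.le) fun hle => h.not_ge ?_
  apply cone_subset_iff.1
  intro v hv
  rw [hX.mem_cone_iff hv.1]
  intro p hp
  exact mem_coneIdeal.1 (hle hp) v hv

theorem isPrime_coneIdeal [Infinite K] {n : ℕ} {X : Set (PP K n)} (hX : ZIrred X) :
    (coneIdeal X).IsPrime := by
  obtain ⟨⟨x, hx⟩, hirr⟩ := hX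
  refine Ideal.isPrime_iff.2 ⟨?_, ?_⟩
  · rw [Ideal.ne_top_iff_one]
    obtain ⟨v, hv, rfl, hvX⟩ := exists_mem_cone hx
    intro h1
    simpa using mem_coneIdeal.1 h1 v hvX
  · intro p q hpq
    have key : X ⊆ zeroLocus {p} ∪ zeroLocus {q} := by
      intro y hy
      obtain ⟨v, hv, rfl, hvX⟩ := exists_mem_cone hy
      have h0 : scalePoly 1 v p * scalePoly 1 v q = 0 := by
        rw [scalePoly, scalePoly, ← map_mul]
        apply scalePoly_eq_zero
        intro t ht
        have := mem_coneIdeal.1 hpq _ (smul_mem_cone hvX ht)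
        rw [← this]; congr 1; congr 1; ext k; simp
      have aux : ∀ r : MvPolynomial (Fin n) K, scalePoly 1 v r = 0 →
          Projectivization.mk K v hv ∈ zeroLocus {r} := by
        rintro r hr _ rfl
        rw [vanishes_mk]
        intro t _
        have := eval_scalePoly 1 v _ t ▸ congrArg (Polynomial.eval t) hr
        rw [Polynomial.eval_zero] at this
        rw [← this]; congr 1; congr 1; ext k; simp
      rcases mul_eq_zero.1 h0 with h | h
      · exact Or.inl (aux p h)
      · exact Or.inr (aux q h)
    have fin : ∀ r : MvPolynomial (Fin n) K, X ⊆ zeroLocus {r} → r ∈ coneIdeal X := by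
      intro r hr
      rw [mem_coneIdeal]
      rintro v ⟨hv, hvX⟩
      exact hr hvX r rfl v hv rfl
    rcases hirr _ _ (zClosed_zeroLocus _) (zClosed_zeroLocus _) key with h | h
    · exact Or.inl (fin p h)
    · exact Or.inr (fin q h)

theorem homogeneousComponent_mem_coneIdeal [Infinite K] {n : ℕ} {X : Set (PP K n)}
    {p : MvPolynomial (Fin n) K} (hp : p ∈ coneIdeal X) (d : ℕ) :
    homogeneousComponent d p ∈ coneIdeal X :=
  mem_coneIdeal.2 fun _ hv => eval_homogeneousComponent_eq_zero
    (fun _ ht => mem_coneIdeal.1 hp _ (smul_mem_cone hv ht)) d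

/-! ### Products of projective spaces: cones over subsets of a product -/

/-- Pairs of nonzero representatives of the points of a set in a product of projective spaces. -/
def bicone {a b : ℕ} (X : Set (PP K a × PP K b)) : Set (Fin a ⊕ Fin b → K) :=
  {x | ∃ (u : Fin a → K) (hu : u ≠ 0) (v : Fin b → K) (hv : v ≠ 0),
    x = Sum.elim u v ∧ (Projectivization.mk K u hu, Projectivization.mk K v hv) ∈ X}

/-- The ideal of polynomials vanishing on the bicone over `X`. -/
def biconeIdeal {a b : ℕ} (X : Set (PP K a × PP K b)) :
    Ideal (MvPolynomial (Fin a ⊕ Fin b) K) :=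
  vanishingIdeal K (bicone X)

theorem mem_biconeIdeal {a b : ℕ} {X : Set (PP K a × PP K b)}
    {p : MvPolynomial (Fin a ⊕ Fin b) K} :
    p ∈ biconeIdeal X ↔ ∀ u (hu : u ≠ 0) v (hv : v ≠ 0),
      (Projectivization.mk K u hu, Projectivization.mk K v hv) ∈ X →
        eval (Sum.elim u v) p = 0 := by
  simp only [biconeIdeal, mem_vanishingIdeal_iff, aeval_eq_eval]
  constructor
  · intro h u hu v hv hX
    exact h _ ⟨u, hu, v, hv, rfl, hX⟩
  · rintro h _ ⟨u, hu, v, hv, rfl, hX⟩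
    exact h u hu v hv hX

theorem eval_eq_zero_of_components {σ : Type} (ω : σ → ℕ) {x : σ → K} {p : MvPolynomial σ K}
    (h : ∀ n, eval x (weightedHomogeneousComponent ω n p) = 0) : eval x p = 0 := by
  have h0 : scalePoly ω x p = 0 := by
    ext n
    rw [coeff_scalePoly, h, Polynomial.coeff_zero]
  have := eval_scalePoly ω x p 1
  rw [h0] at this
  simpa using this.symm

theorem isWeightedHomogeneous_component {σ : Type} {ω ω' : σ → ℕ} {p : MvPolynomial σ K} {d : ℕ}
    (hp : IsWeightedHomogeneous ω p d) (e : ℕ) :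
    IsWeightedHomogeneous ω (weightedHomogeneousComponent ω' e p) d := by
  classical
  intro m hm
  rw [coeff_weightedHomogeneousComponent] at hm
  split_ifs at hm
  · exact hp hm
  · exact absurd rfl hm

theorem vanishes2_mk {a b : ℕ} {p : MvPolynomial (Fin a ⊕ Fin b) K} {u : Fin a → K}
    {v : Fin b → K} (hu : u ≠ 0) (hv : v ≠ 0) :
    vanishes2 p (Projectivization.mk K u hu, Projectivization.mk K v hv) ↔
      ∀ s t : K, s ≠ 0 → t ≠ 0 → eval (Sum.elim (s • u) (t • v)) p = 0 := by
  constructor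
  · intro hp s t hs ht
    exact hp _ (smul_ne_zero hs hu) _ (smul_ne_zero ht hv) (mk_smul_eq hu hs) (mk_smul_eq hv ht)
  · intro hp u' hu' v' hv' h1 h2
    obtain ⟨s, rfl⟩ := (Projectivization.mk_eq_mk_iff' K _ _ hu' hu).1 h1
    obtain ⟨t, rfl⟩ := (Projectivization.mk_eq_mk_iff' K _ _ hv' hv).1 h2
    exact hp s t (by rintro rfl; simp at hu') (by rintro rfl; simp at hv')

theorem scale_left {a b : ℕ} (u : Fin a → K) (v : Fin b → K) (t : K) :
    (fun k => t ^ (Sum.elim (fun _ => (1 : ℕ)) (fun _ => 0) k : ℕ) * Sum.elim u v k) =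
      Sum.elim (t • u) v := by
  ext (k | k) <;> simp

theorem scale_right {a b : ℕ} (u : Fin a → K) (v : Fin b → K) (t : K) :
    (fun k => t ^ (Sum.elim (fun _ => (0 : ℕ)) (fun _ => 1) k : ℕ) * Sum.elim u v k) =
      Sum.elim u (t • v) := by
  ext (k | k) <;> simp

theorem vanishes2_of_isBiHomog {a b : ℕ} {p : MvPolynomial (Fin a ⊕ Fin b) K} (hp : IsBiHomog p)
    {u : Fin a → K} {v : Fin b → K} (hu : u ≠ 0) (hv : v ≠ 0)
    (h : eval (Sum.elim u v) p = 0) :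
    vanishes2 p (Projectivization.mk K u hu, Projectivization.mk K v hv) := by
  obtain ⟨d, e, h1, h2⟩ := hp
  rw [vanishes2_mk]
  intro s t _ _
  rw [← scale_left, eval_smul_of_isWeightedHomogeneous h1, ← scale_right,
    eval_smul_of_isWeightedHomogeneous h2, h, mul_zero, mul_zero]

theorem zClosed2_zeroLocus2 [Infinite K] {a b : ℕ} (S : Set (MvPolynomial (Fin a ⊕ Fin b) K)) :
    ZClosed2 (zeroLocus2 S) := by
  refine ⟨{q | ∃ p ∈ S, ∃ d e, q = weightedHomogeneousComponent
    (Sum.elim (fun _ => (0 : ℕ)) (fun _ => 1)) e (weightedHomogeneousComponent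
      (Sum.elim (fun _ => (1 : ℕ)) (fun _ => 0)) d p)}, ?_, ?_⟩
  · rintro _ ⟨p, _, d, e, rfl⟩
    exact ⟨d, e, isWeightedHomogeneous_component
      (weightedHomogeneousComponent_isWeightedHomogeneous d p) e,
      weightedHomogeneousComponent_isWeightedHomogeneous e _⟩
  · ext ⟨x, y⟩
    obtain ⟨u, hu, rfl⟩ := exists_rep x
    obtain ⟨v, hv, rfl⟩ := exists_rep y
    constructor
    · rintro hx _ ⟨p, hp, d, e, rfl⟩
      have hx' := (vanishes2_mk hu hv).1 (hx p hp)
      apply vanishes2_of_isBiHomog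
      · exact ⟨d, e, isWeightedHomogeneous_component
          (weightedHomogeneousComponent_isWeightedHomogeneous d p) e,
          weightedHomogeneousComponent_isWeightedHomogeneous e _⟩
      · apply eval_weightedHomogeneousComponent_eq_zero
        intro t ht
        rw [scale_right]
        apply eval_weightedHomogeneousComponent_eq_zero
        intro s hs
        rw [scale_left]
        exact hx' s t hs ht
    · intro hx p hp u' hu' v' hv' h1 h2
      apply eval_eq_zero_of_components (Sum.elim (fun _ => (1 : ℕ)) (fun _ => 0))
      intro d
      apply eval_eq_zero_of_components (Sum.elim (fun _ => (0 : ℕ)) (fun _ => 1))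
      intro e
      exact hx _ ⟨p, hp, d, e, rfl⟩ u' hu' v' hv' h1 h2

theorem ZClosed2.exists_isBiHomog {a b : ℕ} {X : Set (PP K a × PP K b)} (hX : ZClosed2 X)
    {u : Fin a → K} {v : Fin b → K} (hu : u ≠ 0) (hv : v ≠ 0)
    (h : (Projectivization.mk K u hu, Projectivization.mk K v hv) ∉ X) :
    ∃ p ∈ biconeIdeal X, IsBiHomog p ∧ eval (Sum.elim u v) p ≠ 0 := by
  obtain ⟨S, hS, hXS⟩ := hX
  by_contra! hcon
  apply h
  rw [hXS]
  intro p hp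
  refine vanishes2_of_isBiHomog (hS p hp) hu hv (hcon p ?_ (hS p hp))
  rw [mem_biconeIdeal]
  intro u' hu' v' hv' huv
  rw [hXS] at huv
  exact huv p hp u' hu' v' hv' rfl rfl

theorem biconeIdeal_anti {a b : ℕ} {X Y : Set (PP K a × PP K b)} (h : X ⊆ Y) :
    biconeIdeal Y ≤ biconeIdeal X := by
  apply vanishingIdeal_anti_mono
  rintro _ ⟨u, hu, v, hv, rfl, huv⟩
  exact ⟨u, hu, v, hv, rfl, h huv⟩

theorem biconeIdeal_lt {a b : ℕ} {X Y : Set (PP K a × PP K b)} (hX : ZClosed2 X) (h : X < Y) :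
    biconeIdeal Y < biconeIdeal X := by
  refine lt_of_le_not_ge (biconeIdeal_anti h.le) fun hle => h.not_ge ?_
  rintro ⟨x, y⟩ hxy
  obtain ⟨u, hu, rfl⟩ := exists_rep x
  obtain ⟨v, hv, rfl⟩ := exists_rep y
  by_contra hcon
  obtain ⟨p, hp, -, hp0⟩ := hX.exists_isBiHomog hu hv hcon
  exact hp0 (mem_biconeIdeal.1 (hle hp) u hu v hv hxy)

theorem exists_eval_ne_zero [Infinite K] {σ : Type} {p : MvPolynomial σ K} (hp : p ≠ 0) :
    ∃ x : σ → K, eval x p ≠ 0 := by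
  by_contra! h
  exact hp (MvPolynomial.funext fun x => by simp [h x])

/-- The polynomial in two scaling parameters obtained from a polynomial and a point. -/
noncomputable def biscalePoly {a b : ℕ} (u : Fin a → K) (v : Fin b → K)
    (p : MvPolynomial (Fin a ⊕ Fin b) K) : MvPolynomial Bool K :=
  aeval (Sum.elim (fun k => C (u k) * X true) (fun k => C (v k) * X false)) p

theorem eval_biscalePoly {a b : ℕ} (u : Fin a → K) (v : Fin b → K)
    (p : MvPolynomial (Fin a ⊕ Fin b) K) (s : Bool → K) :
    eval s (biscalePoly u v p) = eval (Sum.elim (s true • u) (s false • v)) p := by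
  have : ((eval s).comp (aeval (R := K) (Sum.elim (fun k => C (u k) * X true)
      (fun k => C (v k) * X false) : Fin a ⊕ Fin b → MvPolynomial Bool K)).toRingHom) =
      eval (Sum.elim (s true • u) (s false • v)) := by
    apply MvPolynomial.ringHom_ext
    · intro r; simp
    · rintro (i | i) <;> simp [mul_comm]
  exact DFunLike.congr_fun this p

theorem isPrime_biconeIdeal [Infinite K] {a b : ℕ} {X : Set (PP K a × PP K b)}
    (hX : ZIrred2 X) : (biconeIdeal X).IsPrime := by
  obtain ⟨⟨⟨x, y⟩, hxy⟩, hirr⟩ := hX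
  refine Ideal.isPrime_iff.2 ⟨?_, ?_⟩
  · rw [Ideal.ne_top_iff_one]
    obtain ⟨u, hu, rfl⟩ := exists_rep x
    obtain ⟨v, hv, rfl⟩ := exists_rep y
    intro h1
    simpa using mem_biconeIdeal.1 h1 u hu v hv hxy
  · intro p q hpq
    have key : X ⊆ zeroLocus2 {p} ∪ zeroLocus2 {q} := by
      rintro ⟨x, y⟩ hxy
      obtain ⟨u, hu, rfl⟩ := exists_rep x
      obtain ⟨v, hv, rfl⟩ := exists_rep y
      have h0 : biscalePoly u v p * biscalePoly u v q = 0 := by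
        by_contra hne
        obtain ⟨s, hs⟩ := exists_eval_ne_zero
          (mul_ne_zero hne (mul_ne_zero (X_ne_zero true) (X_ne_zero false)))
        rw [map_mul, map_mul, map_mul, eval_X, eval_X, eval_biscalePoly, eval_biscalePoly] at hs
        have hs' := mul_ne_zero_iff.1 hs
        have hs'' := mul_ne_zero_iff.1 hs'.2
        apply hs'.1
        rw [← map_mul]
        refine mem_biconeIdeal.1 hpq _ (smul_ne_zero hs''.1 hu) _ (smul_ne_zero hs''.2 hv) ?_
        rwa [mk_smul_eq hu hs''.1, mk_smul_eq hv hs''.2]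
      have aux : ∀ r : MvPolynomial (Fin a ⊕ Fin b) K, biscalePoly u v r = 0 →
          (Projectivization.mk K u hu, Projectivization.mk K v hv) ∈ zeroLocus2 {r} := by
        rintro r hr _ rfl
        rw [vanishes2_mk]
        intro s t _ _
        have := eval_biscalePoly u v _ (fun i => bif i then s else t) ▸
          congrArg (eval (fun i => bif i then s else t)) hr
        simpa using this
      rcases mul_eq_zero.1 h0 with h | h
      · exact Or.inl (aux p h)
      · exact Or.inr (aux q h)
    have fin : ∀ r : MvPolynomial (Fin a ⊕ Fin b) K, X ⊆ zeroLocus2 {r} →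
        r ∈ biconeIdeal X := by
      intro r hr
      rw [mem_biconeIdeal]
      intro u hu v hv huv
      exact hr huv r rfl u hu v hv rfl rfl
    rcases hirr _ _ (zClosed2_zeroLocus2 _) (zClosed2_zeroLocus2 _) key with h | h
    · exact Or.inl (fin p h)
    · exact Or.inr (fin q h)

/-! ### Algebraically independent families in quotients of polynomial rings -/

/-- The quotient by `P` contains `n` algebraically independent elements. -/
def HasIndep {σ : Type} (n : ℕ) (P : Ideal (MvPolynomial σ K)) : Prop :=
  ∃ x : Fin n → MvPolynomial σ K, AlgebraicIndependent K fun i => Ideal.Quotient.mk P (x i)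

theorem HasIndep.mono {σ : Type} {n : ℕ} {P P' : Ideal (MvPolynomial σ K)} (h : P ≤ P')
    (hn : HasIndep n P') : HasIndep n P := by
  obtain ⟨x, hx⟩ := hn
  exact ⟨x, AlgebraicIndependent.of_comp (Ideal.Quotient.factorₐ K h) hx⟩

theorem HasIndep.succ {σ : Type} {n : ℕ} {P P' : Ideal (MvPolynomial σ K)} [P.IsPrime]
    (h : P < P') (hn : HasIndep n P') : HasIndep (n + 1) P := by
  obtain ⟨x, hx⟩ := hn
  obtain ⟨g, hg', hg⟩ := Set.exists_of_ssubset h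
  let π : MvPolynomial σ K ⧸ P →ₐ[K] MvPolynomial σ K ⧸ P' := Ideal.Quotient.factorₐ K h.le
  have hπ : ∀ y, π (Ideal.Quotient.mk P y) = Ideal.Quotient.mk P' y := fun y => rfl
  let ev : MvPolynomial (Fin n) K →ₐ[K] MvPolynomial σ K ⧸ P :=
    aeval fun i => Ideal.Quotient.mk P (x i)
  have hev : ∀ c, π (ev c) = aeval (fun i => Ideal.Quotient.mk P' (x i)) c := by
    intro c
    have : π.comp ev = aeval (fun i => Ideal.Quotient.mk P' (x i)) := by
      ext i; simp [ev, hπ]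
    exact DFunLike.congr_fun this c
  have key : ∀ m (F : Polynomial (MvPolynomial (Fin n) K)), F.natDegree ≤ m →
      F.eval₂ ev.toRingHom (Ideal.Quotient.mk P g) = 0 → F = 0 := by
    intro m
    induction m with
    | zero =>
      intro F hF h0
      rw [Polynomial.eq_C_of_natDegree_le_zero hF] at h0 ⊢
      rw [Polynomial.eval₂_C] at h0
      have := hev (F.coeff 0)
      rw [show ev (F.coeff 0) = 0 from h0, map_zero] at this
      rw [hx.eq_zero_of_aeval_eq_zero _ this.symm, map_zero]
    | succ m ih =>
      intro F hF h0
      rw [← Polynomial.divX_mul_X_add F] at h0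
      simp only [Polynomial.eval₂_add, Polynomial.eval₂_mul, Polynomial.eval₂_X,
        Polynomial.eval₂_C] at h0
      have h1 := congrArg π h0
      rw [map_add, map_mul, hπ g, Ideal.Quotient.eq_zero_iff_mem.2 hg', mul_zero, zero_add,
        map_zero] at h1
      have h2 := hev (F.coeff 0)
      rw [show π (ev (F.coeff 0)) = 0 from h1] at h2
      have h3 := hx.eq_zero_of_aeval_eq_zero _ h2.symm
      rw [h3, map_zero, add_zero] at h0
      rcases mul_eq_zero.1 h0 with h4 | h4
      · rw [← Polynomial.divX_mul_X_add F, h3, ih F.divX (by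
          rw [Polynomial.natDegree_divX_eq_natDegree_tsub_one]; omega) h4]
        simp
      · exact absurd (Ideal.Quotient.eq_zero_iff_mem.1 h4) hg
  refine ⟨Fin.cons g x, ?_⟩
  rw [algebraicIndependent_iff]
  intro f hf
  have : f = (finSuccEquiv K n).symm (finSuccEquiv K n f) := by simp
  rw [this, key _ (finSuccEquiv K n f) le_rfl ?_, map_zero]
  rw [← hf]
  have h5 : ((Polynomial.eval₂RingHom ev.toRingHom (Ideal.Quotient.mk P g)).comp
      (finSuccEquiv K n).toRingEquiv.toRingHom) = (aeval (R := K) fun i =>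
        Ideal.Quotient.mk P ((Fin.cons g x : Fin (n + 1) → MvPolynomial σ K) i)).toRingHom := by
    apply MvPolynomial.ringHom_ext
    · intro r
      simp [finSuccEquiv_apply, ev]
    · intro i
      refine Fin.cases ?_ (fun j => ?_) i <;> simp [finSuccEquiv_apply, ev]
  exact DFunLike.congr_fun h5 f

theorem HasIndep.chain {σ : Type} {n : ℕ} (k : ℕ) (I : Fin (k + 1) → Ideal (MvPolynomial σ K))
    (hI : ∀ i, (I i).IsPrime) (hs : StrictAnti I) (h0 : HasIndep n (I 0)) :
    HasIndep (n + k) (I (Fin.last k)) := by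
  induction k with
  | zero => exact h0
  | succ k ih =>
    have := ih (fun i => I i.castSucc) (fun i => hI _)
      (fun i j hij => hs (Fin.castSucc_lt_castSucc_iff.2 hij)) h0
    have hp := hI (Fin.last (k + 1))
    exact this.succ (hs (Fin.castSucc_lt_last (Fin.last k)))

theorem HasIndep.le_of_isAlgebraic {σ : Type} {n m : ℕ} {P : Ideal (MvPolynomial σ K)}
    [P.IsPrime] (h : HasIndep n P) (s : Fin m → MvPolynomial σ K ⧸ P)
    (hs : Algebra.IsAlgebraic (Algebra.adjoin K (Set.range s)) (MvPolynomial σ K ⧸ P)) :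
    n ≤ m := by
  obtain ⟨x, hx⟩ := h
  have h1 := hx.lift_cardinalMk_le_trdeg
  have h2 := Algebra.IsAlgebraic.trdeg_le_cardinalMk K (Set.range s)
  have h3 : Cardinal.mk (Set.range s) ≤ m := by
    simpa using Cardinal.mk_range_le_lift (f := s)
  have h4 := (h2.trans h3)
  simp only [Cardinal.mk_fin, Cardinal.lift_id] at h1
  exact_mod_cast h1.trans h4

theorem eval_aeval {σ τ : Type} (x : σ → K) (g : τ → MvPolynomial σ K) (f : MvPolynomial τ K) :
    eval x (aeval g f) = eval (fun i => eval x (g i)) f := by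
  have : (eval x).comp (aeval (R := K) g).toRingHom = eval (fun i => eval x (g i)) := by
    apply MvPolynomial.ringHom_ext
    · intro r; simp
    · intro i; simp
  exact DFunLike.congr_fun this f

theorem hasIndep_coneIdeal [Infinite K] {n : ℕ} {X : Set (PP K n)} (hX : X.Nonempty) :
    HasIndep 1 (coneIdeal X) := by
  obtain ⟨x, hx⟩ := hX
  obtain ⟨v, hv, rfl, hvX⟩ := exists_mem_cone hx
  obtain ⟨k, hk⟩ := Function.ne_iff.1 hv
  refine ⟨fun _ => MvPolynomial.X k, ?_⟩
  rw [algebraicIndependent_iff]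
  intro f hf
  have h1 : aeval (fun _ : Fin 1 => (MvPolynomial.X k : MvPolynomial (Fin n) K)) f ∈
      coneIdeal X := by
    rw [← Ideal.Quotient.eq_zero_iff_mem, ← hf]
    exact (aeval_algebraMap_apply (MvPolynomial (Fin n) K ⧸ coneIdeal X) _ f).symm
  by_contra hne
  obtain ⟨s, hs⟩ := exists_eval_ne_zero (mul_ne_zero hne (X_ne_zero (R := K) (0 : Fin 1)))
  rw [map_mul, eval_X] at hs
  obtain ⟨hs1, hs2⟩ := mul_ne_zero_iff.1 hs
  have h2 := mem_coneIdeal.1 h1 _ (smul_mem_cone hvX (c := s 0 / v k) (div_ne_zero hs2 hk))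
  apply hs1
  rw [← h2, eval_aeval]
  congr 2
  ext i
  fin_cases i
  simpa using (div_mul_cancel₀ _ hk).symm

theorem hasIndep_biconeIdeal [Infinite K] {a b : ℕ} {X : Set (PP K a × PP K b)}
    (hX : X.Nonempty) : HasIndep 2 (biconeIdeal X) := by
  obtain ⟨⟨x, y⟩, hx⟩ := hX
  obtain ⟨u, hu, rfl⟩ := exists_rep x
  obtain ⟨v, hv, rfl⟩ := exists_rep y
  obtain ⟨k, hk⟩ := Function.ne_iff.1 hu
  obtain ⟨l, hl⟩ := Function.ne_iff.1 hv
  refine ⟨![MvPolynomial.X (Sum.inl k), MvPolynomial.X (Sum.inr l)], ?_⟩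
  rw [algebraicIndependent_iff]
  intro f hf
  have h1 : aeval ![(MvPolynomial.X (Sum.inl k) : MvPolynomial (Fin a ⊕ Fin b) K),
      MvPolynomial.X (Sum.inr l)] f ∈ biconeIdeal X := by
    rw [← Ideal.Quotient.eq_zero_iff_mem, ← hf]
    exact (aeval_algebraMap_apply (MvPolynomial (Fin a ⊕ Fin b) K ⧸ biconeIdeal X) _ f).symm
  by_contra hne
  obtain ⟨s, hs⟩ := exists_eval_ne_zero (mul_ne_zero hne
    (mul_ne_zero (X_ne_zero (R := K) (0 : Fin 2)) (X_ne_zero (R := K) (1 : Fin 2))))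
  rw [map_mul, map_mul, eval_X, eval_X] at hs
  obtain ⟨hs1, hs2⟩ := mul_ne_zero_iff.1 hs
  obtain ⟨hs2, hs3⟩ := mul_ne_zero_iff.1 hs2
  have hc := div_ne_zero hs2 hk
  have hc' := div_ne_zero hs3 hl
  have h2 := mem_biconeIdeal.1 h1 _ (smul_ne_zero hc hu) _ (smul_ne_zero hc' hv)
    (by rwa [mk_smul_eq hu hc, mk_smul_eq hv hc'])
  apply hs1
  rw [← h2, eval_aeval]
  congr 2
  ext i
  fin_cases i
  · simpa using (div_mul_cancel₀ _ hk).symm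
  · simpa using (div_mul_cancel₀ _ hl).symm

/-! ### Integrality and projections -/

/-! ### Graded Nullstellensatz and finiteness of linear projections -/

theorem homogeneousComponent_mul_of_isHomogeneous {σ : Type} {a : ℕ} {L : MvPolynomial σ K}
    (hL : L.IsHomogeneous a) (p : MvPolynomial σ K) (n : ℕ) :
    homogeneousComponent (a + n) (L * p) = L * homogeneousComponent n p := by
  classical
  conv_lhs => rw [← sum_homogeneousComponent p, Finset.mul_sum, map_sum]
  have h1 : ∀ i, homogeneousComponent (a + n) (L * homogeneousComponent i p) =
      if i = n then L * homogeneousComponent n p else 0 := by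
    intro i
    rw [homogeneousComponent_of_mem (hL.mul (homogeneousComponent_isHomogeneous i p))]
    by_cases h : i = n
    · simp [h]
    · simp [h, Ne.symm h]
  simp_rw [h1]
  rw [Finset.sum_ite_eq']
  split_ifs with h
  · rfl
  · rw [homogeneousComponent_eq_zero, mul_zero]
    simpa using h

theorem degree_eq_of_isHomogeneous {σ : Type} {m : ℕ} {p : MvPolynomial σ K}
    (hp : p.IsHomogeneous m) {d : σ →₀ ℕ} (hd : coeff d p ≠ 0) : d.degree = m := by
  have := hp hd
  rwa [show (1 : σ → ℕ) = fun _ => 1 from rfl, ← Finsupp.degree_eq_weight_one] at this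

theorem exists_pow_le_of_zeros [IsAlgClosed K] {n : ℕ} {J : Ideal (MvPolynomial (Fin n) K)}
    (hJ : ∀ v : Fin n → K, (∀ p ∈ J, eval v p = 0) → v = 0) :
    ∃ N, ∀ m, N ≤ m → ∀ p : MvPolynomial (Fin n) K, p.IsHomogeneous m → p ∈ J := by
  have hrad : idealOfVars (Fin n) K ≤ J.radical := by
    rw [← vanishingIdeal_zeroLocus_eq_radical (K := K), idealOfVars, Ideal.span_le]
    rintro _ ⟨i, rfl⟩
    rw [SetLike.mem_coe, mem_vanishingIdeal_iff]
    intro v hv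
    have : v = 0 := hJ v fun p hp => by simpa [aeval_eq_eval] using hv p hp
    simp [this]
  obtain ⟨N, hN⟩ := Ideal.exists_pow_le_of_le_radical_of_fg hrad (idealOfVars_fg _ _)
  refine ⟨N, fun m hm p hp => hN ?_⟩
  rw [mem_pow_idealOfVars_iff]
  intro d hd
  rw [show d.degree = m from ?_]
  · exact hm
  · exact degree_eq_of_isHomogeneous hp (mem_support_iff.1 hd)

theorem exists_homogeneous_decomp [IsAlgClosed K] {n r : ℕ} {X : Set (PP K n)} (hX : ZClosed X)
    (g : Fin r → MvPolynomial (Fin n) K) (hg : ∀ j, (g j).IsHomogeneous 1)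
    (h0 : ∀ v ∈ cone X, ∃ j, eval v (g j) ≠ 0) :
    ∃ N, ∀ m, N ≤ m → ∀ p : MvPolynomial (Fin n) K, p.IsHomogeneous (m + 1) →
      ∃ f ∈ coneIdeal X, ∃ κ : Fin r → MvPolynomial (Fin n) K, f.IsHomogeneous (m + 1) ∧
        (∀ j, (κ j).IsHomogeneous m) ∧ p = f + ∑ j, g j * κ j := by
  obtain ⟨N, hN⟩ := exists_pow_le_of_zeros (J := coneIdeal X ⊔ Ideal.span (Set.range g)) (by
    intro v hv
    by_contra hne
    have hvX : v ∈ cone X :=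
      (hX.mem_cone_iff hne).2 fun p hp => hv p (Ideal.mem_sup_left hp)
    obtain ⟨j, hj⟩ := h0 v hvX
    exact hj (hv _ (Ideal.mem_sup_right (Ideal.subset_span ⟨j, rfl⟩))))
  refine ⟨N, fun m hm p hp => ?_⟩
  obtain ⟨f, hf, q, hq, hfq⟩ := Submodule.mem_sup.1 (hN (m + 1) (by omega) p hp)
  obtain ⟨c, rfl⟩ := Ideal.mem_span_range_iff_exists_fun.1 hq
  refine ⟨homogeneousComponent (m + 1) f, homogeneousComponent_mem_coneIdeal hf _,
    fun j => homogeneousComponent m (c j), homogeneousComponent_isHomogeneous _ _,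
    fun j => homogeneousComponent_isHomogeneous _ _, ?_⟩
  conv_lhs => rw [← homogeneousComponent_eq_self hp, ← hfq, map_add, map_sum]
  congr 1
  refine Finset.sum_congr rfl fun j _ => ?_
  rw [mul_comm, add_comm m 1, homogeneousComponent_mul_of_isHomogeneous (hg j)]

theorem isIntegral_adjoin_of_no_common_zero [IsAlgClosed K] {n r : ℕ} {X : Set (PP K n)}
    (hX : ZClosed X) (g : Fin r → MvPolynomial (Fin n) K) (hg : ∀ j, (g j).IsHomogeneous 1)
    (h0 : ∀ v ∈ cone X, ∃ j, eval v (g j) ≠ 0) :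
    Algebra.IsIntegral (Algebra.adjoin K (Set.range fun j => Ideal.Quotient.mk (coneIdeal X) (g j)))
      (MvPolynomial (Fin n) K ⧸ coneIdeal X) := by
  classical
  obtain ⟨N, hN⟩ := exists_homogeneous_decomp hX g hg h0
  set A := Algebra.adjoin K (Set.range fun j => Ideal.Quotient.mk (coneIdeal X) (g j)) with hA
  let T : Set (Fin n →₀ ℕ) := {d | d.degree ≤ N}
  have hT : T.Finite := Finsupp.finite_of_degree_le N
  let M : Submodule A (MvPolynomial (Fin n) K ⧸ coneIdeal X) :=
    Submodule.span A ((fun d => Ideal.Quotient.mk (coneIdeal X) (monomial d (1 : K))) '' T)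
  have hC : ∀ (c : K) (x), x ∈ M → algebraMap K _ c * x ∈ M := by
    intro c x hx
    exact M.smul_mem (algebraMap K A c) hx
  have hsmall : ∀ m, m ≤ N → ∀ p : MvPolynomial (Fin n) K, p.IsHomogeneous m →
      Ideal.Quotient.mk (coneIdeal X) p ∈ M := by
    intro m hm p hp
    rw [p.as_sum, map_sum]
    refine M.sum_mem fun d hd => ?_
    rw [← mul_one (coeff d p), ← C_mul_monomial, map_mul]
    refine hC _ _ (Submodule.subset_span ⟨d, ?_, rfl⟩)
    exact (degree_eq_of_isHomogeneous hp (mem_support_iff.1 hd)).trans_le hm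
  have hhom : ∀ m (p : MvPolynomial (Fin n) K), p.IsHomogeneous m →
      Ideal.Quotient.mk (coneIdeal X) p ∈ M := by
    intro m
    induction m with
    | zero =>
      intro p hp
      exact hsmall 0 (Nat.zero_le N) p hp
    | succ m ih =>
      intro p hp
      by_cases hm : N ≤ m
      · obtain ⟨f, hf, κ, -, hκ, rfl⟩ := hN m hm p hp
        rw [map_add, Ideal.Quotient.eq_zero_iff_mem.2 hf, zero_add, map_sum]
        refine M.sum_mem fun j _ => ?_
        rw [map_mul]
        exact M.smul_mem ⟨Ideal.Quotient.mk (coneIdeal X) (g j),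
          Algebra.subset_adjoin ⟨j, rfl⟩⟩ (ih (κ j) (hκ j))
      · exact hsmall (m + 1) (by omega) p hp
  have htop : M = ⊤ := by
    rw [eq_top_iff]
    rintro x -
    obtain ⟨p, rfl⟩ := Ideal.Quotient.mk_surjective x
    rw [← sum_homogeneousComponent p, map_sum]
    exact M.sum_mem fun i _ => hhom i _ (homogeneousComponent_isHomogeneous i p)
  have hfin : Module.Finite A (MvPolynomial (Fin n) K ⧸ coneIdeal X) := by
    refine ⟨?_⟩
    rw [← htop]
    exact Submodule.fg_span (hT.image _)
  infer_instance

/-! ### Elimination for bilinear incidence relations -/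

theorem zClosed_of_separated [Infinite K] {n : ℕ} {Y : Set (PP K n)}
    (h : ∀ v : Fin n → K, v ≠ 0 → v ∉ cone Y → ∃ q ∈ coneIdeal Y, eval v q ≠ 0) : ZClosed Y := by
  have : Y = zeroLocus (coneIdeal Y : Set (MvPolynomial (Fin n) K)) := by
    ext y
    obtain ⟨v, hv, rfl⟩ := exists_rep y
    constructor
    · intro hy p hp
      rw [vanishes_mk]
      intro t ht
      exact mem_coneIdeal.1 hp _ (smul_mem_cone ⟨hv, hy⟩ ht)
    · intro hy
      by_contra hcon
      obtain ⟨q, hq, hq0⟩ := h v hv fun ⟨_, h'⟩ => hcon h'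
      exact hq0 (hy q hq v hv rfl)
  rw [this]
  exact zClosed_zeroLocus _

theorem eval_eq_sum_of_isHomogeneous {n m : ℕ} [Fintype {d : Fin n →₀ ℕ // d.degree = m}]
    {p : MvPolynomial (Fin n) K} (hp : p.IsHomogeneous m) (w : Fin n → K) :
    eval w p = ∑ β : {d : Fin n →₀ ℕ // d.degree = m},
      coeff β.1 p * eval w (monomial β.1 (1 : K)) := by
  classical
  have : p = ∑ β : {d : Fin n →₀ ℕ // d.degree = m}, C (coeff β.1 p) * monomial β.1 (1 : K) := by
    ext d
    simp only [coeff_sum, coeff_C_mul, coeff_monomial]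
    by_cases hd : d.degree = m
    · rw [Finset.sum_eq_single ⟨d, hd⟩]
      · simp
      · intro b _ hb
        rw [if_neg fun h => hb (Subtype.ext h), mul_zero]
      · simp
    · rw [Finset.sum_eq_zero]
      · by_contra h
        exact hd (degree_eq_of_isHomogeneous hp h)
      · intro b _
        rw [if_neg (by rintro rfl; exact hd b.2), mul_zero]
  conv_lhs => rw [this, map_sum]
  simp only [map_mul, eval_C]

theorem zClosed_of_bilinear [IsAlgClosed K] {n b r : ℕ} {X : Set (PP K n)} (hX : ZClosed X)
    {Y : Set (PP K b)} (ℓ : Fin r → Fin b → MvPolynomial (Fin n) K)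
    (hℓ : ∀ j i, (ℓ j i).IsHomogeneous 1)
    (hY : ∀ v : Fin b → K, v ≠ 0 →
      (v ∈ cone Y ↔ ∃ w ∈ cone X, ∀ j, ∑ i, v i * eval w (ℓ j i) = 0)) : ZClosed Y := by
  classical
  apply zClosed_of_separated
  intro v₀ hv₀ hv₀Y
  rw [hY v₀ hv₀] at hv₀Y
  push Not at hv₀Y
  obtain ⟨N, hN⟩ := exists_homogeneous_decomp hX (fun j => ∑ i, C (v₀ i) * ℓ j i)
    (fun j => IsHomogeneous.sum _ _ _ fun i _ => by
      simpa using (isHomogeneous_C (Fin n) (v₀ i)).mul (hℓ j i))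
    (fun w hw => by
      obtain ⟨j, hj⟩ := hv₀Y w hw
      exact ⟨j, by simpa using hj⟩)
  have : Finite {d : Fin n →₀ ℕ // d.degree = N + 1} := Finsupp.finite_of_degree_eq (N + 1)
  have := Fintype.ofFinite {d : Fin n →₀ ℕ // d.degree = N + 1}
  choose f hf κ hfh hκ hdec using fun α : {d : Fin n →₀ ℕ // d.degree = N + 1} =>
    hN N le_rfl (monomial α.1 1) (isHomogeneous_monomial _ α.2)
  let M : Matrix {d : Fin n →₀ ℕ // d.degree = N + 1} {d : Fin n →₀ ℕ // d.degree = N + 1}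
      (MvPolynomial (Fin b) K) := fun α β =>
    C (coeff β.1 (f α)) + ∑ j, ∑ i, MvPolynomial.X i * C (coeff β.1 (ℓ j i * κ α j))
  have hMv : ∀ v α β, eval v (M α β) =
      coeff β.1 (f α + ∑ j, (∑ i, C (v i) * ℓ j i) * κ α j) := by
    intro v α β
    simp only [M, map_add, map_sum, map_mul, eval_C, eval_X, coeff_add, coeff_sum,
      Finset.sum_mul, mul_assoc, coeff_C_mul]
  refine ⟨M.det, ?_, ?_⟩
  · rw [mem_coneIdeal]
    intro v hv
    obtain ⟨w, hw, hwv⟩ := (hY v hv.1).1 hv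
    rw [RingHom.map_det, ← Matrix.exists_mulVec_eq_zero_iff]
    refine ⟨fun β => eval w (monomial β.1 (1 : K)), ?_, ?_⟩
    · obtain ⟨k, hk⟩ := Function.ne_iff.1 hw.1
      rw [Function.ne_iff]
      refine ⟨⟨Finsupp.single k (N + 1), by simp⟩, ?_⟩
      rw [Pi.zero_apply, eval_monomial, one_mul,
        Finsupp.prod_single_index (h := fun n e => w n ^ e) (pow_zero _)]
      exact pow_ne_zero _ hk
    · ext α
      have hhom : (f α + ∑ j, (∑ i, C (v i) * ℓ j i) * κ α j).IsHomogeneous (N + 1) := by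
        refine (hfh α).add (IsHomogeneous.sum _ _ _ fun j _ => ?_)
        rw [add_comm N 1]
        exact (IsHomogeneous.sum _ _ _ fun i _ => by
          simpa using (isHomogeneous_C (Fin n) (v i)).mul (hℓ j i)).mul (hκ α j)
      simp only [Matrix.mulVec, dotProduct, RingHom.mapMatrix_apply, Matrix.map_apply, hMv,
        Pi.zero_apply]
      rw [← eval_eq_sum_of_isHomogeneous hhom]
      simp only [map_add, map_sum, map_mul, eval_C, mem_coneIdeal.1 (hf α) w hw, hwv, zero_mul,
        Finset.sum_const_zero, add_zero]
  · have : (eval v₀).mapMatrix M = 1 := by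
      ext α β
      rw [RingHom.mapMatrix_apply, Matrix.map_apply, hMv, ← hdec, coeff_monomial,
        Matrix.one_apply]
      simp [Subtype.ext_iff]
    rw [RingHom.map_det, this, Matrix.det_one]
    exact one_ne_zero

/-! ### Bivectors and lines -/

/-! ### Plücker algebra -/

/-- Contraction of the bivector `w` with the covector `φ`. -/
def contr (w : Fin 6 → K) (φ : Fin 4 → K) : Fin 4 → K :=
  ![-(φ 1 * w 0) - φ 2 * w 1 - φ 3 * w 2, φ 0 * w 0 - φ 2 * w 3 - φ 3 * w 4,
    φ 0 * w 1 + φ 1 * w 3 - φ 3 * w 5, φ 0 * w 2 + φ 1 * w 4 + φ 2 * w 5]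

theorem wedgePt_contr {w : Fin 6 → K} (hw : plQuad w = 0) (φ : Fin 4 → K) :
    wedgePt w (contr w φ) = 0 := by
  unfold plQuad at hw
  ext i
  fin_cases i <;> simp [wedgePt, contr]
  · linear_combination -φ 3 * hw
  · linear_combination φ 2 * hw
  · linear_combination -φ 1 * hw
  · linear_combination φ 0 * hw

theorem exists_contr_eq {w : Fin 6 → K} (hw : w ≠ 0) {v : Fin 4 → K} (hv : wedgePt w v = 0) :
    ∃ φ, contr w φ = v := by
  have h0 := congrFun hv 0
  have h1 := congrFun hv 1
  have h2 := congrFun hv 2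
  have h3 := congrFun hv 3
  simp [wedgePt] at h0 h1 h2 h3
  obtain ⟨i, hi⟩ := Function.ne_iff.1 hw
  fin_cases i <;> simp at hi
  · refine ⟨![v 1 / w 0, -v 0 / w 0, 0, 0], ?_⟩
    ext j; fin_cases j <;> simp [contr] <;> field_simp
    · linear_combination -h0
    · linear_combination -h1
  · refine ⟨![v 2 / w 1, 0, -v 0 / w 1, 0], ?_⟩
    ext j; fin_cases j <;> simp [contr] <;> field_simp
    · linear_combination h0
    · linear_combination -h2
  · refine ⟨![v 3 / w 2, 0, 0, -v 0 / w 2], ?_⟩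
    ext j; fin_cases j <;> simp [contr] <;> field_simp
    · linear_combination h1
    · linear_combination h2
  · refine ⟨![0, v 2 / w 3, -v 1 / w 3, 0], ?_⟩
    ext j; fin_cases j <;> simp [contr] <;> field_simp
    · linear_combination -h0
    · linear_combination -h3
  · refine ⟨![0, v 3 / w 4, 0, -v 1 / w 4], ?_⟩
    ext j; fin_cases j <;> simp [contr] <;> field_simp
    · linear_combination -h1
    · linear_combination h3
  · refine ⟨![0, 0, v 3 / w 5, -v 2 / w 5], ?_⟩
    ext j; fin_cases j <;> simp [contr] <;> field_simp
    · linear_combination -h2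
    · linear_combination -h3

theorem exists_contr_ne_zero {w : Fin 6 → K} (hw : w ≠ 0) : ∃ φ, contr w φ ≠ 0 := by
  by_contra! h
  apply hw
  have h0 := h ![1, 0, 0, 0]
  have h1 := h ![0, 1, 0, 0]
  have h2 := h ![0, 0, 1, 0]
  ext i
  fin_cases i
  · simpa [contr] using congrFun h0 1
  · simpa [contr] using congrFun h0 2
  · simpa [contr] using congrFun h0 3
  · simpa [contr] using congrFun h1 2
  · simpa [contr] using congrFun h1 3
  · simpa [contr] using congrFun h2 3

theorem wedgePt_smul_smul (s t : K) (w : Fin 6 → K) (v : Fin 4 → K) :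
    wedgePt (s • w) (t • v) = (s * t) • wedgePt w v := by
  ext i
  fin_cases i <;> simp [wedgePt] <;> ring

theorem wedgePt_add (w : Fin 6 → K) (u v : Fin 4 → K) :
    wedgePt w (u + v) = wedgePt w u + wedgePt w v := by
  ext i
  fin_cases i <;> simp [wedgePt] <;> ring

theorem wedgePt_smul (w : Fin 6 → K) (t : K) (v : Fin 4 → K) :
    wedgePt w (t • v) = t • wedgePt w v := by
  simpa using wedgePt_smul_smul 1 t w v

theorem plQuad_smul (s : K) (w : Fin 6 → K) : plQuad (s • w) = s ^ 2 * plQuad w := by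
  simp [plQuad]; ring

theorem mk_mem_lineOfRep {w : Fin 6 → K} {v : Fin 4 → K} (hv : v ≠ 0) :
    Projectivization.mk K v hv ∈ lineOfRep w ↔ wedgePt w v = 0 := by
  refine ⟨fun h => h v hv rfl, fun h u hu huv => ?_⟩
  obtain ⟨t, rfl⟩ := (Projectivization.mk_eq_mk_iff' K _ _ hu hv).1 huv
  rw [wedgePt_smul, h, smul_zero]

theorem mk_mem_lineOf {w : Fin 6 → K} (hw : w ≠ 0) {v : Fin 4 → K} (hv : v ≠ 0) :
    Projectivization.mk K v hv ∈ lineOf (Projectivization.mk K w hw) ↔ wedgePt w v = 0 := by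
  refine ⟨fun h => (mk_mem_lineOfRep hv).1 (h w hw rfl), fun h u hu huw => ?_⟩
  obtain ⟨t, rfl⟩ := (Projectivization.mk_eq_mk_iff' K _ _ hu hw).1 huw
  rw [mk_mem_lineOfRep hv, ← one_smul K v, wedgePt_smul_smul, h, smul_zero]

theorem mk_mem_grass {w : Fin 6 → K} (hw : w ≠ 0) :
    Projectivization.mk K w hw ∈ grass K ↔ plQuad w = 0 := by
  refine ⟨fun ⟨u, hu, huw, h⟩ => ?_, fun h => ⟨w, hw, rfl, h⟩⟩
  obtain ⟨t, rfl⟩ := (Projectivization.mk_eq_mk_iff' K _ _ hw hu).1 huw.symm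
  rw [plQuad_smul, h, mul_zero]

theorem mk_mem_hyp {n : ℕ} {φ v : Fin n → K} (hv : v ≠ 0) :
    Projectivization.mk K v hv ∈ hyp φ ↔ ∑ i, φ i * v i = 0 := by
  refine ⟨fun h => h v hv rfl, fun h u hu huv => ?_⟩
  obtain ⟨t, rfl⟩ := (Projectivization.mk_eq_mk_iff' K _ _ hu hv).1 huv
  simp only [Pi.smul_apply, smul_eq_mul, mul_left_comm _ t, ← Finset.mul_sum, h, mul_zero]

theorem plQuad_of_mem_cone {C : Set (PP K 6)} (hC : C ⊆ grass K) {w : Fin 6 → K}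
    (hw : w ∈ cone C) : plQuad w = 0 :=
  (mk_mem_grass hw.1).1 (hC hw.2)

theorem contr_plucker (a b φ : Fin 4 → K) :
    contr (plucker a b) φ = (∑ i, φ i * a i) • b - (∑ i, φ i * b i) • a := by
  ext i
  fin_cases i <;> simp [contr, plucker, Fin.sum_univ_four] <;> ring

theorem plQuad_plucker (a b : Fin 4 → K) : plQuad (plucker a b) = 0 := by
  simp [plQuad, plucker]; ring

theorem plucker_contr {w : Fin 6 → K} (hw : plQuad w = 0) (φ ψ : Fin 4 → K) :
    plucker (contr w φ) (contr w ψ) =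
      (∑ i, ψ i * contr w φ i) • w := by
  unfold plQuad at hw
  ext i
  fin_cases i <;> simp [contr, plucker, Fin.sum_univ_four]
  · linear_combination -(φ 2 * ψ 3 - φ 3 * ψ 2) * hw
  · linear_combination -(-φ 1 * ψ 3 + φ 3 * ψ 1) * hw
  · linear_combination -(φ 1 * ψ 2 - φ 2 * ψ 1) * hw
  · linear_combination -(φ 0 * ψ 3 - φ 3 * ψ 0) * hw
  · linear_combination -(-φ 0 * ψ 2 + φ 2 * ψ 0) * hw
  · linear_combination -(φ 0 * ψ 1 - φ 1 * ψ 0) * hw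

theorem plucker_smul_right (a b : Fin 4 → K) (t : K) : plucker a (t • b) = t • plucker a b := by
  ext i
  fin_cases i <;> simp [plucker] <;> ring

theorem IsLineRep.exists_plucker {w : Fin 6 → K} (hw : IsLineRep w) :
    ∃ a b, w = plucker a b := by
  obtain ⟨φ, hφ⟩ := exists_contr_ne_zero hw.1
  obtain ⟨j, hj⟩ := Function.ne_iff.1 hφ
  refine ⟨contr w φ, (contr w φ j)⁻¹ • contr w (Pi.single j 1), ?_⟩
  rw [plucker_smul_right, plucker_contr hw.2, smul_smul]
  simp only [Pi.single_apply, ite_mul, one_mul, zero_mul, Finset.sum_ite_eq', Finset.mem_univ,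
    if_true]
  rw [inv_mul_cancel₀ hj, one_smul]

theorem wedgePt_plucker_comb (a b : Fin 4 → K) (s t : K) :
    wedgePt (plucker a b) (s • a + t • b) = 0 := by
  ext i
  fin_cases i <;> simp [wedgePt, plucker] <;> ring

theorem wedgePt_plucker_eq_zero {a b : Fin 4 → K} (hab : plucker a b ≠ 0) {v : Fin 4 → K} :
    wedgePt (plucker a b) v = 0 ↔ ∃ s t : K, v = s • a + t • b := by
  constructor
  · intro h
    obtain ⟨φ, rfl⟩ := exists_contr_eq hab h
    exact ⟨-∑ i, φ i * b i, ∑ i, φ i * a i, by rw [contr_plucker, neg_smul]; abel⟩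
  · rintro ⟨s, t, rfl⟩
    exact wedgePt_plucker_comb a b s t

/-- The pairing of a trivector with a vector. -/
def trivPair (τ v : Fin 4 → K) : K := τ 0 * v 3 - τ 1 * v 2 + τ 2 * v 1 - τ 3 * v 0

theorem plPair_plucker (w : Fin 6 → K) (a b : Fin 4 → K) :
    plPair w (plucker a b) = trivPair (wedgePt w a) b := by
  simp [plPair, plucker, trivPair, wedgePt]; ring

theorem plPair_plucker_comb (w : Fin 6 → K) (a b : Fin 4 → K) (s t : K) :
    trivPair (wedgePt w (s • a + t • b)) b = s * plPair w (plucker a b) ∧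
      trivPair (wedgePt w (s • a + t • b)) a = -t * plPair w (plucker a b) := by
  constructor <;> simp [plPair, plucker, trivPair, wedgePt] <;> ring

theorem plPair_eq_zero_of_wedgePt {w : Fin 6 → K} {a b : Fin 4 → K} {s t : K}
    (hst : s ≠ 0 ∨ t ≠ 0) (h : wedgePt w (s • a + t • b) = 0) : plPair w (plucker a b) = 0 := by
  obtain ⟨h1, h2⟩ := plPair_plucker_comb w a b s t
  rw [h] at h1 h2
  simp only [trivPair, Pi.zero_apply, zero_mul, sub_zero, add_zero] at h1 h2
  rcases hst with hs | ht
  · exact (mul_eq_zero.1 h1.symm).resolve_left hs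
  · exact (mul_eq_zero.1 h2.symm).resolve_left (neg_ne_zero.2 ht)

theorem wedgePt_minor {w : Fin 6 → K} (hw : plQuad w = 0) {a b : Fin 4 → K}
    (h : plPair w (plucker a b) = 0) (i j : Fin 4) :
    wedgePt w a i * wedgePt w b j = wedgePt w b i * wedgePt w a j := by
  simp [plPair, plucker] at h
  unfold plQuad at hw
  fin_cases i <;> fin_cases j <;> simp [wedgePt] <;> grind

/-! ### The incidence variety and the union of the lines -/

theorem exists_comb_of_plPair_eq_zero {w : Fin 6 → K} (hw : plQuad w = 0) {a b : Fin 4 → K}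
    (h : plPair w (plucker a b) = 0) :
    ∃ s t : K, (s ≠ 0 ∨ t ≠ 0) ∧ wedgePt w (s • a + t • b) = 0 := by
  by_cases ha : wedgePt w a = 0
  · exact ⟨1, 0, Or.inl one_ne_zero, by simpa using ha⟩
  · obtain ⟨i, hi⟩ := Function.ne_iff.1 ha
    refine ⟨wedgePt w b i, -wedgePt w a i, Or.inr (neg_ne_zero.2 hi), ?_⟩
    rw [wedgePt_add, wedgePt_smul, wedgePt_smul]
    ext j
    simp only [Pi.add_apply, Pi.smul_apply, smul_eq_mul, Pi.zero_apply]
    linear_combination -wedgePt_minor hw h i j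

theorem comb_ne_zero {a b : Fin 4 → K} (hab : plucker a b ≠ 0) {s t : K} (hst : s ≠ 0 ∨ t ≠ 0) :
    s • a + t • b ≠ 0 := by
  intro h
  apply hab
  have hc : ∀ i, s * a i + t * b i = 0 := fun i => by simpa using congrFun h i
  have aux : ∀ i j, a i * b j - a j * b i = 0 := by
    intro i j
    rcases hst with hs | ht
    · apply (mul_eq_zero.1 (?_ : s * (a i * b j - a j * b i) = 0)).resolve_left hs
      linear_combination b j * hc i - b i * hc j
    · apply (mul_eq_zero.1 (?_ : t * (a i * b j - a j * b i) = 0)).resolve_left ht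
      linear_combination a i * hc j - a j * hc i
  ext k
  fin_cases k <;> simp [plucker, aux]

/-! ### The incidence variety and the swept surface -/

/-- The pairs consisting of a line of `C` and a point on it. -/
def incidence (C : Set (PP K 6)) : Set (PP K 6 × PP K 4) := {z | z.1 ∈ C ∧ z.2 ∈ lineOf z.1}

/-- The union of the lines of `C`. -/
def sweep (C : Set (PP K 6)) : Set (PP K 4) := Prod.snd '' incidence C

theorem mk_mem_incidence {C : Set (PP K 6)} {w : Fin 6 → K} (hw : w ≠ 0) {v : Fin 4 → K}
    (hv : v ≠ 0) : (Projectivization.mk K w hw, Projectivization.mk K v hv) ∈ incidence C ↔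
      w ∈ cone C ∧ wedgePt w v = 0 := by
  rw [incidence, Set.mem_ofPred_eq, mk_mem_lineOf hw hv, mk_mem_iff_mem_cone hw]

theorem mem_cone_sweep {C : Set (PP K 6)} {v : Fin 4 → K} (hv : v ≠ 0) :
    v ∈ cone (sweep C) ↔ ∃ w ∈ cone C, wedgePt w v = 0 := by
  constructor
  · rintro ⟨_, ⟨x, y⟩, hxy, hy⟩
    obtain ⟨w, hw, rfl⟩ := exists_rep x
    simp only at hy
    subst hy
    rw [mk_mem_incidence hw hv] at hxy
    exact ⟨w, hxy⟩
  · rintro ⟨w, hw, h⟩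
    exact ⟨hv, _, (mk_mem_incidence hw.1 hv).2 ⟨hw, h⟩, rfl⟩

/-- The four equations expressing that a point lies on a line. -/
noncomputable def wedgePoly (K : Type) [Field K] : Fin 4 → MvPolynomial (Fin 6 ⊕ Fin 4) K :=
  ![X (Sum.inl 0) * X (Sum.inr 2) - X (Sum.inl 1) * X (Sum.inr 1) +
      X (Sum.inl 3) * X (Sum.inr 0),
    X (Sum.inl 0) * X (Sum.inr 3) - X (Sum.inl 2) * X (Sum.inr 1) +
      X (Sum.inl 4) * X (Sum.inr 0),
    X (Sum.inl 1) * X (Sum.inr 3) - X (Sum.inl 2) * X (Sum.inr 2) +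
      X (Sum.inl 5) * X (Sum.inr 0),
    X (Sum.inl 3) * X (Sum.inr 3) - X (Sum.inl 4) * X (Sum.inr 2) +
      X (Sum.inl 5) * X (Sum.inr 1)]

theorem eval_wedgePoly (w : Fin 6 → K) (v : Fin 4 → K) (i : Fin 4) :
    eval (Sum.elim w v) (wedgePoly K i) = wedgePt w v i := by
  fin_cases i <;> simp [wedgePoly, wedgePt]

theorem zClosed2_incidence [Infinite K] {C : Set (PP K 6)} (hC : ZClosed C) :
    ZClosed2 (incidence C) := by
  have : incidence C = zeroLocus2
      ((rename Sum.inl '' (coneIdeal C : Set (MvPolynomial (Fin 6) K))) ∪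
        Set.range (wedgePoly K)) := by
    ext ⟨x, y⟩
    obtain ⟨w, hw, rfl⟩ := exists_rep x
    obtain ⟨v, hv, rfl⟩ := exists_rep y
    rw [mk_mem_incidence]
    constructor
    · rintro ⟨hwC, hwv⟩ p (⟨q, hq, rfl⟩ | ⟨i, rfl⟩) <;> rw [vanishes2_mk] <;> intro s t hs ht
      · rw [eval_rename, Sum.elim_comp_inl]
        exact mem_coneIdeal.1 hq _ (smul_mem_cone hwC hs)
      · rw [eval_wedgePoly, wedgePt_smul_smul, hwv, smul_zero, Pi.zero_apply]
    · intro h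
      constructor
      · rw [hC.mem_cone_iff hw]
        intro p hp
        have := h _ (Or.inl ⟨p, hp, rfl⟩) w hw v hv rfl rfl
        rwa [eval_rename, Sum.elim_comp_inl] at this
      · ext i
        have := h _ (Or.inr ⟨i, rfl⟩) w hw v hv rfl rfl
        rwa [eval_wedgePoly] at this
  rw [this]
  exact zClosed2_zeroLocus2 _

/-- Contraction of the generic bivector with a fixed covector. -/
noncomputable def contrLeft (φ : Fin 4 → K) : Fin 4 → MvPolynomial (Fin 6) K :=
  ![-(C (φ 1) * X 0) - C (φ 2) * X 1 - C (φ 3) * X 2,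
    C (φ 0) * X 0 - C (φ 2) * X 3 - C (φ 3) * X 4,
    C (φ 0) * X 1 + C (φ 1) * X 3 - C (φ 3) * X 5,
    C (φ 0) * X 2 + C (φ 1) * X 4 + C (φ 2) * X 5]

theorem eval_contrLeft (φ : Fin 4 → K) (w : Fin 6 → K) (i : Fin 4) :
    eval w (contrLeft φ i) = contr w φ i := by
  fin_cases i <;> simp [contrLeft, contr]

/-- Contraction of a fixed bivector with the generic covector. -/
noncomputable def contrRight (w : Fin 6 → K) : Fin 4 → MvPolynomial (Fin 4) K :=
  ![-(X 1 * C (w 0)) - X 2 * C (w 1) - X 3 * C (w 2),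
    X 0 * C (w 0) - X 2 * C (w 3) - X 3 * C (w 4),
    X 0 * C (w 1) + X 1 * C (w 3) - X 3 * C (w 5),
    X 0 * C (w 2) + X 1 * C (w 4) + X 2 * C (w 5)]

theorem eval_contrRight (φ : Fin 4 → K) (w : Fin 6 → K) (i : Fin 4) :
    eval φ (contrRight w i) = contr w φ i := by
  fin_cases i <;> simp [contrRight, contr]

theorem zIrred2_incidence [Infinite K] {C : Set (PP K 6)} (hGr : C ⊆ grass K) (hC : ZIrred C) :
    ZIrred2 (incidence C) := by
  have hprime := isPrime_coneIdeal hC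
  constructor
  · obtain ⟨x, hx⟩ := hC.1
    obtain ⟨w, hw, rfl, hwC⟩ := exists_mem_cone hx
    obtain ⟨φ, hφ⟩ := exists_contr_ne_zero hw
    exact ⟨_, (mk_mem_incidence hw hφ).2 ⟨hwC, wedgePt_contr (plQuad_of_mem_cone hGr hwC) φ⟩⟩
  · intro A B hA hB hAB
    by_contra! hcon
    have aux : ∀ A : Set (PP K 6 × PP K 4), ZClosed2 A → ¬ incidence C ⊆ A →
        ∃ p ∈ biconeIdeal A, ∃ φ, aeval (Sum.elim X (contrLeft φ)) p ∉ coneIdeal C := by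
      intro A hA hCA
      obtain ⟨⟨x, y⟩, hxy, hxyA⟩ := Set.not_subset.1 hCA
      obtain ⟨w, hw, rfl⟩ := exists_rep x
      obtain ⟨v, hv, rfl⟩ := exists_rep y
      rw [mk_mem_incidence] at hxy
      obtain ⟨p, hpA, -, hp0⟩ := hA.exists_isBiHomog hw hv hxyA
      obtain ⟨φ, rfl⟩ := exists_contr_eq hw hxy.2
      refine ⟨p, hpA, φ, fun h => hp0 ?_⟩
      rw [← mem_coneIdeal.1 h w hxy.1, eval_aeval]
      congr 2
      ext (i | i) <;> simp [eval_contrLeft]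
    obtain ⟨p, hpA, φ, hp⟩ := aux A hA hcon.1
    obtain ⟨q, hqB, ψ, hq⟩ := aux B hB hcon.2
    have hpq : ¬ aeval (Sum.elim X (contrLeft φ)) p * aeval (Sum.elim X (contrLeft ψ)) q ∈
        coneIdeal C := fun h => (hprime.mem_or_mem h).elim hp hq
    rw [mem_coneIdeal] at hpq
    push Not at hpq
    obtain ⟨w, hwC, hw0⟩ := hpq
    rw [map_mul, eval_aeval, eval_aeval] at hw0
    obtain ⟨hp0, hq0⟩ := mul_ne_zero_iff.1 hw0
    obtain ⟨χ, hχ⟩ := exists_contr_ne_zero hwC.1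
    obtain ⟨j, hj⟩ := Function.ne_iff.1 hχ
    have hev : ∀ (r : MvPolynomial (Fin 6 ⊕ Fin 4) K) θ,
        eval θ (aeval (Sum.elim (fun k => MvPolynomial.C (w k)) (contrRight w)) r) =
          eval (Sum.elim w (contr w θ)) r := by
      intro r θ
      rw [eval_aeval]
      congr 2
      ext (i | i) <;> simp [eval_contrRight]
    have hev' : ∀ (r : MvPolynomial (Fin 6 ⊕ Fin 4) K) θ,
        eval (fun i => eval w (Sum.elim X (contrLeft θ) i)) r =
          eval (Sum.elim w (contr w θ)) r := by
      intro r θ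
      congr 2
      ext (i | i) <;> simp [eval_contrLeft]
    rw [hev'] at hp0 hq0
    have hP : aeval (Sum.elim (fun k => MvPolynomial.C (w k)) (contrRight w)) p ≠ 0 := by
      intro h; apply hp0; rw [← hev, h, map_zero]
    have hQ : aeval (Sum.elim (fun k => MvPolynomial.C (w k)) (contrRight w)) q ≠ 0 := by
      intro h; apply hq0; rw [← hev, h, map_zero]
    have hR : contrRight w j ≠ 0 := by
      intro h; apply hj; rw [← eval_contrRight, h, map_zero]; rfl
    obtain ⟨θ, hθ⟩ := exists_eval_ne_zero (mul_ne_zero (mul_ne_zero hP hQ) hR)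
    rw [map_mul, map_mul, hev, hev, eval_contrRight] at hθ
    obtain ⟨hθ, hθ3⟩ := mul_ne_zero_iff.1 hθ
    obtain ⟨hθ1, hθ2⟩ := mul_ne_zero_iff.1 hθ
    have hv : contr w θ ≠ 0 := fun h => hθ3 (by rw [h]; rfl)
    rcases hAB ((mk_mem_incidence hwC.1 hv).2
      ⟨hwC, wedgePt_contr (plQuad_of_mem_cone hGr hwC) θ⟩) with h | h
    · exact hθ1 (mem_biconeIdeal.1 hpA w hwC.1 _ hv h)
    · exact hθ2 (mem_biconeIdeal.1 hqB w hwC.1 _ hv h)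

theorem zIrred_sweep [Infinite K] {C : Set (PP K 6)} (hGr : C ⊆ grass K) (hC : ZIrred C) :
    ZIrred (sweep C) := by
  obtain ⟨hne, hirr⟩ := zIrred2_incidence hGr hC
  refine ⟨hne.image _, fun A B hA hB hAB => ?_⟩
  have aux : ∀ A : Set (PP K 4), ZClosed A →
      ZClosed2 (Prod.snd ⁻¹' A : Set (PP K 6 × PP K 4)) := by
    intro A hA
    have : (Prod.snd ⁻¹' A : Set (PP K 6 × PP K 4)) = zeroLocus2
        (rename Sum.inr '' (coneIdeal A : Set (MvPolynomial (Fin 4) K))) := by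
      ext ⟨x, y⟩
      obtain ⟨w, hw, rfl⟩ := exists_rep x
      obtain ⟨v, hv, rfl⟩ := exists_rep y
      rw [Set.mem_preimage, mk_mem_iff_mem_cone hv]
      constructor
      · rintro h _ ⟨q, hq, rfl⟩
        rw [vanishes2_mk]
        intro s t hs ht
        rw [eval_rename, Sum.elim_comp_inr]
        exact mem_coneIdeal.1 hq _ (smul_mem_cone h ht)
      · intro h
        rw [hA.mem_cone_iff hv]
        intro p hp
        have := h _ ⟨p, hp, rfl⟩ w hw v hv rfl rfl
        rwa [eval_rename, Sum.elim_comp_inr] at this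
    rw [this]
    exact zClosed2_zeroLocus2 _
  simpa [sweep, Set.image_subset_iff] using
    hirr _ _ (aux A hA) (aux B hB) (by rw [← Set.preimage_union, ← Set.image_subset_iff]; exact hAB)

theorem zClosed_sweep [IsAlgClosed K] {C : Set (PP K 6)} (hC : ZClosed C) :
    ZClosed (sweep C) := by
  let ℓ : Fin 4 → Fin 4 → MvPolynomial (Fin 6) K :=
    ![![X 3, -X 1, X 0, 0], ![X 4, -X 2, 0, X 0], ![X 5, 0, -X 2, X 1], ![0, X 5, -X 4, X 3]]
  refine zClosed_of_bilinear hC ℓ ?_ ?_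
  · intro j i
    fin_cases j <;> fin_cases i <;>
      first
        | exact isHomogeneous_X _ _
        | exact (isHomogeneous_X _ _).neg
        | exact isHomogeneous_zero _ _ _
  · intro v hv
    rw [mem_cone_sweep hv]
    refine exists_congr fun w => and_congr_right fun _ => ?_
    rw [funext_iff]
    refine forall_congr' fun j => ?_
    have : wedgePt w v j = ∑ i, v i * eval w (ℓ j i) := by
      fin_cases j <;> simp [ℓ, wedgePt, Fin.sum_univ_four] <;> ring
    rw [this, Pi.zero_apply]

/-! ### Lower bounds for dimensions -/

theorem zClosed_singleton [Infinite K] {n : ℕ} (x : PP K n) : ZClosed {x} := by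
  apply zClosed_of_separated
  intro v hv hvx
  obtain ⟨w, hw, rfl⟩ := exists_rep x
  by_contra! hcon
  apply hvx
  obtain ⟨k, hk⟩ := Function.ne_iff.1 hw
  refine ⟨hv, ?_⟩
  rw [Set.mem_singleton_iff, Projectivization.mk_eq_mk_iff']
  refine ⟨v k / w k, ?_⟩
  ext i
  have := hcon (C (w k) * X i - C (w i) * X k) (mem_coneIdeal.2 ?_)
  · simp only [map_sub, map_mul, eval_C, eval_X] at this
    rw [Pi.smul_apply, smul_eq_mul, div_mul_eq_mul_div, div_eq_iff hk]
    linear_combination -this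
  · rintro u ⟨hu, hux⟩
    obtain ⟨t, rfl⟩ := (Projectivization.mk_eq_mk_iff' K _ _ hu hw).1 hux
    simp only [map_sub, map_mul, eval_C, eval_X, Pi.smul_apply, smul_eq_mul]
    ring

theorem zIrred_singleton {n : ℕ} (x : PP K n) : ZIrred {x} :=
  ⟨Set.singleton_nonempty x, fun A B _ _ h => by simpa using h⟩

theorem zIrred2_singleton {a b : ℕ} (x : PP K a × PP K b) : ZIrred2 {x} :=
  ⟨Set.singleton_nonempty x, fun A B _ _ h => by simpa using h⟩

theorem zClosed2_singleton [Infinite K] {a b : ℕ} (z : PP K a × PP K b) : ZClosed2 {z} := by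
  obtain ⟨x, y⟩ := z
  have : ({(x, y)} : Set (PP K a × PP K b)) = zeroLocus2
      ((rename Sum.inl '' (coneIdeal {x} : Set (MvPolynomial (Fin a) K))) ∪
        (rename Sum.inr '' (coneIdeal {y} : Set (MvPolynomial (Fin b) K)))) := by
    ext ⟨x', y'⟩
    obtain ⟨w, hw, rfl⟩ := exists_rep x'
    obtain ⟨v, hv, rfl⟩ := exists_rep y'
    rw [Set.mem_singleton_iff, Prod.mk.injEq, ← Set.mem_singleton_iff, ← Set.mem_singleton_iff,
      mk_mem_iff_mem_cone, mk_mem_iff_mem_cone]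
    constructor
    · rintro ⟨h1, h2⟩ _ (⟨q, hq, rfl⟩ | ⟨q, hq, rfl⟩) <;> rw [vanishes2_mk] <;>
        intro s t hs ht <;> rw [eval_rename]
      · rw [Sum.elim_comp_inl]
        exact mem_coneIdeal.1 hq _ (smul_mem_cone h1 hs)
      · rw [Sum.elim_comp_inr]
        exact mem_coneIdeal.1 hq _ (smul_mem_cone h2 ht)
    · intro h
      constructor
      · rw [(zClosed_singleton x).mem_cone_iff hw]
        intro p hp
        have := h _ (Or.inl ⟨p, hp, rfl⟩) w hw v hv rfl rfl
        rwa [eval_rename, Sum.elim_comp_inl] at this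
      · rw [(zClosed_singleton y).mem_cone_iff hv]
        intro p hp
        have := h _ (Or.inr ⟨p, hp, rfl⟩) w hw v hv rfl rfl
        rwa [eval_rename, Sum.elim_comp_inr] at this
  rw [this]
  exact zClosed2_zeroLocus2 _

theorem strictMono_fin_three {α : Type} [Preorder α] {x y z : α} (h1 : x < y) (h2 : y < z) :
    StrictMono ![x, y, z] := by
  rw [Fin.strictMono_iff_lt_succ]
  intro i
  fin_cases i
  · exact h1
  · exact h2

theorem sweep_mono {C D : Set (PP K 6)} (h : C ⊆ D) : sweep C ⊆ sweep D :=
  Set.image_mono fun _ hz => ⟨h hz.1, hz.2⟩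

theorem plucker_smul_smul_self (a : Fin 4 → K) (s t : K) :
    plucker (s • a) (t • a) = 0 := by
  ext i
  fin_cases i <;> simp [plucker] <;> ring

theorem mk_ne_mk_of_plucker {a b : Fin 4 → K} (h : plucker a b ≠ 0) (ha : a ≠ 0) (hb : b ≠ 0) :
    Projectivization.mk K a ha ≠ Projectivization.mk K b hb := by
  intro hab
  obtain ⟨t, rfl⟩ := (Projectivization.mk_eq_mk_iff' K _ _ ha hb).1 hab
  apply h
  simpa using plucker_smul_smul_self b t 1

theorem exists_two_points_on_line {w : Fin 6 → K} (hw : IsLineRep w) :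
    ∃ (a b : Fin 4 → K), w = plucker a b ∧ a ≠ 0 ∧ b ≠ 0 ∧ wedgePt w a = 0 ∧
      wedgePt w b = 0 := by
  obtain ⟨a, b, rfl⟩ := hw.exists_plucker
  refine ⟨a, b, rfl, ?_, ?_, ?_, ?_⟩
  · simpa using comb_ne_zero hw.1 (Or.inl one_ne_zero : (1 : K) ≠ 0 ∨ (0 : K) ≠ 0)
  · simpa using comb_ne_zero hw.1 (Or.inr one_ne_zero : (0 : K) ≠ 0 ∨ (1 : K) ≠ 0)
  · simpa using wedgePt_plucker_comb a b 1 0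
  · simpa using wedgePt_plucker_comb a b 0 1

theorem dimGE2_incidence [Infinite K] {C : Set (PP K 6)} (hGr : C ⊆ grass K) (hCcl : ZClosed C)
    (hC : ZIrred C) {x y : PP K 6} (hx : x ∈ C) (hy : y ∈ C) (hxy : x ≠ y) :
    dimGE2 (incidence C) 2 := by
  obtain ⟨w, hw, rfl, hwC⟩ := exists_mem_cone hx
  obtain ⟨u, hu, rfl, huC⟩ := exists_mem_cone hy
  have hwq := plQuad_of_mem_cone hGr hwC
  have huq := plQuad_of_mem_cone hGr huC
  obtain ⟨a, b, rfl, ha, hb, hwa, hwb⟩ := exists_two_points_on_line ⟨hw, hwq⟩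
  obtain ⟨φ, hφ⟩ := exists_contr_ne_zero hu
  have hsub : ({Projectivization.mk K (plucker a b) hw} : Set (PP K 6)) ⊆ C := by simpa using hx
  have hmem : ∀ {v : Fin 4 → K} (hv : v ≠ 0), wedgePt (plucker a b) v = 0 →
      (Projectivization.mk K (plucker a b) hw, Projectivization.mk K v hv) ∈
        incidence {Projectivization.mk K (plucker a b) hw} := fun hv h =>
    (mk_mem_incidence hw hv).2 ⟨⟨hw, rfl⟩, h⟩
  have hmono : incidence {Projectivization.mk K (plucker a b) hw} ⊆ incidence C :=
    fun z hz => ⟨hsub hz.1, hz.2⟩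
  have h1 : ({(Projectivization.mk K (plucker a b) hw, Projectivization.mk K a ha)} :
      Set (PP K 6 × PP K 4)) < incidence {Projectivization.mk K (plucker a b) hw} := by
    refine (Set.ssubset_iff_of_subset (by simpa using hmem ha hwa)).2 ⟨_, hmem hb hwb, ?_⟩
    simpa using (mk_ne_mk_of_plucker hw ha hb).symm
  have h2 : incidence {Projectivization.mk K (plucker a b) hw} < incidence C := by
    refine (Set.ssubset_iff_of_subset hmono).2 ⟨_, (mk_mem_incidence hu hφ).2
      ⟨huC, wedgePt_contr huq φ⟩, ?_⟩
    intro h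
    exact hxy h.1.symm
  refine ⟨_, ?_, strictMono_fin_three h1 h2⟩
  intro i
  fin_cases i
  · exact ⟨zClosed2_singleton _, zIrred2_singleton _, h1.le.trans h2.le⟩
  · exact ⟨zClosed2_incidence (zClosed_singleton _),
      zIrred2_incidence (hsub.trans hGr) (zIrred_singleton _), h2.le⟩
  · exact ⟨zClosed2_incidence hCcl, zIrred2_incidence hGr hC, subset_rfl⟩

theorem dimGE_sweep [IsAlgClosed K] {C : Set (PP K 6)} (hGr : C ⊆ grass K) (hCcl : ZClosed C)
    (hC : ZIrred C) {x y : PP K 6} (hx : x ∈ C) (hy : y ∈ C) (hxy : x ≠ y) :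
    dimGE (sweep C) 2 := by
  obtain ⟨w, hw, rfl, hwC⟩ := exists_mem_cone hx
  obtain ⟨u, hu, rfl, huC⟩ := exists_mem_cone hy
  have hwq := plQuad_of_mem_cone hGr hwC
  have huq := plQuad_of_mem_cone hGr huC
  obtain ⟨a, b, hwab, ha, hb, hwa, hwb⟩ := exists_two_points_on_line ⟨hw, hwq⟩
  obtain ⟨a', b', rfl, ha', hb', hua, hub⟩ := exists_two_points_on_line ⟨hu, huq⟩
  have hsub : ({Projectivization.mk K w hw} : Set (PP K 6)) ⊆ C := by simpa using hx
  have hmem : ∀ {v : Fin 4 → K} (hv : v ≠ 0), Projectivization.mk K v hv ∈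
      sweep {Projectivization.mk K w hw} ↔ wedgePt w v = 0 := by
    intro v hv
    rw [mk_mem_iff_mem_cone hv, mem_cone_sweep hv]
    constructor
    · rintro ⟨z, ⟨hz, hzw⟩, h⟩
      have : Projectivization.mk K v hv ∈ lineOf (Projectivization.mk K z hz) :=
        (mk_mem_lineOf hz hv).2 h
      rw [Set.mem_singleton_iff.1 hzw] at this
      exact (mk_mem_lineOf hw hv).1 this
    · intro h
      exact ⟨w, ⟨hw, rfl⟩, h⟩
  have h1 : ({Projectivization.mk K a ha} : Set (PP K 4)) <
      sweep {Projectivization.mk K w hw} := by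
    refine (Set.ssubset_iff_of_subset (by simpa using (hmem ha).2 hwa)).2
      ⟨_, (hmem hb).2 hwb, ?_⟩
    simpa using (mk_ne_mk_of_plucker (hwab ▸ hw) ha hb).symm
  have h2 : sweep {Projectivization.mk K w hw} < sweep C := by
    refine lt_of_le_not_ge (sweep_mono hsub) fun hle => hxy ?_
    have hon : ∀ {v : Fin 4 → K} (hv : v ≠ 0), wedgePt (plucker a' b') v = 0 →
        wedgePt w v = 0 := fun hv h =>
      (hmem hv).1 (hle ((mem_cone_sweep hv).2 ⟨_, huC, h⟩).2)
    obtain ⟨φ, hφ⟩ := exists_contr_eq hw (hon ha' hua)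
    obtain ⟨ψ, hψ⟩ := exists_contr_eq hw (hon hb' hub)
    have := plucker_contr hwq φ ψ
    rw [hφ, hψ] at this
    exact ((Projectivization.mk_eq_mk_iff' K _ _ hu hw).2 ⟨_, this.symm⟩).symm
  refine ⟨_, ?_, strictMono_fin_three h1 h2⟩
  intro i
  fin_cases i
  · exact ⟨zClosed_singleton _, zIrred_singleton _, h1.le.trans h2.le⟩
  · exact ⟨zClosed_sweep (zClosed_singleton _),
      zIrred_sweep (hsub.trans hGr) (zIrred_singleton _), h2.le⟩
  · exact ⟨zClosed_sweep hCcl, zIrred_sweep hGr hC, subset_rfl⟩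

/-! ### General position -/

/-- The minor of the two linear forms `a ∧ b ∧ ·` and `a ∧ b' ∧ ·` at the bivectors `w`, `z`. -/
def pairMinor {E : Type} [Field E] (w z : Fin 6 → E) (a b b' : Fin 4 → E) : E :=
  plPair w (plucker a b) * plPair z (plucker a b') -
    plPair z (plucker a b) * plPair w (plucker a b')

theorem exists_pairMinor_ne_zero {E : Type} [Field E] [Algebra K E] {w z : Fin 6 → E}
    (hwz : ∃ i j, w i * z j ≠ w j * z i) :
    ∃ a b b' : Fin 4 → K, pairMinor w z (algebraMap K E ∘ a) (algebraMap K E ∘ b)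
      (algebraMap K E ∘ b') ≠ 0 := by
  by_contra! h
  have e012 := h ![1,0,0,0] ![0,1,0,0] ![0,0,1,0]
  have e013 := h ![1,0,0,0] ![0,1,0,0] ![0,0,0,1]
  have e023 := h ![1,0,0,0] ![0,0,1,0] ![0,0,0,1]
  have e102 := h ![0,1,0,0] ![1,0,0,0] ![0,0,1,0]
  have e103 := h ![0,1,0,0] ![1,0,0,0] ![0,0,0,1]
  have e123 := h ![0,1,0,0] ![0,0,1,0] ![0,0,0,1]
  have e201 := h ![0,0,1,0] ![1,0,0,0] ![0,1,0,0]
  have e203 := h ![0,0,1,0] ![1,0,0,0] ![0,0,0,1]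
  have e213 := h ![0,0,1,0] ![0,1,0,0] ![0,0,0,1]
  have e301 := h ![0,0,0,1] ![1,0,0,0] ![0,1,0,0]
  have e302 := h ![0,0,0,1] ![1,0,0,0] ![0,0,1,0]
  have e312 := h ![0,0,0,1] ![0,1,0,0] ![0,0,1,0]
  have f1 := h ![1,1,0,0] ![0,0,1,0] ![0,0,0,1]
  have f2 := h ![1,0,1,0] ![0,1,0,0] ![0,0,0,1]
  have f3 := h ![1,0,0,1] ![0,1,0,0] ![0,0,1,0]
  simp [pairMinor, plPair, plucker] at e012 e013 e023 e102 e103 e123 e201 e203 e213 e301 e302 e312 f1 f2 f3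
  have g05 : w 0 * z 5 = w 5 * z 0 := by grind
  have g14 : w 1 * z 4 = w 4 * z 1 := by grind
  have g23 : w 2 * z 3 = w 3 * z 2 := by grind
  obtain ⟨i, j, hij⟩ := hwz
  apply hij
  clear h hij
  fin_cases i <;> fin_cases j <;> simp only [Fin.mk_zero, Fin.mk_one, Fin.reduceFinMk] <;> first | ring1 | grind

/-- Nonempty sets whose trace on any line through one of their points is cofinite. -/
def LineOpen (K : Type) [Field K] {V : Type} [AddCommGroup V] [Module K V] (U : Set V) : Prop :=
  U.Nonempty ∧ ∀ x ∈ U, ∀ y, {t : K | x + t • y ∉ U}.Finite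

theorem LineOpen.inter [Infinite K] {V : Type} [AddCommGroup V] [Module K V] {U U' : Set V}
    (h : LineOpen K U) (h' : LineOpen K U') : LineOpen K (U ∩ U') := by
  constructor
  · obtain ⟨x, hx⟩ := h.1
    obtain ⟨x', hx'⟩ := h'.1
    have h1 := h.2 x hx (x' - x)
    have h2 := h'.2 x' hx' (x - x')
    have h3 : {t : K | x' + (1 - t) • (x - x') ∉ U'}.Finite :=
      h2.preimage (f := fun t : K => 1 - t) (fun s _ t _ hst => by simpa using hst)
    obtain ⟨t, ht⟩ := (h1.union h3).infinite_compl.nonempty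
    simp only [Set.mem_compl_iff, Set.mem_union, not_or, Set.mem_ofPred_eq, not_not] at ht
    refine ⟨_, ht.1, ?_⟩
    convert ht.2 using 1
    module
  · intro x hx y
    refine ((h.2 x hx.1 y).union (h'.2 x hx.2 y)).subset ?_
    intro t ht
    by_contra hc
    simp only [Set.mem_union, not_or, Set.mem_ofPred_eq, not_not] at hc
    exact ht hc

theorem LineOpen.univ {V : Type} [AddCommGroup V] [Module K V] :
    LineOpen K (Set.univ : Set V) := ⟨⟨0, trivial⟩, fun _ _ _ => by simp⟩

theorem LineOpen.biInter [Infinite K] {V ι : Type} [AddCommGroup V] [Module K V] {s : Set ι}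
    (hs : s.Finite) {U : ι → Set V} (h : ∀ i ∈ s, LineOpen K (U i)) :
    LineOpen K (⋂ i ∈ s, U i) := by
  induction s, hs using Set.Finite.induction_on with
  | empty => simpa using LineOpen.univ
  | insert _ _ ih =>
    rw [Set.biInter_insert]
    exact (h _ (Set.mem_insert _ _)).inter (ih fun i hi => h i (Set.mem_insert_of_mem _ hi))

/-- The restriction of a polynomial to the parametrised line `t ↦ x + t • y`. -/
noncomputable def linePoly {σ : Type} (x y : σ → K) (p : MvPolynomial σ K) : Polynomial K :=
  aeval (fun k => Polynomial.C (x k) + Polynomial.X * Polynomial.C (y k)) p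

theorem eval_linePoly {σ : Type} (x y : σ → K) (p : MvPolynomial σ K) (t : K) :
    (linePoly x y p).eval t = eval (x + t • y) p := by
  have : (Polynomial.evalRingHom t).comp ((aeval (R := K)
      (fun k => Polynomial.C (x k) + Polynomial.X * Polynomial.C (y k))).toRingHom) =
      eval (x + t • y) := by
    apply MvPolynomial.ringHom_ext
    · intro r; simp
    · intro i; simp; ring
  exact congrArg (fun f => f p) this

theorem lineOpen_eval_ne_zero [Infinite K] {σ : Type} {p : MvPolynomial σ K} (hp : p ≠ 0) :
    LineOpen K {x : σ → K | eval x p ≠ 0} := by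
  refine ⟨exists_eval_ne_zero hp, fun x hx y => ?_⟩
  have h0 : linePoly x y p ≠ 0 := by
    intro h
    apply hx
    have := eval_linePoly x y p 0
    simpa [h] using this.symm
  refine (Polynomial.finite_setOfPred_isRoot h0).subset ?_
  intro t ht
  simpa [Polynomial.IsRoot, eval_linePoly] using ht

/-- The linear form with coefficient vector `φ`. -/
noncomputable def linForm {σ : Type} [Fintype σ] (φ : σ → K) : MvPolynomial σ K :=
  ∑ i, C (φ i) * X i

theorem eval_linForm {σ : Type} [Fintype σ] (φ v : σ → K) :
    eval v (linForm φ) = ∑ i, φ i * v i := by simp [linForm]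

theorem isHomogeneous_linForm {σ : Type} [Fintype σ] (φ : σ → K) : (linForm φ).IsHomogeneous 1 :=
  IsHomogeneous.sum _ _ _ fun i _ => by
    simpa using (isHomogeneous_C σ (φ i)).mul (isHomogeneous_X K i)

theorem linForm_ne_zero {σ : Type} [Fintype σ] {φ : σ → K} (h : φ ≠ 0) : linForm φ ≠ 0 := by
  classical
  obtain ⟨i, hi⟩ := Function.ne_iff.1 h
  intro h0
  apply hi
  have := eval_linForm φ (Pi.single i 1)
  simpa [h0, Pi.single_apply] using this.symm

theorem hasIndep_two [Infinite K] {n : ℕ} {X : Set (PP K n)} (hX : ZIrred X) {x y : PP K n}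
    (hx : x ∈ X) (hy : y ∈ X) (hxy : x ≠ y) : HasIndep 2 (coneIdeal X) := by
  have := isPrime_coneIdeal hX
  refine HasIndep.succ (P' := coneIdeal {x}) ?_ (hasIndep_coneIdeal ⟨x, rfl⟩)
  apply coneIdeal_lt (zClosed_singleton x)
  refine lt_of_le_of_ne (by simpa using hx) ?_
  rintro rfl
  exact hxy hy.symm

theorem exists_mem_cone_linForm_eq_zero [IsAlgClosed K] {n : ℕ} {X : Set (PP K n)}
    (hXcl : ZClosed X) (hX : ZIrred X) {x y : PP K n}
    (hx : x ∈ X) (hy : y ∈ X) (hxy : x ≠ y) (φ : Fin n → K) :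
    ∃ v ∈ cone X, ∑ i, φ i * v i = 0 := by
  by_contra! h
  have := isPrime_coneIdeal hX
  have hi := isIntegral_adjoin_of_no_common_zero hXcl (fun _ : Fin 1 => linForm φ)
    (fun _ => isHomogeneous_linForm φ) fun v hv => ⟨0, by rw [eval_linForm]; exact h v hv⟩
  have := (hasIndep_two hX hx hy hxy).le_of_isAlgebraic _ hi.isAlgebraic
  omega

theorem exists_linForm_ne_zero_of_finite [Infinite K] {n : ℕ} {T : Set (PP K n)} (hT : T.Finite) :
    LineOpen K {ψ : Fin n → K | ∀ v ∈ cone T, ∑ i, ψ i * v i ≠ 0} := by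
  have h : LineOpen K (⋂ x ∈ T, {ψ : Fin n → K | eval ψ (linForm x.rep) ≠ 0}) :=
    LineOpen.biInter hT fun x _ => lineOpen_eval_ne_zero (linForm_ne_zero x.rep_nonzero)
  convert h using 1
  ext ψ
  simp only [Set.mem_ofPred_eq, Set.mem_iInter, eval_linForm]
  constructor
  · intro h x hx
    simpa [mul_comm] using h x.rep ⟨x.rep_nonzero, by simpa using hx⟩
  · rintro h v ⟨hv, hx⟩ h0
    apply h _ hx
    obtain ⟨c, hc⟩ := Projectivization.exists_smul_eq_mk_rep K v hv
    rw [← hc]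
    have : ∀ i, (c • v) i * ψ i = (c : K) * (ψ i * v i) := fun i => by
      simp [Units.smul_def]; ring
    simp only [this, ← Finset.mul_sum, h0, mul_zero]

/-- Two linear forms without common zero on `X`, seen in the homogeneous coordinate ring. -/
theorem isIntegral_pair [IsAlgClosed K] {n : ℕ} {X : Set (PP K n)} (hX : ZClosed X)
    {φ ψ : Fin n → K} (h0 : ∀ v ∈ cone X, ∑ i, φ i * v i = 0 → ∑ i, ψ i * v i ≠ 0) :
    Algebra.IsIntegral (Algebra.adjoin K
      (Set.range fun j => Ideal.Quotient.mk (coneIdeal X) (![linForm φ, linForm ψ] j)))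
      (MvPolynomial (Fin n) K ⧸ coneIdeal X) := by
  apply isIntegral_adjoin_of_no_common_zero hX
  · intro j
    fin_cases j <;> exact isHomogeneous_linForm _
  · intro v hv
    by_cases h : ∑ i, φ i * v i = 0
    · exact ⟨1, by simpa [eval_linForm] using h0 v hv h⟩
    · exact ⟨0, by simpa [eval_linForm] using h⟩

theorem exists_isAlgebraic_of_wedge {Q : Type} [CommRing Q] [IsDomain Q] [Algebra K Q]
    {w : Fin 6 → Q} {v : Fin 4 → Q} (hw : w ≠ 0)
    (h0 : w 0 * v 2 - w 1 * v 1 + w 3 * v 0 = 0) (h1 : w 0 * v 3 - w 2 * v 1 + w 4 * v 0 = 0)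
    (h2 : w 1 * v 3 - w 2 * v 2 + w 5 * v 0 = 0) (h3 : w 3 * v 3 - w 4 * v 2 + w 5 * v 1 = 0) :
    ∃ i j : Fin 4, ∀ A : Subalgebra K Q, (∀ k, IsAlgebraic A (w k)) → v i ∈ A → v j ∈ A →
      ∀ l, IsAlgebraic A (v l) := by
  obtain ⟨k, hk⟩ := Function.ne_iff.1 hw
  have main : ∀ i j : Fin 4, (∀ l, l = i ∨ l = j ∨ ∃ p q, w k * v l = w p * v i - w q * v j ∨
      w k * v l = w p * v i + w q * v j ∨ w k * v l = w q * v j - w p * v i) →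
      ∃ i j : Fin 4, ∀ A : Subalgebra K Q, (∀ k, IsAlgebraic A (w k)) → v i ∈ A → v j ∈ A →
      ∀ l, IsAlgebraic A (v l) := by
    refine fun i j h => ⟨i, j, fun A hA hi hj l => ?_⟩
    have hi' : IsAlgebraic A (v i) := isAlgebraic_algebraMap (⟨v i, hi⟩ : A)
    have hj' : IsAlgebraic A (v j) := isAlgebraic_algebraMap (⟨v j, hj⟩ : A)
    rcases h l with rfl | rfl | ⟨p, q, h | h | h⟩
    · exact hi'
    · exact hj'
    · refine (hA k).of_mul (mem_nonZeroDivisors_of_ne_zero hk) ?_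
      rw [h]
      exact ((hA p).mul hi').sub ((hA q).mul hj')
    · refine (hA k).of_mul (mem_nonZeroDivisors_of_ne_zero hk) ?_
      rw [h]
      exact ((hA p).mul hi').add ((hA q).mul hj')
    · refine (hA k).of_mul (mem_nonZeroDivisors_of_ne_zero hk) ?_
      rw [h]
      exact ((hA q).mul hj').sub ((hA p).mul hi')
  fin_cases k
  · refine main 1 0 fun l => ?_
    fin_cases l
    · simp
    · simp
    · exact .inr (.inr ⟨1, 3, .inl (by grind)⟩)
    · exact .inr (.inr ⟨2, 4, .inl (by grind)⟩)
  · refine main 2 0 fun l => ?_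
    fin_cases l
    · simp
    · exact .inr (.inr ⟨0, 3, .inr (.inl (by grind))⟩)
    · simp
    · exact .inr (.inr ⟨2, 5, .inl (by grind)⟩)
  · refine main 3 0 fun l => ?_
    fin_cases l
    · simp
    · exact .inr (.inr ⟨0, 4, .inr (.inl (by grind))⟩)
    · exact .inr (.inr ⟨1, 5, .inr (.inl (by grind))⟩)
    · simp
  · refine main 1 2 fun l => ?_
    fin_cases l
    · exact .inr (.inr ⟨1, 0, .inl (by grind)⟩)
    · simp
    · simp
    · exact .inr (.inr ⟨5, 4, .inr (.inr (by grind))⟩)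
  · refine main 1 3 fun l => ?_
    fin_cases l
    · exact .inr (.inr ⟨2, 0, .inl (by grind)⟩)
    · simp
    · exact .inr (.inr ⟨5, 3, .inr (.inl (by grind))⟩)
    · simp
  · refine main 2 3 fun l => ?_
    fin_cases l
    · exact .inr (.inr ⟨2, 1, .inl (by grind)⟩)
    · exact .inr (.inr ⟨4, 3, .inl (by grind)⟩)
    · simp
    · simp

theorem not_dimGE2_incidence [IsAlgClosed K] {C : Set (PP K 6)} (hGr : C ⊆ grass K)
    (hCcl : ZClosed C) (hC : ZIrred C) {φ : Fin 6 → K} (hφ : (C ∩ hyp φ).Finite) :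
    ¬ dimGE2 (incidence C) 3 := by
  rintro ⟨f, hf, hmono⟩
  obtain ⟨ψ, hψ⟩ := (exists_linForm_ne_zero_of_finite hφ).1
  have hint := isIntegral_pair hCcl (φ := φ) (ψ := ψ) fun v hv h0 => hψ v ⟨hv.1, hv.2, by
    rw [mk_mem_hyp]; exact h0⟩
  have hP := isPrime_biconeIdeal (zIrred2_incidence hGr hC)
  have h5 : HasIndep 5 (biconeIdeal (incidence C)) := by
    have := HasIndep.chain 3 (fun i => biconeIdeal (f i)) (fun i => isPrime_biconeIdeal (hf i).2.1)
      (fun i j hij => biconeIdeal_lt (hf i).1 (hmono hij)) (hasIndep_biconeIdeal (hf 0).2.1.1)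
    exact this.mono (biconeIdeal_anti (hf _).2.2)
  let π := Ideal.Quotient.mk (biconeIdeal (incidence C))
  have hrel : ∀ i, π (wedgePoly K i) = 0 := fun i => by
    refine Ideal.Quotient.eq_zero_iff_mem.2 (mem_biconeIdeal.2 fun u hu v hv h => ?_)
    rw [eval_wedgePoly, ((mk_mem_incidence hu hv).1 h).2]
    rfl
  have hw : (fun k => π (X (Sum.inl k))) ≠ 0 := by
    intro h
    obtain ⟨⟨x, y⟩, hxy⟩ := (zIrred2_incidence hGr hC).1
    obtain ⟨u, hu, rfl⟩ := exists_rep x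
    obtain ⟨v, hv, rfl⟩ := exists_rep y
    apply hu
    ext k
    have := mem_biconeIdeal.1 (Ideal.Quotient.eq_zero_iff_mem.1 (congrFun h k)) u hu v hv hxy
    simpa using this
  obtain ⟨i, j, hij⟩ := exists_isAlgebraic_of_wedge (K := K) (w := fun k => π (X (Sum.inl k)))
    (v := fun l => π (X (Sum.inr l))) hw (by simpa [wedgePoly] using hrel 0)
    (by simpa [wedgePoly] using hrel 1) (by simpa [wedgePoly] using hrel 2)
    (by simpa [wedgePoly] using hrel 3)
  let Φ : MvPolynomial (Fin 6) K ⧸ coneIdeal C →ₐ[K] MvPolynomial (Fin 6 ⊕ Fin 4) K ⧸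
      biconeIdeal (incidence C) := Ideal.quotientMapₐ _ (rename Sum.inl) (by
    intro p hp
    rw [Ideal.mem_comap]
    refine mem_biconeIdeal.2 fun u hu v hv h => ?_
    rw [eval_rename]
    exact mem_coneIdeal.1 hp u ((mk_mem_incidence hu hv).1 h).1)
  let s : Fin 4 → MvPolynomial (Fin 6 ⊕ Fin 4) K ⧸ biconeIdeal (incidence C) :=
    ![Φ (Ideal.Quotient.mk _ (linForm φ)), Φ (Ideal.Quotient.mk _ (linForm ψ)),
      π (X (Sum.inr i)), π (X (Sum.inr j))]
  have hwalg : ∀ k, IsAlgebraic (Algebra.adjoin K (Set.range s)) (π (X (Sum.inl k))) := by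
    intro k
    have hle : (Algebra.adjoin K (Set.range fun j => Ideal.Quotient.mk (coneIdeal C)
        (![linForm φ, linForm ψ] j))).map Φ ≤ Algebra.adjoin K (Set.range s) := by
      rw [AlgHom.map_adjoin]
      apply Algebra.adjoin_mono
      rintro _ ⟨_, ⟨j, rfl⟩, rfl⟩
      fin_cases j
      · exact ⟨0, rfl⟩
      · exact ⟨1, rfl⟩
    have := hint.isIntegral (Ideal.Quotient.mk _ (X k))
    have := IsIntegral.map_of_comp_eq
      (((Φ.toRingHom.comp (Algebra.adjoin K (Set.range fun j => Ideal.Quotient.mk (coneIdeal C)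
        (![linForm φ, linForm ψ] j))).val.toRingHom)).codRestrict
        (Algebra.adjoin K (Set.range s)) fun x => hle ⟨x.1, x.2, rfl⟩) Φ.toRingHom rfl this
    have hk : Φ (Ideal.Quotient.mk _ (X k)) = π (X (Sum.inl k)) := by
      simp [Φ, π]
    rw [← hk]
    exact this.isAlgebraic
  have hvalg := hij (Algebra.adjoin K (Set.range s)) hwalg
    (Algebra.subset_adjoin ⟨2, rfl⟩) (Algebra.subset_adjoin ⟨3, rfl⟩)
  have hall : ∀ p, π p ∈ Subalgebra.algebraicClosure (Algebra.adjoin K (Set.range s))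
      (MvPolynomial (Fin 6 ⊕ Fin 4) K ⧸ biconeIdeal (incidence C)) := by
    intro p
    induction p using MvPolynomial.induction_on with
    | C a => exact Subalgebra.algebraMap_mem _ (algebraMap K _ a)
    | add p q hp hq => rw [map_add]; exact add_mem hp hq
    | mul_X p k hp =>
      rw [map_mul]
      refine mul_mem hp ?_
      rcases k with k | l
      · exact hwalg k
      · exact hvalg l
  have := h5.le_of_isAlgebraic s ⟨fun x => by
    obtain ⟨p, rfl⟩ := Ideal.Quotient.mk_surjective x
    exact hall p⟩
  omega

/-- The coefficients of the linear form `w ↦ w ∧ z`. -/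
def pairCoeff (z : Fin 6 → K) : Fin 6 → K := ![z 5, -z 4, z 3, z 2, -z 1, z 0]

theorem sum_pairCoeff (z w : Fin 6 → K) : ∑ i, pairCoeff z i * w i = plPair w z := by
  simp [pairCoeff, plPair, Fin.sum_univ_succ]; ring

theorem pairCoeff_ne_zero {z : Fin 6 → K} (h : z ≠ 0) : pairCoeff z ≠ 0 := by
  intro h0
  apply h
  have := fun i => congrFun h0 i
  ext i
  have h1 := this 0; have h2 := this 1; have h3 := this 2; have h4 := this 3; have h5 := this 4
  have h6 := this 5
  simp [pairCoeff] at h1 h2 h3 h4 h5 h6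
  fin_cases i <;> simp [*]

theorem plucker_add_smul (a b b' : Fin 4 → K) (t : K) :
    plucker a (b + t • b') = plucker a b + t • plucker a b' := by
  ext i; fin_cases i <;> simp [plucker] <;> ring

theorem plPair_add_smul (w z z' : Fin 6 → K) (t : K) :
    plPair w (z + t • z') = plPair w z + t * plPair w z' := by
  simp [plPair]; ring

theorem plPair_zero_right (w : Fin 6 → K) : plPair w 0 = 0 := by simp [plPair]

theorem exists_mul_ne_of_mk_ne {n : ℕ} {v w : Fin n → K} (hv : v ≠ 0) (hw : w ≠ 0)
    (h : Projectivization.mk K v hv ≠ Projectivization.mk K w hw) :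
    ∃ i j, v i * w j ≠ v j * w i := by
  by_contra! h0
  apply h
  obtain ⟨j, hj⟩ := Function.ne_iff.1 hw
  rw [Projectivization.mk_eq_mk_iff']
  refine ⟨v j / w j, ?_⟩
  ext i
  have := h0 i j
  simp only [Pi.smul_apply, smul_eq_mul, Pi.zero_apply] at hj ⊢
  field_simp
  rw [← this, mul_comm]

/-- A hyperplane section of a curve by the lines meeting a given line is finite. -/
theorem finite_pairing {C : Set (PP K 6)} {d : ℕ} (hdeg : HasCurveDeg C d) {z w₀ : Fin 6 → K}
    (hw₀ : w₀ ∈ cone C) (hz : plPair w₀ z ≠ 0) :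
    (C ∩ hyp (pairCoeff z)).Finite ∧ (C ∩ hyp (pairCoeff z)).ncard ≤ d := by
  apply hdeg.1 _ (pairCoeff_ne_zero _)
  · intro h
    have := h hw₀.2
    rw [mk_mem_hyp, sum_pairCoeff] at this
    exact hz this
  · rintro rfl
    exact hz (plPair_zero_right _)

theorem exists_plucker_eq_smul {w : Fin 6 → K} (hw : w ≠ 0) (hq : plQuad w = 0) {a b : Fin 4 → K}
    (ha : wedgePt w a = 0) (hb : wedgePt w b = 0) : ∃ c : K, plucker a b = c • w := by
  obtain ⟨φ, rfl⟩ := exists_contr_eq hw ha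
  obtain ⟨ψ, rfl⟩ := exists_contr_eq hw hb
  exact ⟨_, plucker_contr hq φ ψ⟩

theorem exists_notMem_cone_sweep [Infinite K] {C : Set (PP K 6)} {d : ℕ} (hGr : C ⊆ grass K)
    (hdeg : HasCurveDeg C d) {x y : PP K 6} (hx : x ∈ C) (hy : y ∈ C) (hxy : x ≠ y) :
    ∃ v : Fin 4 → K, v ≠ 0 ∧ v ∉ cone (sweep C) := by
  obtain ⟨w, hw, rfl⟩ := exists_rep x
  obtain ⟨z, hz, rfl⟩ := exists_rep y
  obtain ⟨a, b, b', hM⟩ := exists_pairMinor_ne_zero (K := K) (exists_mul_ne_of_mk_ne hw hz hxy)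
  simp only [Algebra.algebraMap_self, RingHom.coe_id, Function.id_comp] at hM
  obtain ⟨w₀, hw₀, h0⟩ : ∃ w₀ ∈ cone C, plPair w₀ (plucker a b) ≠ 0 := by
    by_contra! h
    apply hM
    simp [pairMinor, h w ⟨hw, hx⟩, h z ⟨hz, hy⟩]
  have hfin := (finite_pairing hdeg hw₀ h0).1
  have hne : ∀ s : K, plucker a (b + s • b') ≠ 0 := by
    intro s hs
    apply hM
    rw [plucker_add_smul] at hs
    have h1 : plucker a b = -s • plucker a b' := by
      rw [neg_smul]; exact eq_neg_of_add_eq_zero_left hs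
    simp only [pairMinor, h1, plPair, Pi.smul_apply, smul_eq_mul]
    ring
  have hCfin : {s : K | plucker a (b + s • b') ∈ cone C}.Finite := by
    refine Set.Finite.of_finite_image (f := fun s : K => Projectivization.mk K _ (hne s))
      (hfin.subset ?_) ?_
    · rintro _ ⟨s, hs, rfl⟩
      refine ⟨hs.2, ?_⟩
      rw [mk_mem_hyp, sum_pairCoeff]
      simp [plPair, plucker]; ring
    · intro s _ t _ hst
      obtain ⟨c, hc⟩ := (Projectivization.mk_eq_mk_iff' K _ _ _ _).1 hst
      simp only [plucker_add_smul, smul_add, smul_smul] at hc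
      by_contra hne'
      have h1 : c = 1 := by
        by_contra hc1
        have hc2 : c - 1 ≠ 0 := sub_ne_zero.2 hc1
        have : plucker a b = ((s - c * t) / (c - 1)) • plucker a b' := by
          have : (c - 1) • plucker a b = (s - c * t) • plucker a b' := by
            rw [sub_smul, sub_smul, sub_eq_sub_iff_add_eq_add, one_smul, hc, add_comm]
          rw [div_eq_inv_mul, mul_smul, ← this, smul_smul, inv_mul_cancel₀ hc2, one_smul]
        apply hM
        simp only [pairMinor, this, plPair, Pi.smul_apply, smul_eq_mul]
        ring
      subst h1
      have : plucker a b' = 0 := by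
        have h3 : (t - s) • plucker a b' = 0 := by
          simp only [one_smul, one_mul, add_right_inj] at hc
          rw [sub_smul, hc, sub_self]
        exact (smul_eq_zero.1 h3).resolve_left (sub_ne_zero.2 (Ne.symm hne'))
      apply hM
      simp [pairMinor, this, plPair_zero_right]
  have hroot : {s : K | plPair w₀ (plucker a b) + s * plPair w₀ (plucker a b') = 0}.Finite := by
    refine Set.Subsingleton.finite fun s hs t ht => ?_
    simp only [Set.mem_ofPred_eq] at hs ht
    by_cases hb : plPair w₀ (plucker a b') = 0
    · rw [hb] at hs; simp [h0] at hs
    · exact mul_right_cancel₀ hb (by linear_combination hs - ht)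
  obtain ⟨s, hs⟩ := (hCfin.union hroot).infinite_compl.nonempty
  simp only [Set.mem_compl_iff, Set.mem_union, not_or, Set.mem_ofPred_eq] at hs
  set b₁ := b + s • b' with hb₁
  have hfin₁ := (finite_pairing hdeg hw₀ (z := plucker a b₁) (by
    rw [hb₁, plucker_add_smul, plPair_add_smul]; exact hs.2)).1
  by_contra! hall
  have hv : ∀ t : K, a + t • b₁ ≠ 0 := fun t => by
    simpa only [one_smul] using comb_ne_zero (hne s) (s := 1) (t := t) (.inl one_ne_zero)
  choose ww hww hwv using fun t => (mem_cone_sweep (hv t)).1 (hall _ (hv t))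
  have hinj : Function.Injective fun t : K => Projectivization.mk K (ww t) (hww t).1 := by
    intro t u htu
    by_contra hne'
    obtain ⟨c, hc⟩ := (Projectivization.mk_eq_mk_iff' K _ _ _ _).1 htu
    have h1 : wedgePt (ww u) (a + t • b₁) = 0 := by
      have := hwv t
      rw [← hc] at this
      have h2 := wedgePt_smul_smul c 1 (ww u) (a + t • b₁)
      rw [one_smul, this] at h2
      have hc0 : c ≠ 0 := by
        rintro rfl
        exact (hww t).1 (by rw [← hc, zero_smul])
      simpa [hc0] using h2.symm
    have h3 := hwv u
    rw [wedgePt_add, wedgePt_smul] at h1 h3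
    have hb0 : wedgePt (ww u) b₁ = 0 := by
      have : (t - u) • wedgePt (ww u) b₁ = 0 := by
        rw [sub_smul, sub_eq_zero]
        exact add_left_cancel (h1.trans h3.symm)
      exact (smul_eq_zero.1 this).resolve_left (sub_ne_zero.2 hne')
    have ha0 : wedgePt (ww u) a = 0 := by simpa [hb0] using h3
    apply hs.1
    obtain ⟨c, hc⟩ := exists_plucker_eq_smul (hww u).1 (plQuad_of_mem_cone hGr (hww u)) ha0 hb0
    have hc0 : c ≠ 0 := by
      rintro rfl
      exact hne s (by rw [hc, zero_smul])
    rw [hc]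
    exact smul_mem_cone (hww u) hc0
  apply Set.infinite_of_injective_forall_mem hinj (s := C ∩ hyp (pairCoeff (plucker a b₁))) _ hfin₁
  intro t
  refine ⟨(hww t).2, ?_⟩
  rw [mk_mem_hyp, sum_pairCoeff]
  refine plPair_eq_zero_of_wedgePt (s := 1) (t := t) (.inl one_ne_zero) ?_
  simpa using hwv t

theorem not_dimGE_sweep [IsAlgClosed K] {C : Set (PP K 6)} {d : ℕ} (hGr : C ⊆ grass K)
    (hdeg : HasCurveDeg C d) {x y : PP K 6} (hx : x ∈ C) (hy : y ∈ C) (hxy : x ≠ y) : ¬ dimGE (sweep C) 3 := by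
  rintro ⟨f, hf, hmono⟩
  obtain ⟨v, hv, hvS⟩ := exists_notMem_cone_sweep hGr hdeg hx hy hxy
  have h4 := HasIndep.chain 3 (fun i => coneIdeal (f i)) (fun i => isPrime_coneIdeal (hf i).2.1)
      (fun i j hij => coneIdeal_lt (hf i).1 (hmono hij)) (hasIndep_coneIdeal (hf 0).2.1.1)
  have h5 : HasIndep 5 (⊥ : Ideal (MvPolynomial (Fin 4) K)) := by
    refine h4.succ (bot_lt_iff_ne_bot.2 fun hbot => hvS ?_)
    have h6 : v ∈ cone (f (Fin.last 3)) := by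
      rw [(hf _).1.mem_cone_iff hv, hbot]
      rintro p rfl
      simp
    exact cone_subset_iff.2 (hf _).2.2 h6
  have := h5.le_of_isAlgebraic (fun i : Fin 4 => Ideal.Quotient.mk ⊥ (X i)) ⟨fun x => by
    obtain ⟨p, rfl⟩ := Ideal.Quotient.mk_surjective x
    have hp : Ideal.Quotient.mk ⊥ p ∈ Algebra.adjoin K (Set.range fun i : Fin 4 =>
        (Ideal.Quotient.mk (⊥ : Ideal (MvPolynomial (Fin 4) K)) (X i))) := by
      induction p using MvPolynomial.induction_on with
      | C a => exact Subalgebra.algebraMap_mem _ a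
      | add p q hp hq => rw [map_add]; exact add_mem hp hq
      | mul_X p k hp => rw [map_mul]; exact mul_mem hp (Algebra.subset_adjoin ⟨k, rfl⟩)
    exact isAlgebraic_algebraMap (⟨_, hp⟩ : Algebra.adjoin K _)⟩
  omega

/-! ### Derivations of function fields -/

/-- The partial derivative attached to a member of an algebraically independent family, on the
subalgebra generated by the family. -/
noncomputable def partialAdjoin {E ι : Type} [Field E] [Algebra K E] {v : ι → E}
    (hv : AlgebraicIndependent K v) (i : ι) :
    Derivation K (Algebra.adjoin K (Set.range v)) (Algebra.adjoin K (Set.range v)) :=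
  Derivation.mk' (hv.aevalEquiv.toLinearMap ∘ₗ (pderiv i).toLinearMap ∘ₗ
    hv.aevalEquiv.symm.toLinearMap) fun a b => by
      simp [Derivation.leibniz]

open scoped IntermediateField.algebraAdjoinAdjoin in
theorem exists_derivation_eq_single {E ι : Type} [Field E] [Algebra K E] [DecidableEq ι] {v : ι → E}
    (hv : AlgebraicIndependent K v)
    [Algebra.IsSeparable (IntermediateField.adjoin K (Set.range v)) E] (i : ι) :
    ∃ D : Derivation K E E, ∀ j, D (v j) = Pi.single (M := fun _ => E) i 1 j := by
  let A := Algebra.adjoin K (Set.range v)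
  let L := IntermediateField.adjoin K (Set.range v)
  have h1 : Algebra.FormallyEtale A L := Algebra.FormallyEtale.of_isLocalization (nonZeroDivisors _)
  have h2 : Algebra.FormallyEtale L E := Algebra.FormallyEtale.of_isSeparable _ E
  have h3 : Algebra.FormallyEtale A E := Algebra.FormallyEtale.comp A L E
  let d : Derivation K A E := (Algebra.linearMap A E).compDer (partialAdjoin hv i)
  let f : Ω[E⁄K] →ₗ[E] E := (LinearMap.liftBaseChange E d.liftKaehlerDifferential) ∘ₗ
    (KaehlerDifferential.tensorKaehlerEquivOfFormallyEtale K A E).symm.toLinearMap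
  refine ⟨f.compDer (KaehlerDifferential.D K E), fun j => ?_⟩
  have hs : hv.aevalEquiv.symm ⟨v j, Algebra.subset_adjoin ⟨j, rfl⟩⟩ = X j := by
    rw [AlgEquiv.symm_apply_eq]
    ext
    simp
  have hD : (KaehlerDifferential.tensorKaehlerEquivOfFormallyEtale K A E).symm
      (KaehlerDifferential.D K E (v j)) = _ :=
    KaehlerDifferential.tensorKaehlerEquivOfFormallyEtale_symm_D_algebraMap K A E
      ⟨v j, Algebra.subset_adjoin ⟨j, rfl⟩⟩
  change LinearMap.liftBaseChange E d.liftKaehlerDifferential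
    ((KaehlerDifferential.tensorKaehlerEquivOfFormallyEtale K A E).symm
      (KaehlerDifferential.D K E (v j))) = _
  rw [hD, LinearMap.liftBaseChange_tmul, Derivation.liftKaehlerDifferential_comp_D, one_smul]
  change algebraMap A E (hv.aevalEquiv (pderiv i (hv.aevalEquiv.symm
    ⟨v j, Algebra.subset_adjoin ⟨j, rfl⟩⟩))) = _
  rw [hs, pderiv_X, Pi.single_apply, Pi.single_apply]
  split_ifs <;> simp

/-- A derivation of the fraction field of `B` which kills generators of `B` vanishes. -/
theorem derivation_eq_zero_of_generators {B E ι : Type} [CommRing B] [IsDomain B] [Algebra K B]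
    [Field E] [Algebra K E] [Algebra B E] [IsScalarTower K B E] [IsFractionRing B E] {w : ι → B}
    (hw : Algebra.adjoin K (Set.range w) = ⊤) {D : Derivation K E E}
    (hD : ∀ k, D (algebraMap B E (w k)) = 0) : D = 0 := by
  have hB : ∀ b : B, D (algebraMap B E b) = 0 := by
    intro b
    have hb : b ∈ Algebra.adjoin K (Set.range w) := by rw [hw]; trivial
    induction hb using Algebra.adjoin_induction with
    | mem x hx => obtain ⟨k, rfl⟩ := hx; exact hD k
    | algebraMap r => rw [← IsScalarTower.algebraMap_apply]; exact D.map_algebraMap r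
    | add x y _ _ hx hy => rw [map_add, map_add, hx, hy, add_zero]
    | mul x y _ _ hx hy => rw [map_mul, D.leibniz, hx, hy, smul_zero, smul_zero, add_zero]
  ext x
  obtain ⟨a, b, hb, rfl⟩ := IsFractionRing.div_surjective (A := B) x
  simp [Derivation.leibniz_div, hB]

theorem exists_derivation_not_proportional [PerfectField K] {B E : Type} {n : ℕ} [CommRing B]
    [IsDomain B] [Algebra K B] [Field E] [Algebra K E] [Algebra B E] [IsScalarTower K B E]
    [IsFractionRing B E] {w : Fin n → B} (hw : Algebra.adjoin K (Set.range w) = ⊤)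
    {x : Fin 2 → B} (hx : AlgebraicIndependent K x) :
    ∃ D : Derivation K E E, ∃ i j, algebraMap B E (w i) * D (algebraMap B E (w j)) ≠
      algebraMap B E (w j) * D (algebraMap B E (w i)) := by
  classical
  have hft : Algebra.FiniteType K B := ⟨⟨Finset.univ.image w, by simpa using hw⟩⟩
  have : Algebra.EssFiniteType K E :=
    have := Algebra.EssFiniteType.of_isLocalization (R := B) E (nonZeroDivisors B)
    Algebra.EssFiniteType.comp K B E
  obtain ⟨s, hs, hsep⟩ := exists_isTranscendenceBasis_and_isSeparable_of_perfectField K E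
  have hsep' : Algebra.IsSeparable (IntermediateField.adjoin K (Set.range ((↑) : s → E))) E := by
    convert! hsep <;> simp
  have hcard : 1 < Fintype.card s := by
    have h2 := (hx.map' (f := IsScalarTower.toAlgHom K B E)
      (IsFractionRing.injective B E)).lift_cardinalMk_le_trdeg
    rw [← hs.cardinalMk_eq_trdeg] at h2
    simp at h2
    simpa using Nat.lt_of_succ_le h2
  obtain ⟨i, j, hij⟩ := Fintype.exists_pair_of_one_lt_card hcard
  by_contra! hprop
  have hw0 : ∃ k, algebraMap B E (w k) ≠ 0 := by
    by_contra! h0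
    obtain ⟨D, hD⟩ := exists_derivation_eq_single hs.1 i
    have : D = 0 := derivation_eq_zero_of_generators hw fun k => by rw [h0 k, map_zero]
    have := hD i
    simp [‹D = 0›] at this
  obtain ⟨k, hk⟩ := hw0
  obtain ⟨D₁, hD₁⟩ := exists_derivation_eq_single hs.1 i
  obtain ⟨D₂, hD₂⟩ := exists_derivation_eq_single hs.1 j
  set W := fun l => algebraMap B E (w l)
  have h0 : D₂ (W k) • D₁ - D₁ (W k) • D₂ = 0 := by
    apply derivation_eq_zero_of_generators hw
    intro l
    have e1 := hprop D₁ k l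
    have e2 := hprop D₂ k l
    simp only [Derivation.coe_sub, Derivation.coe_smul, Pi.sub_apply, Pi.smul_apply, smul_eq_mul]
    apply mul_left_cancel₀ hk
    simp only [W]
    linear_combination D₂ (W k) * e1 - D₁ (W k) * e2
  have hi := congrArg (fun D : Derivation K E E => D i) h0
  have hj := congrArg (fun D : Derivation K E E => D j) h0
  simp [hD₁, hD₂, hij, hij.symm] at hi hj
  have : D₁ = 0 := by
    apply derivation_eq_zero_of_generators hw
    intro l
    have e1 := hprop D₁ k l
    apply mul_left_cancel₀ hk
    rw [e1]
    simp only [W] at hj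
    simp [hj]
  have := hD₁ i
  simp [‹D₁ = 0›] at this

/-! ### Hypersurfaces and lines -/

/-- The restriction of a polynomial to the line `T ↦ x + T • a` with `R`-valued base point `x`. -/
noncomputable def genLine {σ R : Type} [CommRing R] [Algebra K R] (x : σ → R) (a : σ → K) :
    MvPolynomial σ K →ₐ[K] Polynomial R :=
  aeval fun k => Polynomial.C (x k) + Polynomial.X * Polynomial.C (algebraMap K R (a k))

theorem linePoly_eq_genLine {σ : Type} (x a : σ → K) (p : MvPolynomial σ K) :
    linePoly x a p = genLine x a p := rfl

theorem genLine_monomial {σ R : Type} [CommRing R] [Algebra K R] (x : σ → R) (a : σ → K)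
    (s : σ →₀ ℕ) :
    (genLine x a (monomial s 1)).natDegree ≤ s.degree ∧
      (genLine x a (monomial s 1)).coeff s.degree = algebraMap K R (eval a (monomial s 1)) := by
  induction s using Finsupp.induction_linear with
  | zero => simp [genLine]
  | add s t hs ht =>
    have h1 : (monomial (s + t) 1 : MvPolynomial σ K) = monomial s 1 * monomial t 1 := by
      rw [monomial_mul, one_mul]
    rw [h1, map_mul, map_mul, map_mul, map_add]
    exact ⟨Polynomial.natDegree_mul_le.trans (add_le_add hs.1 ht.1), by
      rw [Polynomial.coeff_mul_add_eq_of_natDegree_le hs.1 ht.1, hs.2, ht.2]⟩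
  | single i k =>
    have h1 : (monomial (Finsupp.single i k) 1 : MvPolynomial σ K) = X i ^ k := by
      rw [X_pow_eq_monomial]
    have h2 : (Polynomial.C (x i) + Polynomial.X *
        Polynomial.C (algebraMap K R (a i))).natDegree ≤ 1 := by
      compute_degree
    rw [h1, map_pow, map_pow, map_pow, Finsupp.degree_single]
    refine ⟨?_, ?_⟩
    · simpa [genLine] using Polynomial.natDegree_pow_le_of_le k h2
    · have := Polynomial.coeff_pow_of_natDegree_le (m := k) h2
      simp only [mul_one] at this
      simp only [genLine, aeval_X, eval_X]
      rw [← mul_one k] at this ⊢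
      simpa using this

theorem genLine_isHomogeneous {σ R : Type} [CommRing R] [Algebra K R] (x : σ → R) (a : σ → K)
    {F : MvPolynomial σ K} {e : ℕ} (hF : F.IsHomogeneous e) :
    (genLine x a F).natDegree ≤ e ∧ (genLine x a F).coeff e = algebraMap K R (eval a F) := by
  have key : ∀ s ∈ F.support, (genLine x a (monomial s (coeff s F))).natDegree ≤ e ∧
      (genLine x a (monomial s (coeff s F))).coeff e =
        algebraMap K R (eval a (monomial s (coeff s F))) := by
    intro s hs
    have hd : s.degree = e := degree_eq_of_isHomogeneous hF (mem_support_iff.1 hs)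
    obtain ⟨h1, h2⟩ := genLine_monomial x a s
    have h3 : monomial s (coeff s F) = coeff s F • (monomial s 1 : MvPolynomial σ K) := by
      rw [smul_monomial, smul_eq_mul, mul_one]
    rw [h3, map_smul, ← hd]
    refine ⟨(Polynomial.natDegree_smul_le _ _).trans h1, ?_⟩
    rw [Polynomial.coeff_smul, h2, smul_eval, map_mul, Algebra.smul_def]
  rw [F.as_sum, map_sum, map_sum, map_sum, Polynomial.finsetSum_coeff]
  exact ⟨Polynomial.natDegree_sum_le_of_forall_le _ _ fun s hs => (key s hs).1,
    Finset.sum_congr rfl fun s hs => (key s hs).2⟩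

theorem derivative_linePoly {σ : Type} [Fintype σ] (x a : σ → K) (p : MvPolynomial σ K) :
    Polynomial.derivative (linePoly x a p) = linePoly x a (∑ i, C (a i) * pderiv i p) := by
  classical
  simp only [linePoly_eq_genLine]
  induction p using MvPolynomial.induction_on with
  | C r => simp [genLine]
  | add p q hp hq => simp [hp, hq, mul_add, Finset.sum_add_distrib]
  | mul_X p i hp =>
    have h1 : ∑ j, C (a j) * pderiv j (p * X i) =
        (∑ j, C (a j) * pderiv j p) * X i + C (a i) * p := by
      simp only [Derivation.leibniz, pderiv_X, smul_eq_mul, mul_add, Finset.sum_add_distrib,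
        Finset.sum_mul]
      rw [add_comm]
      congr 1
      · exact Finset.sum_congr rfl fun j _ => by ring
      · rw [Finset.sum_eq_single i]
        · simp
        · intro j _ hj; simp [hj.symm]
        · simp
    rw [h1, map_mul, Polynomial.derivative_mul, hp, map_add, map_mul, map_mul]
    simp [genLine]
    ring

/-- The shear `x ↦ x + T • a` of the polynomial ring `K[x][T]`. -/
noncomputable def shear {σ : Type} (a : σ → K) :
    Polynomial (MvPolynomial σ K) →ₐ[K] Polynomial (MvPolynomial σ K) :=
  Polynomial.eval₂AlgHom (genLine X a) Polynomial.X fun _ => Commute.all _ _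

theorem shear_C {σ : Type} (a : σ → K) (p : MvPolynomial σ K) :
    shear a (Polynomial.C p) = genLine X a p := by simp [shear]

theorem shear_X {σ : Type} (a : σ → K) : shear a Polynomial.X = Polynomial.X := by simp [shear]

theorem genLine_X {σ R : Type} [CommRing R] [Algebra K R] (x : σ → R) (a : σ → K) (i : σ) :
    genLine x a (X i) = Polynomial.C (x i) + Polynomial.X * Polynomial.C (algebraMap K R (a i)) :=
  aeval_X _ _

theorem shear_shear_neg {σ : Type} (a : σ → K) (p : Polynomial (MvPolynomial σ K)) :
    shear a (shear (-a) p) = p := by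
  have h : (shear a).comp (shear (-a)) = AlgHom.id K _ := by
    apply Polynomial.algHom_ext'
    · apply MvPolynomial.algHom_ext
      intro i
      change shear a (shear (-a) (Polynomial.C (X i))) = Polynomial.C (X i)
      have hC (r : K) : shear a (Polynomial.C (C r)) = Polynomial.C (C r) := (shear a).commutes r
      rw [shear_C, genLine_X, map_add, map_mul, shear_C, genLine_X, shear_X, algebraMap_eq, hC,
        add_assoc, ← mul_add, ← map_add, ← map_add, Pi.neg_apply, add_neg_cancel, map_zero,
        map_zero, mul_zero, add_zero]
    · change shear a (shear (-a) Polynomial.X) = Polynomial.X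
      rw [shear_X, shear_X]
  exact congrArg (fun f => f p) h

/-- The shear as an automorphism. -/
noncomputable def shearEquiv {σ : Type} (a : σ → K) :
    Polynomial (MvPolynomial σ K) ≃ₐ[K] Polynomial (MvPolynomial σ K) :=
  AlgEquiv.ofAlgHom (shear a) (shear (-a)) (AlgHom.ext (shear_shear_neg a))
    (AlgHom.ext fun p => by simpa using shear_shear_neg (-a) p)

theorem prime_genLine {σ : Type} (a : σ → K) {F : MvPolynomial σ K} (hF : Prime F) :
    Prime (genLine (X : σ → MvPolynomial σ K) a F) := by
  rw [← shear_C]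
  exact (MulEquiv.prime_iff (shearEquiv a)).2 (Polynomial.prime_C_iff.2 hF)

theorem genLine_dvd_genLine {σ : Type} (a : σ → K) {F G : MvPolynomial σ K} :
    genLine (X : σ → MvPolynomial σ K) a F ∣ genLine X a G ↔ F ∣ G := by
  rw [← shear_C, ← shear_C]
  refine (map_dvd_iff (shearEquiv a)).trans ?_
  rw [Polynomial.C_dvd_iff_dvd_coeff]
  refine ⟨fun h => by simpa using h 0, fun h i => ?_⟩
  rw [Polynomial.coeff_C]
  split_ifs
  exacts [h, dvd_zero _]

theorem eval_genLine {σ : Type} (a b : σ → K) (t : K) (p : MvPolynomial σ K) :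
    eval b ((genLine (X : σ → MvPolynomial σ K) a p).eval (C t)) = eval (b + t • a) p := by
  have : ((eval b).comp (Polynomial.evalRingHom (C t))).comp
      (genLine (X : σ → MvPolynomial σ K) a).toRingHom = eval (b + t • a) := by
    apply MvPolynomial.ringHom_ext
    · intro r; simp
    · intro i; simp [genLine]; ring
  exact congrArg (fun f => f p) this

theorem exists_C_eq_of_prime {A : Type} [CommRing A] [IsDomain A] {P Q G : Polynomial A}
    (hP : Prime P) (hPQ : P ∣ Q) (hQ : Q.Monic) (hG : ¬ P ∣ G) :
    ∃ R : A, R ≠ 0 ∧ ∃ U V, Polynomial.C R = P * U + G * V := by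
  let I := Ideal.span {P}
  have hI : I.IsPrime := (Ideal.span_singleton_prime hP.ne_zero).2 hP
  have haeval (q : Polynomial A) :
      Polynomial.aeval (Ideal.Quotient.mk I Polynomial.X) q = Ideal.Quotient.mk I q := by
    have := Polynomial.aeval_algHom_apply (Ideal.Quotient.mkₐ A I) Polynomial.X q
    simpa using this
  have hX : IsIntegral A (Ideal.Quotient.mk I Polynomial.X) := by
    refine ⟨_, hQ, ?_⟩
    rw [← Polynomial.aeval_def, haeval, Ideal.Quotient.eq_zero_iff_mem]
    exact Ideal.mem_span_singleton.2 hPQ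
  have hadj : Algebra.adjoin A {Ideal.Quotient.mk I Polynomial.X} ≤
      integralClosure A (Polynomial A ⧸ I) := by
    rw [Algebra.adjoin_le_iff, Set.singleton_subset_iff]
    exact hX
  have hint : IsIntegral A (Ideal.Quotient.mk I G) := by
    rw [← haeval]
    exact hadj (Polynomial.aeval_mem_adjoin_singleton A _)
  have hinj : Function.Injective (algebraMap A (Polynomial A ⧸ I)) := by
    rw [injective_iff_map_eq_zero]
    intro r hr
    by_contra hr0
    have hr : P ∣ Polynomial.C r :=
      Ideal.mem_span_singleton.1 (Ideal.Quotient.eq_zero_iff_mem.1 hr)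
    have hdeg : P.natDegree = 0 := by
      have := Polynomial.natDegree_le_of_dvd hr (by simpa using hr0)
      simpa using this
    obtain ⟨g, hg⟩ := hPQ
    apply hP.not_isUnit
    rw [Polynomial.eq_C_of_natDegree_eq_zero hdeg]
    apply Polynomial.isUnit_C.2
    have : P.leadingCoeff * g.leadingCoeff = 1 := by
      rw [← Polynomial.leadingCoeff_mul, ← hg, hQ.leadingCoeff]
    rw [Polynomial.leadingCoeff, hdeg] at this
    exact IsUnit.of_mul_eq_one _ this
  have hG0 : Ideal.Quotient.mk I G ≠ 0 := by
    rw [Ne, Ideal.Quotient.eq_zero_iff_mem, Ideal.mem_span_singleton]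
    exact hG
  have : FaithfulSMul A (Polynomial A ⧸ I) := (faithfulSMul_iff_algebraMap_injective _ _).2 hinj
  obtain ⟨R, hR, ⟨y, hy⟩⟩ := hint.isAlgebraic.exists_nonzero_dvd
    (mem_nonZeroDivisors_of_ne_zero hG0)
  obtain ⟨V, rfl⟩ := Ideal.Quotient.mk_surjective y
  have h4 : Ideal.Quotient.mk I (Polynomial.C R - G * V) = 0 := by
    rw [map_sub, map_mul, ← hy, sub_eq_zero]; rfl
  rw [Ideal.Quotient.eq_zero_iff_mem, Ideal.mem_span_singleton] at h4
  obtain ⟨U, hU⟩ := h4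
  exact ⟨R, hR, U, V, by rw [← hU]; ring⟩

/-- Elimination along the direction `a`: away from a proper closed set of base points `b`, the
line `b + t • a` carries no common zero of the prime `F` and of a non-multiple `G` of `F`. -/
theorem exists_elimination {σ : Type} {a : σ → K} {F f G : MvPolynomial σ K} {e : ℕ}
    (hF : Prime F) (hFf : F ∣ f) (hf : f.IsHomogeneous e) (hfa : eval a f ≠ 0) (hG : ¬ F ∣ G) :
    ∃ R : MvPolynomial σ K, R ≠ 0 ∧ ∀ b, eval b R ≠ 0 → ∀ t : K,
      eval (b + t • a) F = 0 → eval (b + t • a) G ≠ 0 := by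
  have hg : (C (eval a f)⁻¹ * f).IsHomogeneous e := by
    simpa using (isHomogeneous_C σ (eval a f)⁻¹).mul hf
  have hmon : (genLine (X : σ → MvPolynomial σ K) a (C (eval a f)⁻¹ * f)).Monic := by
    obtain ⟨h2, h3⟩ := genLine_isHomogeneous (X : σ → MvPolynomial σ K) a hg
    refine Polynomial.monic_of_natDegree_le_of_coeff_eq_one e h2 (h3.trans ?_)
    simp [hfa]
  obtain ⟨R, hR, U, V, h⟩ := exists_C_eq_of_prime (prime_genLine a hF)
    ((genLine_dvd_genLine a).2 (hFf.mul_left (C (eval a f)⁻¹))) hmon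
    (fun h => hG ((genLine_dvd_genLine a).1 h))
  refine ⟨R, hR, fun b hb t h2 h3 => hb ?_⟩
  have h5 := congrArg (fun q => eval b (Polynomial.eval (C t) q)) h
  simpa only [Polynomial.eval_add, Polynomial.eval_mul, Polynomial.eval_C, map_add, map_mul,
    eval_genLine, h2, h3, zero_mul, add_zero] using h5

theorem exists_pderiv_ne_zero [PerfectField K] {σ : Type} [Fintype σ] {F : MvPolynomial σ K}
    (hF : Prime F) : ∃ i, pderiv i F ≠ 0 := by
  classical
  by_contra! h
  have hs : ∀ s ∈ F.support, ∀ i, (s i : K) = 0 := by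
    intro s hs i
    by_cases hsi : s i = 0
    · simp [hsi]
    have h1 := congrArg (coeff (s - Finsupp.single i 1)) (h i)
    have h2 : s - Finsupp.single i 1 + Finsupp.single i 1 = s :=
      tsub_add_cancel_of_le (by simpa [Nat.one_le_iff_ne_zero] using hsi)
    rw [coeff_pderiv, h2, coeff_zero] at h1
    rcases mul_eq_zero.1 h1 with h3 | h3
    · exact absurd h3 (mem_support_iff.1 hs)
    · have h4 : (s - Finsupp.single i 1 : σ →₀ ℕ) i + 1 = s i := by
        simp only [Finsupp.coe_tsub, Pi.sub_apply, Finsupp.single_eq_same]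
        omega
      rw [← h4]
      exact_mod_cast h3
  obtain ⟨p, hp⟩ := ExpChar.exists K
  have hroot : ∃ G, F = G ^ p ∧ (p = 1 → ∃ r, F = C r) := by
    cases hp with
    | @zero hchar =>
      have hF0 : F = C (coeff 0 F) := by
        ext s
        rw [coeff_C]
        split_ifs with h0
        · rw [h0]
        · by_contra hc
          refine h0 ?_
          ext i
          have := hs s (mem_support_iff.2 hc) i
          exact (Nat.cast_eq_zero.1 this).symm
      exact ⟨F, by simp, fun _ => ⟨_, hF0⟩⟩
    | prime hp =>
      have : Fact p.Prime := ⟨hp⟩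
      have hperf : PerfectRing K p := inferInstance
      choose g hg using fun c : K => surjective_frobenius K p c
      refine ⟨∑ s ∈ F.support, monomial (s.mapRange (· / p) (by simp)) (g (coeff s F)), ?_,
        fun h => absurd h hp.ne_one⟩
      rw [sum_pow_char]
      conv_lhs => rw [F.as_sum]
      refine Finset.sum_congr rfl fun s hs' => ?_
      rw [monomial_pow]
      have h1 : g (coeff s F) ^ p = coeff s F := hg (coeff s F)
      have h2 : p • s.mapRange (· / p) (by simp) = s := by
        ext i
        have := (CharP.cast_eq_zero_iff K p (s i)).1 (hs s hs' i)
        simp [Nat.mul_div_cancel' this]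
      rw [h1, h2]
  obtain ⟨G, hG, hG1⟩ := hroot
  by_cases hp1 : p = 1
  · obtain ⟨r, rfl⟩ := hG1 hp1
    refine hF.not_isUnit ((isUnit_map_iff C r).2 (Ne.isUnit ?_))
    rintro rfl
    exact hF.ne_zero (by simp)
  · rw [hG] at hF
    exact not_irreducible_pow hp1 hF.irreducible

theorem not_dvd_of_isHomogeneous {σ : Type} {F G : MvPolynomial σ K} {e : ℕ}
    (hF : F.IsHomogeneous e) (hF' : Prime F) (hG : G.IsHomogeneous (e - 1)) (hG0 : G ≠ 0) :
    ¬ F ∣ G := by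
  rintro ⟨H, rfl⟩
  have hH : H ≠ 0 := right_ne_zero_of_mul hG0
  have h1 := hG.totalDegree hG0
  rw [totalDegree_mul_of_isDomain hF'.ne_zero hH, hF.totalDegree hF'.ne_zero] at h1
  have he : e = 0 := by omega
  subst he
  apply hF'.not_isUnit
  rw [totalDegree_eq_zero_iff_eq_C.1 (hF.totalDegree hF'.ne_zero)]
  refine (isUnit_map_iff C _).2 (Ne.isUnit fun h => hF'.ne_zero ?_)
  rw [totalDegree_eq_zero_iff_eq_C.1 (hF.totalDegree hF'.ne_zero), h, map_zero]

theorem natDegree_linePoly {σ : Type} {F : MvPolynomial σ K} {a : σ → K} {e : ℕ}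
    (hF : F.IsHomogeneous e) (ha : eval a F ≠ 0) (b : σ → K) :
    (linePoly b a F).natDegree = e ∧ linePoly b a F ≠ 0 := by
  obtain ⟨h1, h2⟩ := genLine_isHomogeneous b a hF
  have h3 : (linePoly b a F).coeff e ≠ 0 := by
    rw [linePoly_eq_genLine, h2]
    simpa using ha
  exact ⟨h1.antisymm (Polynomial.le_natDegree_of_ne_zero h3), fun h => h3 (by simp [h])⟩

theorem finite_line_zeros {σ : Type} {F : MvPolynomial σ K} {a : σ → K} {e : ℕ}
    (hF : F.IsHomogeneous e) (ha : eval a F ≠ 0) (b : σ → K) :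
    {t : K | eval (b + t • a) F = 0}.Finite ∧ {t : K | eval (b + t • a) F = 0}.ncard ≤ e := by
  classical
  obtain ⟨h1, h2⟩ := natDegree_linePoly hF ha b
  have h3 : {t : K | eval (b + t • a) F = 0} = (linePoly b a F).roots.toFinset := by
    ext t
    simp [h2, Polynomial.IsRoot, eval_linePoly]
  rw [h3, Set.ncard_coe_finset]
  exact ⟨Finset.finite_toSet _,
    (Multiset.toFinset_card_le _).trans ((Polynomial.card_roots' _).trans h1.le)⟩

/-- The lines in a direction `a` along which the derivative of `F` does not vanish identically
meet the hypersurface `F = 0` in `deg F` distinct points, for a general base point. -/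
theorem exists_ncard_line_zeros [IsAlgClosed K] {σ : Type} [Fintype σ] {F : MvPolynomial σ K}
    {a : σ → K} {e : ℕ} (hF : F.IsHomogeneous e) (hF' : Prime F) (ha : eval a F ≠ 0)
    (hd : ∑ i, C (a i) * pderiv i F ≠ 0) :
    ∃ R : MvPolynomial σ K, R ≠ 0 ∧ ∀ b, eval b R ≠ 0 →
      {t : K | eval (b + t • a) F = 0}.ncard = e := by
  classical
  have hG : (∑ i, C (a i) * pderiv i F).IsHomogeneous (e - 1) :=
    IsHomogeneous.sum _ _ _ fun i _ => by
      simpa using (isHomogeneous_C σ (a i)).mul (hF.pderiv (i := i))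
  obtain ⟨R, hR, h⟩ := exists_elimination hF' dvd_rfl hF ha
    (not_dvd_of_isHomogeneous hF hF' hG hd)
  refine ⟨R, hR, fun b hb => ?_⟩
  obtain ⟨h1, h2⟩ := natDegree_linePoly hF ha b
  have h3 : {t : K | eval (b + t • a) F = 0} = (linePoly b a F).roots.toFinset := by
    ext t
    simp [h2, Polynomial.IsRoot, eval_linePoly]
  have hnd : (linePoly b a F).roots.Nodup := by
    rw [Multiset.nodup_iff_count_le_one]
    intro t
    rw [Polynomial.count_roots]
    by_contra! hc
    obtain ⟨h4, h5⟩ := (Polynomial.one_lt_rootMultiplicity_iff_isRoot h2).1 hc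
    rw [derivative_linePoly] at h5
    rw [Polynomial.IsRoot, eval_linePoly] at h4 h5
    exact h b hb t h4 h5
  rw [h3, Set.ncard_coe_finset, Multiset.toFinset_card_of_nodup hnd, ← h1]
  exact (IsAlgClosed.splits _).natDegree_eq_card_roots.symm

theorem ncard_line_section {n : ℕ} {F : MvPolynomial (Fin n) K} {e : ℕ} (hF : F.IsHomogeneous e)
    {c b : Fin n → K} (hc : eval c F ≠ 0) (hcb : ∀ s t : K, s • c + t • b = 0 → s = 0 ∧ t = 0)
    {Z : Set (PP K n)} (hZ : ∀ v (hv : v ≠ 0), Projectivization.mk K v hv ∈ Z ↔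
      eval v F = 0 ∧ ∃ s t : K, v = s • c + t • b) :
    Z.Finite ∧ Z.ncard ≤ e ∧ Z.ncard = {t : K | eval (b + t • c) F = 0}.ncard := by
  have hne (t : K) : b + t • c ≠ 0 := by
    intro h
    have := (hcb t 1 (by rw [one_smul, add_comm, h])).2
    exact one_ne_zero this
  let g : K → PP K n := fun t => Projectivization.mk K _ (hne t)
  have hg : Function.Injective g := by
    intro t t' h
    obtain ⟨r, hr⟩ := (Projectivization.mk_eq_mk_iff' K _ _ _ _).1 h
    have := hcb (r * t' - t) (r - 1) (by
      have : r • (b + t' • c) - (b + t • c) = 0 := by rw [hr, sub_self]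
      rw [← this]; module)
    have hr1 : r = 1 := by linear_combination this.2
    rw [hr1] at this
    linear_combination -this.1
  have hZg : Z = g '' {t : K | eval (b + t • c) F = 0} := by
    ext x
    obtain ⟨v, hv, rfl⟩ := exists_rep x
    rw [hZ v hv]
    constructor
    · rintro ⟨h0, s, t, rfl⟩
      have ht : t ≠ 0 := by
        rintro rfl
        simp only [zero_smul, add_zero] at h0 hv
        rw [eval_smul_of_isHomogeneous hF] at h0
        have hs : s ≠ 0 := by rintro rfl; simp at hv
        exact mul_ne_zero (pow_ne_zero _ hs) hc h0
      have hst : s • c + t • b = t • (b + (s / t) • c) := by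
        rw [smul_add, smul_smul, mul_div_cancel₀ _ ht, add_comm]
      refine ⟨s / t, ?_, ?_⟩
      · rw [hst, eval_smul_of_isHomogeneous hF] at h0
        exact (mul_eq_zero.1 h0).resolve_left (pow_ne_zero _ ht)
      · refine (Projectivization.mk_eq_mk_iff' K _ _ _ _).2 ⟨t⁻¹, ?_⟩
        rw [hst, smul_smul, inv_mul_cancel₀ ht, one_smul]
    · rintro ⟨t, ht, h⟩
      obtain ⟨r, hr⟩ := (Projectivization.mk_eq_mk_iff' K _ _ _ _).1 h
      have hr0 : r ≠ 0 := by
        rintro rfl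
        exact hne t (by rw [← hr, zero_smul])
      have hv' : v = r⁻¹ • (b + t • c) := by rw [← hr, smul_smul, inv_mul_cancel₀ hr0, one_smul]
      refine ⟨?_, r⁻¹ * t, r⁻¹, ?_⟩
      · rw [hv', eval_smul_of_isHomogeneous hF, ht, mul_zero]
      · rw [hv']; module
  obtain ⟨h1, h2⟩ := finite_line_zeros hF hc b
  have h3 : Z.ncard = {t : K | eval (b + t • c) F = 0}.ncard := by
    rw [hZg, Set.ncard_image_of_injective _ hg]
  exact ⟨hZg ▸ h1.image g, h3.trans_le h2, h3⟩

theorem exists_defining_form [IsAlgClosed K] {n : ℕ} {X : Set (PP K n)} (hXcl : ZClosed X)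
    (hX : (coneIdeal X).IsPrime) {a : Fin n → K} (ha : a ≠ 0) (haX : a ∉ cone X)
    (hline : ∀ b, ∃ t : K, b + t • a = 0 ∨ b + t • a ∈ cone X) :
    ∃ (e : ℕ) (F : MvPolynomial (Fin n) K), F.IsHomogeneous e ∧ Prime F ∧
      ∀ g, g ∈ coneIdeal X ↔ F ∣ g := by
  obtain ⟨f, hfX, ⟨k, hfk⟩, hfa⟩ := hXcl.exists_isHomogeneous ha haX
  have hf0 : f ≠ 0 := by rintro rfl; simp at hfa
  obtain ⟨F, hF, hFX, hFf⟩ : ∃ F, Prime F ∧ F ∈ coneIdeal X ∧ F ∣ f := by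
    obtain ⟨u, hu⟩ := UniqueFactorizationMonoid.factors_prod hf0
    have h1 : (UniqueFactorizationMonoid.factors f).prod ∈ coneIdeal X := by
      rw [← hu] at hfX
      exact ((hX.mem_or_mem hfX).resolve_right fun h => hX.ne_top
        (Ideal.eq_top_of_isUnit_mem _ h u.isUnit))
    obtain ⟨F, hF, hFX⟩ := (Ideal.IsPrime.multiset_prod_mem_iff_exists_mem hX _).1 h1
    exact ⟨F, UniqueFactorizationMonoid.prime_of_factor F hF, hFX,
      UniqueFactorizationMonoid.dvd_of_mem_factors hF⟩
  have hzero : ∀ g ∈ coneIdeal X, eval 0 g = 0 := by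
    intro g hg
    by_contra hc
    have h0 := homogeneousComponent_mem_coneIdeal hg 0
    rw [homogeneousComponent_zero] at h0
    have hu : IsUnit (C (coeff 0 g) : MvPolynomial (Fin n) K) := by
      refine (isUnit_map_iff C _).2 (Ne.isUnit fun h => hc ?_)
      simpa [constantCoeff_eq, eval_zero] using h
    exact hX.ne_top (Ideal.eq_top_of_isUnit_mem _ h0 hu)
  have hdvd : ∀ g ∈ coneIdeal X, F ∣ g := by
    intro g hg
    by_contra hFg
    obtain ⟨R, hR, h⟩ := exists_elimination hF hFf hfk hfa hFg
    obtain ⟨b, hb⟩ := exists_eval_ne_zero hR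
    obtain ⟨t, ht | ht⟩ := hline b
    · refine h b hb t ?_ ?_
      · rw [ht]; exact hzero F hFX
      · rw [ht]; exact hzero g hg
    · exact h b hb t (mem_coneIdeal.1 hFX _ ht) (mem_coneIdeal.1 hg _ ht)
  obtain ⟨e, hne⟩ : ∃ e, homogeneousComponent e F ≠ 0 := by
    by_contra! h
    apply hF.ne_zero
    rw [← sum_homogeneousComponent F]
    exact Finset.sum_eq_zero fun i _ => h i
  have hhom : F.IsHomogeneous e := by
    obtain ⟨u, hu⟩ := hdvd _ (homogeneousComponent_mem_coneIdeal hFX e)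
    have hu0 : u ≠ 0 := by rintro rfl; exact hne (by rw [hu, mul_zero])
    have he : e ≤ F.totalDegree := by
      by_contra! h
      exact hne (homogeneousComponent_eq_zero _ _ h)
    have hd := (homogeneousComponent_isHomogeneous e F).totalDegree hne
    rw [hu, totalDegree_mul_of_isDomain hF.ne_zero hu0] at hd
    have hud : u.totalDegree = 0 := by omega
    rw [totalDegree_eq_zero_iff_eq_C] at hud
    have hc : coeff 0 u ≠ 0 := by intro h; rw [h, map_zero] at hud; exact hu0 hud
    have hF' : F = C (coeff 0 u)⁻¹ * homogeneousComponent e F := by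
      rw [hu]
      conv_rhs => rw [hud]
      rw [mul_comm F, ← mul_assoc, ← map_mul]
      simp [hc]
    have := (isHomogeneous_C (Fin n) (coeff 0 u)⁻¹).mul
      (homogeneousComponent_isHomogeneous e F)
    rwa [← hF', zero_add] at this
  exact ⟨_, F, hhom, hF, fun g => ⟨hdvd g, fun h => Ideal.mem_of_dvd _ h hFX⟩⟩

theorem mem_cone_iff_eval_eq_zero {n : ℕ} {X : Set (PP K n)} (hXcl : ZClosed X)
    {F : MvPolynomial (Fin n) K} (hF : ∀ g, g ∈ coneIdeal X ↔ F ∣ g) {v : Fin n → K} (hv : v ≠ 0) :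
    v ∈ cone X ↔ eval v F = 0 := by
  rw [hXcl.mem_cone_iff hv]
  refine ⟨fun h => h F ((hF F).2 dvd_rfl), fun h p hp => ?_⟩
  obtain ⟨q, rfl⟩ := (hF p).1 hp
  simp [h]

/-! ### Linear projections of curves -/

/-- The value at `w` of the linear map with rows `φ`. -/
def linVal {n m : ℕ} (φ : Fin m → Fin n → K) (w : Fin n → K) : Fin m → K :=
  fun j => ∑ i, φ j i * w i

theorem linVal_smul {n m : ℕ} (φ : Fin m → Fin n → K) (c : K) (w : Fin n → K) :
    linVal φ (c • w) = c • linVal φ w := by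
  ext j
  simp only [linVal, Pi.smul_apply, smul_eq_mul, Finset.mul_sum]
  exact Finset.sum_congr rfl fun i _ => by ring

/-- The image of `X` under the linear projection with rows `φ`. -/
def linImage {n m : ℕ} (X : Set (PP K n)) (φ : Fin m → Fin n → K) : Set (PP K m) :=
  {y | ∃ w ∈ cone X, ∃ h, Projectivization.mk K (linVal φ w) h = y}

theorem mem_cone_linImage {n m : ℕ} {X : Set (PP K n)} {φ : Fin m → Fin n → K}
    (hφ : ∀ w ∈ cone X, linVal φ w ≠ 0) {v : Fin m → K} :
    v ∈ cone (linImage X φ) ↔ ∃ w ∈ cone X, linVal φ w = v := by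
  constructor
  · rintro ⟨hv, w, hw, h, he⟩
    obtain ⟨r, hr⟩ := (Projectivization.mk_eq_mk_iff' K _ _ _ _).1 he
    have hr0 : r ≠ 0 := by
      rintro rfl
      exact h (by rw [← hr, zero_smul])
    refine ⟨r⁻¹ • w, smul_mem_cone hw (inv_ne_zero hr0), ?_⟩
    rw [linVal_smul, ← hr, smul_smul, inv_mul_cancel₀ hr0, one_smul]
  · rintro ⟨w, hw, rfl⟩
    exact ⟨hφ w hw, w, hw, hφ w hw, rfl⟩

theorem zClosed_linImage [IsAlgClosed K] {n m : ℕ} {X : Set (PP K n)} (hX : ZClosed X)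
    {φ : Fin m → Fin n → K} (hφ : ∀ w ∈ cone X, linVal φ w ≠ 0) : ZClosed (linImage X φ) := by
  classical
  refine zClosed_of_bilinear hX (r := m * m) (fun p i =>
    (if i = (finProdFinEquiv.symm p).1 then linForm (φ (finProdFinEquiv.symm p).2) else 0) -
      (if i = (finProdFinEquiv.symm p).2 then linForm (φ (finProdFinEquiv.symm p).1) else 0))
    (fun p i => ?_) fun v hv => ?_
  · refine IsHomogeneous.sub ?_ ?_ <;> split_ifs <;>
      first | exact isHomogeneous_linForm _ | exact isHomogeneous_zero _ _ _
  · rw [mem_cone_linImage hφ]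
    have key : ∀ w (j k : Fin m), ∑ i, v i * eval w ((if i = j then linForm (φ k) else 0) -
        (if i = k then linForm (φ j) else 0)) = v j * linVal φ w k - v k * linVal φ w j := by
      intro w j k
      simp only [map_sub, mul_sub, Finset.sum_sub_distrib, apply_ite (eval w), map_zero, mul_ite,
        mul_zero, Finset.sum_ite_eq', Finset.mem_univ, if_true, eval_linForm, linVal]
    constructor
    · rintro ⟨w, hw, rfl⟩
      refine ⟨w, hw, fun p => ?_⟩
      rw [key]
      ring
    · rintro ⟨w, hw, h⟩
      obtain ⟨k, hk⟩ := Function.ne_iff.1 (hφ w hw)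
      have hk : linVal φ w k ≠ 0 := hk
      have hvk : v = (v k / linVal φ w k) • linVal φ w := by
        ext j
        have := h (finProdFinEquiv (j, k))
        rw [key] at this
        simp only [Equiv.symm_apply_apply] at this
        simp only [Pi.smul_apply, smul_eq_mul]
        field_simp
        linear_combination this
      have hc : v k / linVal φ w k ≠ 0 := by
        intro h0
        rw [h0, zero_smul] at hvk
        exact hv hvk
      exact ⟨_, smul_mem_cone hw hc, by rw [linVal_smul, ← hvk]⟩

theorem mem_coneIdeal_linImage {n m : ℕ} {X : Set (PP K n)} {φ : Fin m → Fin n → K}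
    (hφ : ∀ w ∈ cone X, linVal φ w ≠ 0) {g : MvPolynomial (Fin m) K} :
    g ∈ coneIdeal (linImage X φ) ↔ aeval (fun j => linForm (φ j)) g ∈ coneIdeal X := by
  rw [mem_coneIdeal, mem_coneIdeal]
  have key (w : Fin n → K) : eval w (aeval (fun j => linForm (φ j)) g) = eval (linVal φ w) g := by
    rw [eval_aeval]
    simp only [eval_linForm]
    rfl
  constructor
  · intro h w hw
    rw [key]
    exact h _ ((mem_cone_linImage hφ).2 ⟨w, hw, rfl⟩)
  · intro h v hv
    obtain ⟨w, hw, rfl⟩ := (mem_cone_linImage hφ).1 hv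
    rw [← key]
    exact h w hw

theorem isPrime_coneIdeal_linImage {n m : ℕ} {X : Set (PP K n)} [hX : (coneIdeal X).IsPrime]
    {φ : Fin m → Fin n → K} (hφ : ∀ w ∈ cone X, linVal φ w ≠ 0) :
    (coneIdeal (linImage X φ)).IsPrime := by
  have : coneIdeal (linImage X φ) =
      (coneIdeal X).comap (aeval (R := K) fun j => linForm (φ j)) := by
    ext g
    exact mem_coneIdeal_linImage hφ
  rw [this]
  exact Ideal.comap_isPrime _ _

theorem derivation_aeval {E σ : Type} [Field E] [Algebra K E] [Fintype σ] (D : Derivation K E E)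
    (ξ : σ → E) (p : MvPolynomial σ K) :
    D (aeval ξ p) = ∑ j, aeval ξ (pderiv j p) * D (ξ j) := by
  classical
  induction p using MvPolynomial.induction_on with
  | C r => simp
  | add p q hp hq => simp [hp, hq, add_mul, Finset.sum_add_distrib]
  | mul_X p i hp =>
    rw [map_mul, D.leibniz, hp, aeval_X]
    simp only [Derivation.leibniz, pderiv_X, smul_eq_mul, map_add, map_mul, aeval_X, add_mul,
      Finset.sum_add_distrib, Finset.mul_sum]
    congr 1
    · rw [Finset.sum_eq_single i]
      · simp
      · intro j _ hj; simp [hj.symm]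
      · simp
    · exact Finset.sum_congr rfl fun j _ => by ring

/-- If a derivation separates the first two coordinates of a generic point `ξ` of an irreducible
plane curve, then the equation of the curve is separable in the third variable. -/
theorem pderiv_two_ne_zero [PerfectField K] {E : Type} [Field E] [Algebra K E] {ξ : Fin 3 → E}
    {G : MvPolynomial (Fin 3) K} {m : ℕ} (hG : G.IsHomogeneous m) (hG' : Prime G)
    (hξ : ∀ p, aeval ξ p = 0 ↔ G ∣ p) {D : Derivation K E E} (hD : ξ 0 * D (ξ 1) ≠ ξ 1 * D (ξ 0)) :
    pderiv 2 G ≠ 0 := by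
  intro h2
  have h0 : aeval ξ G = 0 := (hξ G).2 dvd_rfl
  have h3 := derivation_aeval D ξ G
  have h4 := congrArg (aeval ξ) hG.sum_X_mul_pderiv
  simp only [Fin.sum_univ_three, h2, h0, map_zero, map_add, map_mul, aeval_X, zero_mul, mul_zero,
    add_zero, smul_zero, map_nsmul] at h3 h4
  have hz : ∀ j, pderiv j G = 0 := by
    have key : ∀ j, aeval ξ (pderiv j G) = 0 → pderiv j G = 0 := fun j hj => by
      by_contra hc
      exact not_dvd_of_isHomogeneous hG hG' hG.pderiv hc ((hξ _).1 hj)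
    have hdet : ξ 0 * D (ξ 1) - ξ 1 * D (ξ 0) ≠ 0 := sub_ne_zero.2 hD
    intro j
    fin_cases j
    · exact key 0 (mul_right_cancel₀ hdet (by linear_combination D (ξ 1) * h4 + ξ 1 * h3))
    · exact key 1 (mul_right_cancel₀ hdet (by linear_combination -D (ξ 0) * h4 - ξ 0 * h3))
    · exact h2
  obtain ⟨j, hj⟩ := exists_pderiv_ne_zero hG'
  exact hj (hz j)

/-- A plane curve of degree `m`, not containing the line `X 2 = 0`, meets it in at most `m`
points. -/
theorem ncard_plane_section_le [Infinite K] {G : MvPolynomial (Fin 3) K} {m : ℕ}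
    (hG : G.IsHomogeneous m) (hG' : Prime G) (he : eval ![0, 0, 1] G ≠ 0) (h2 : ¬ G ∣ X 2)
    {Z : Set (PP K 3)} (hZ : ∀ v (hv : v ≠ 0), Projectivization.mk K v hv ∈ Z ↔
      eval v G = 0 ∧ v 2 = 0) : Z.Finite ∧ Z.ncard ≤ m := by
  obtain ⟨R, hR, hRb⟩ := exists_elimination hG' dvd_rfl hG he h2
  obtain ⟨b, hb⟩ := exists_eval_ne_zero (mul_ne_zero hR (X_ne_zero (R := K) (0 : Fin 3)))
  simp only [map_mul, eval_X] at hb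
  have hb0 := right_ne_zero_of_mul hb
  have hu : eval ![b 0, b 1, 0] G ≠ 0 := by
    intro h
    have hbe : b + (-b 2) • ![0, 0, 1] = ![b 0, b 1, 0] := by
      ext i; fin_cases i <;> simp
    have := hRb b (left_ne_zero_of_mul hb) (-b 2) (by rw [hbe]; exact h)
    rw [hbe] at this
    simp at this
  have := ncard_line_section hG (c := ![b 0, b 1, 0]) (b := ![0, 1, 0]) (Z := Z) hu ?_ ?_
  · exact ⟨this.1, this.2.1⟩
  · intro s t h
    have h0 := congrFun h 0
    have h1 := congrFun h 1
    simp [hb0] at h0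
    simp [h0] at h1
    exact ⟨h0, h1⟩
  · intro v hv
    rw [hZ]
    refine and_congr_right fun _ => ⟨fun h => ⟨v 0 / b 0, v 1 - v 0 / b 0 * b 1, ?_⟩, ?_⟩
    · ext i; fin_cases i <;> simp [h, hb0]
    · rintro ⟨s, t, rfl⟩; simp

theorem sum_comb_mul {n : ℕ} (φ : Fin 3 → Fin n → K) (p q : K) (w : Fin n → K) :
    ∑ i, (p • φ 0 - q • φ 1) i * w i = p * linVal φ w 0 - q * linVal φ w 1 := by
  simp only [linVal, Finset.mul_sum, ← Finset.sum_sub_distrib]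
  exact Finset.sum_congr rfl fun i _ => by simp; ring

/-- Projecting a curve to the plane: the hyperplane sections in a general member of a pencil have at
least as many points as a set of separated points in one hyperplane section. -/
theorem exists_ncard_le_ncard_pencil_section [IsAlgClosed K] {n : ℕ} {C : Set (PP K n)} (hCcl : ZClosed C)
    (hC : ZIrred C) {x y : PP K n} (hx : x ∈ C) (hy : y ∈ C) (hxy : x ≠ y)
    {φ : Fin 3 → Fin n → K} (h01 : ∀ w ∈ cone C, linVal φ w 0 = 0 → linVal φ w 1 ≠ 0)
    (h2 : ∃ w ∈ cone C, linVal φ w 2 ≠ 0) {E : Type} [Field E] [Algebra K E] {ξ : Fin n → E}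
    (hξ : ∀ p, aeval ξ p = 0 ↔ p ∈ coneIdeal C) {D : Derivation K E E}
    (hD : aeval ξ (linForm (φ 0)) * D (aeval ξ (linForm (φ 1))) ≠
      aeval ξ (linForm (φ 1)) * D (aeval ξ (linForm (φ 0))))
    {T : Set (PP K n)} (hT : T ⊆ C ∩ hyp (φ 2))
    (hsep : ∀ x ∈ T, ∀ y ∈ T, x ≠ y →
      linVal φ x.rep 0 * linVal φ y.rep 1 ≠ linVal φ y.rep 0 * linVal φ x.rep 1) :
    ∃ R : MvPolynomial (Fin 3) K, R ≠ 0 ∧ ∀ β, eval β R ≠ 0 →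
      (C ∩ hyp (β 1 • φ 0 - β 0 • φ 1)).Finite →
      T.ncard ≤ (C ∩ hyp (β 1 • φ 0 - β 0 • φ 1)).ncard := by
  classical
  have hφ : ∀ w ∈ cone C, linVal φ w ≠ 0 := fun w hw h =>
    h01 w hw (by rw [h]; rfl) (by rw [h]; rfl)
  have hprime := isPrime_coneIdeal hC
  have hYcl := zClosed_linImage hCcl hφ
  have hYprime := isPrime_coneIdeal_linImage hφ
  have he0 : (![0, 0, 1] : Fin 3 → K) ≠ 0 := fun h => by simpa using congrFun h 2
  have heY : (![0, 0, 1] : Fin 3 → K) ∉ cone (linImage C φ) := by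
    rw [mem_cone_linImage hφ]
    rintro ⟨w, hw, h⟩
    exact h01 w hw (by rw [h]; rfl) (by rw [h]; rfl)
  have hline : ∀ b : Fin 3 → K, ∃ t : K, b + t • ![0, 0, 1] = 0 ∨
      b + t • ![0, 0, 1] ∈ cone (linImage C φ) := by
    intro b
    by_cases hb : b 0 = 0 ∧ b 1 = 0
    · refine ⟨-b 2, Or.inl ?_⟩
      ext i; fin_cases i <;> simp [hb.1, hb.2]
    · obtain ⟨w, hw, h⟩ := exists_mem_cone_linForm_eq_zero hCcl hC hx hy hxy
        (b 1 • φ 0 - b 0 • φ 1)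
      rw [sum_comb_mul] at h
      obtain ⟨c, hc, hc0, hc1⟩ : ∃ c : K, c ≠ 0 ∧ c * linVal φ w 0 = b 0 ∧
          c * linVal φ w 1 = b 1 := by
        by_cases h0 : linVal φ w 0 = 0
        · have h1 := h01 w hw h0
          have hb0 : b 0 = 0 := by simpa [h0, h1] using h
          refine ⟨b 1 / linVal φ w 1, div_ne_zero (fun hb1 => hb ⟨hb0, hb1⟩) h1, ?_, ?_⟩
          · rw [h0, hb0, mul_zero]
          · field_simp
        · refine ⟨b 0 / linVal φ w 0, div_ne_zero (fun hb0 => hb ⟨hb0, ?_⟩) h0, ?_, ?_⟩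
          · simpa [h0, hb0] using h
          · field_simp
          · field_simp
            linear_combination -h
      refine ⟨c * linVal φ w 2 - b 2, Or.inr ((mem_cone_linImage hφ).2
        ⟨c • w, smul_mem_cone hw hc, ?_⟩)⟩
      rw [linVal_smul]
      ext i; fin_cases i <;> simp [hc0, hc1]
  obtain ⟨m, G, hG, hG', hGY⟩ := exists_defining_form hYcl hYprime he0 heY hline
  have heG : eval ![0, 0, 1] G ≠ 0 := fun h => heY ((mem_cone_iff_eval_eq_zero hYcl hGY he0).2 h)
  have hG2 : pderiv 2 G ≠ 0 := by
    refine pderiv_two_ne_zero hG hG' (ξ := fun j => aeval ξ (linForm (φ j))) (fun p => ?_) hD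
    rw [← hGY, mem_coneIdeal_linImage hφ, ← hξ, ← AlgHom.comp_apply, comp_aeval]
  obtain ⟨R, hR, hRb⟩ := exists_ncard_line_zeros hG hG' heG (by
    simpa [Fin.sum_univ_three] using hG2)
  have hTm : T.ncard ≤ m := by
    have hX2 : ¬ G ∣ X 2 := by
      rw [← hGY, mem_coneIdeal_linImage hφ, mem_coneIdeal]
      intro h
      obtain ⟨w, hw, h2⟩ := h2
      have := h w hw
      rw [aeval_X, eval_linForm] at this
      exact h2 this
    let Z : Set (PP K 3) := {y | eval y.rep G = 0 ∧ y.rep 2 = 0}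
    obtain ⟨hZ, hZm⟩ := ncard_plane_section_le (Z := Z) hG hG' heG hX2 (fun v hv => by
      obtain ⟨c, hc⟩ := Projectivization.exists_smul_eq_mk_rep K v hv
      simp only [Z, Set.mem_ofPred_eq, ← hc]
      rw [show c • v = (c : K) • v from rfl, eval_smul_of_isHomogeneous hG]
      simp)
    have hcone : ∀ x ∈ T, x.rep ∈ cone C := fun x hx =>
      ⟨x.rep_nonzero, by rw [x.mk_rep]; exact (hT hx).1⟩
    let g : PP K n → PP K 3 := fun x => if h : linVal φ x.rep = 0 then
      Projectivization.mk K _ he0 else Projectivization.mk K _ h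
    refine (Set.ncard_le_ncard_of_injOn g ?_ ?_ hZ).trans hZm
    · intro x hx
      have hx0 := hφ _ (hcone x hx)
      simp only [g, hx0, dite_false]
      obtain ⟨c, hc⟩ := Projectivization.exists_smul_eq_mk_rep K _ hx0
      simp only [Z, Set.mem_ofPred_eq, ← hc]
      rw [show c • linVal φ x.rep = (c : K) • linVal φ x.rep from rfl,
        eval_smul_of_isHomogeneous hG]
      have h1 := (mem_cone_iff_eval_eq_zero hYcl hGY hx0).1
        ((mem_cone_linImage hφ).2 ⟨_, hcone x hx, rfl⟩)
      have h2 : linVal φ x.rep 2 = 0 := (hT hx).2 _ x.rep_nonzero x.mk_rep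
      simp [h1, h2]
    · intro x hx y hy h
      by_contra hne
      have hx0 := hφ _ (hcone x hx)
      have hy0 := hφ _ (hcone y hy)
      simp only [g, hx0, hy0, dite_false] at h
      obtain ⟨c, hc⟩ := (Projectivization.mk_eq_mk_iff' K _ _ _ _).1 h
      apply hsep x hx y hy hne
      rw [← hc]
      simp only [Pi.smul_apply, smul_eq_mul]
      ring
  refine ⟨R * X 0, mul_ne_zero hR (X_ne_zero _), fun β hβ hfin => hTm.trans ?_⟩
  simp only [map_mul, eval_X] at hβ
  have hβ0 := right_ne_zero_of_mul hβ
  rw [← hRb β (left_ne_zero_of_mul hβ)]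
  have hw : ∀ t : K, ∃ w : Fin n → K, eval (β + t • ![0, 0, 1]) G = 0 →
      w ∈ cone C ∧ linVal φ w = β + t • ![0, 0, 1] := by
    intro t
    by_cases h : eval (β + t • ![0, 0, 1]) G = 0
    · have hne : β + t • ![0, 0, 1] ≠ 0 := fun h0 => hβ0 (by simpa using congrFun h0 0)
      obtain ⟨w, hw⟩ := (mem_cone_linImage hφ).1 ((mem_cone_iff_eval_eq_zero hYcl hGY hne).2 h)
      exact ⟨w, fun _ => hw⟩
    · exact ⟨0, fun h' => absurd h' h⟩
  choose w hw using hw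
  let g : K → PP K n := fun t => if h : w t = 0 then x else Projectivization.mk K _ h
  refine Set.ncard_le_ncard_of_injOn g ?_ ?_ hfin
  · intro t ht
    obtain ⟨h1, h2⟩ := hw t ht
    simp only [g, h1.1, dite_false]
    refine ⟨(mk_mem_iff_mem_cone h1.1).2 h1, (mk_mem_hyp h1.1).2 ?_⟩
    rw [sum_comb_mul, h2]
    simp
    ring
  · intro t ht s hs h
    obtain ⟨h1, h2⟩ := hw t ht
    obtain ⟨h3, h4⟩ := hw s hs
    simp only [g, h1.1, h3.1, dite_false] at h
    obtain ⟨c, hc⟩ := (Projectivization.mk_eq_mk_iff' K _ _ _ _).1 h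
    have h5 := h2
    rw [← hc, linVal_smul, h4] at h5
    have h6 : c * (β 0 + s * 0) = β 0 + t * 0 := congrFun h5 0
    have h7 : c * (β 2 + s * 1) = β 2 + t * 1 := congrFun h5 2
    have hc1 : c = 1 := mul_right_cancel₀ hβ0 (by linear_combination h6)
    rw [hc1] at h7
    linear_combination -h7

/-! ### The degree of the union of the lines -/

theorem exists_add_smul_eq_zero {a b : Fin 4 → K} (ha : a ≠ 0) (h : plucker a b = 0) :
    ∃ t : K, b + t • a = 0 := by
  obtain ⟨j, hj⟩ := Function.ne_iff.1 ha
  refine ⟨-(b j / a j), ?_⟩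
  have h0 := congrFun h 0
  have h1 := congrFun h 1
  have h2 := congrFun h 2
  have h3 := congrFun h 3
  have h4 := congrFun h 4
  have h5 := congrFun h 5
  simp only [plucker, Matrix.cons_val, Pi.zero_apply] at h0 h1 h2 h3 h4 h5 hj
  have aux : ∀ i, a j * b i = a i * b j := by
    intro i
    fin_cases i <;> fin_cases j <;> simp only [Fin.reduceFinMk, Fin.mk_zero, Fin.mk_one,
      Fin.isValue] <;> grind
  ext i
  simp only [Pi.add_apply, Pi.smul_apply, smul_eq_mul, Pi.zero_apply]
  field_simp
  linear_combination aux i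

theorem IsLineRep.exists_plucker_of_mem {w : Fin 6 → K} (hw : IsLineRep w) {c : Fin 4 → K}
    (hc : c ≠ 0) (hwc : wedgePt w c = 0) : ∃ b, w = plucker c b := by
  obtain ⟨φ, rfl⟩ := exists_contr_eq hw.1 hwc
  obtain ⟨j, hj⟩ := Function.ne_iff.1 hc
  refine ⟨(contr w φ j)⁻¹ • contr w (Pi.single j 1), ?_⟩
  rw [plucker_smul_right, plucker_contr hw.2, smul_smul]
  simp only [Pi.single_apply, ite_mul, one_mul, zero_mul, Finset.sum_ite_eq', Finset.mem_univ,
    if_true]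
  rw [inv_mul_cancel₀ hj, one_smul]

theorem exists_sweep_form [IsAlgClosed K] {C : Set (PP K 6)} {d : ℕ} (hGr : C ⊆ grass K)
    (hCcl : ZClosed C) (hC : ZIrred C) (hdeg : HasCurveDeg C d) {x y : PP K 6} (hx : x ∈ C)
    (hy : y ∈ C) (hxy : x ≠ y) :
    ∃ (e : ℕ) (F : MvPolynomial (Fin 4) K), F.IsHomogeneous e ∧ Prime F ∧
      ∀ g, g ∈ coneIdeal (sweep C) ↔ F ∣ g := by
  obtain ⟨a, ha, haS⟩ := exists_notMem_cone_sweep hGr hdeg hx hy hxy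
  refine exists_defining_form (zClosed_sweep hCcl) (isPrime_coneIdeal (zIrred_sweep hGr hC)) ha haS
    fun b => ?_
  by_cases hab : plucker a b = 0
  · obtain ⟨t, ht⟩ := exists_add_smul_eq_zero ha hab
    exact ⟨t, Or.inl ht⟩
  · obtain ⟨w, hw, h⟩ := exists_mem_cone_linForm_eq_zero hCcl hC hx hy hxy
      (pairCoeff (plucker a b))
    rw [sum_pairCoeff] at h
    obtain ⟨s, t, hst, hwst⟩ := exists_comb_of_plPair_eq_zero (plQuad_of_mem_cone hGr hw) h
    have hS := (mem_cone_sweep (comb_ne_zero hab hst)).2 ⟨w, hw, hwst⟩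
    have ht : t ≠ 0 := by
      rintro rfl
      have hs : s ≠ 0 := by simpa using hst
      rw [zero_smul, add_zero] at hS
      have := smul_mem_cone hS (inv_ne_zero hs)
      rw [smul_smul, inv_mul_cancel₀ hs, one_smul] at this
      exact haS this
    refine ⟨s / t, Or.inr ?_⟩
    have := smul_mem_cone hS (inv_ne_zero ht)
    rwa [smul_add, smul_smul, smul_smul, inv_mul_cancel₀ ht, one_smul, add_comm,
      inv_mul_eq_div] at this

theorem ncard_surface_line_section {S : Set (PP K 4)} (hScl : ZClosed S)
    {F : MvPolynomial (Fin 4) K} {e : ℕ} (hF : F.IsHomogeneous e)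
    (hFS : ∀ g, g ∈ coneIdeal S ↔ F ∣ g) {a b : Fin 4 → K} (ha : eval a F ≠ 0)
    (hab : plucker a b ≠ 0) :
    (S ∩ lineOfRep (plucker a b)).Finite ∧ (S ∩ lineOfRep (plucker a b)).ncard ≤ e ∧
      (S ∩ lineOfRep (plucker a b)).ncard = {t : K | eval (b + t • a) F = 0}.ncard := by
  refine ncard_line_section hF ha (fun s t h => ?_) fun v hv => ?_
  · by_contra hst
    exact comb_ne_zero hab (by tauto) h
  · rw [Set.mem_inter_iff, mk_mem_iff_mem_cone hv, mem_cone_iff_eval_eq_zero hScl hFS hv,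
      mk_mem_lineOfRep hv, wedgePt_plucker_eq_zero hab]

theorem exists_plucker_ne_zero {a : Fin 4 → K} (ha : a ≠ 0) : ∃ b, plucker a b ≠ 0 := by
  by_contra! h
  obtain ⟨t, ht⟩ := exists_add_smul_eq_zero ha (h ![1, 0, 0, 0])
  obtain ⟨s, hs⟩ := exists_add_smul_eq_zero ha (h ![0, 1, 0, 0])
  have h0 : 1 + t * a 0 = 0 := congrFun ht 0
  have h1 : 0 + t * a 1 = 0 := congrFun ht 1
  have h2 : 0 + s * a 0 = 0 := congrFun hs 0
  have h3 : 1 + s * a 1 = 0 := congrFun hs 1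
  grind

theorem lineOpen_linear_ne_zero {V E : Type} [AddCommGroup V] [Module K V] [AddCommGroup E]
    [Module K E] (ℓ : V →ₗ[K] E) (h : ∃ v, ℓ v ≠ 0) : LineOpen K {v | ℓ v ≠ 0} := by
  refine ⟨h, fun x hx y => Set.Subsingleton.finite fun s hs t ht => ?_⟩
  simp only [Set.mem_ofPred_eq, not_not, map_add, map_smul] at hs ht hx
  by_contra hst
  have h1 : (s - t) • ℓ y = 0 := by
    rw [sub_smul, sub_eq_zero]
    exact add_left_cancel (hs.trans ht.symm)
  have h2 : ℓ y = 0 := (smul_eq_zero.1 h1).resolve_left (sub_ne_zero.2 hst)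
  rw [h2, smul_zero, add_zero] at hs
  exact hx hs

theorem LineOpen.preimage {V W : Type} [AddCommGroup V] [Module K V] [AddCommGroup W] [Module K W]
    {U : Set W} (hU : LineOpen K U) (ℓ : V →ₗ[K] W) (h : (ℓ ⁻¹' U).Nonempty) :
    LineOpen K (ℓ ⁻¹' U) :=
  ⟨h, fun x hx y => by simpa using hU.2 (ℓ x) hx (ℓ y)⟩

theorem plPair_plucker_add_smul_left (w : Fin 6 → K) (x y b : Fin 4 → K) (t : K) :
    plPair w (plucker (x + t • y) b) = plPair w (plucker x b) + t * plPair w (plucker y b) := by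
  simp [plPair, plucker]; ring

theorem plPair_plucker_add_smul (w : Fin 6 → K) (a x y : Fin 4 → K) (t : K) :
    plPair w (plucker a (x + t • y)) = plPair w (plucker a x) + t * plPair w (plucker a y) := by
  rw [plucker_add_smul, plPair_add_smul]

theorem algebraMap_comp_add_smul {E : Type} [Field E] [Algebra K E] {n : ℕ} (x y : Fin n → K)
    (t : K) : algebraMap K E ∘ (x + t • y) =
      algebraMap K E ∘ x + algebraMap K E t • (algebraMap K E ∘ y) := by
  ext i; simp [Algebra.smul_def]

theorem finite_algebraMap_isRoot {E : Type} [Field E] [Algebra K E] {P : Polynomial E} {e : K}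
    (he : P.eval (algebraMap K E e) ≠ 0) : {t : K | P.eval (algebraMap K E t) = 0}.Finite :=
  (Polynomial.finite_setOfPred_isRoot (p := P) (by rintro rfl; simp at he)).preimage
    (algebraMap K E).injective.injOn

section Minors

variable {E : Type} [Field E] [Algebra K E] (w z : Fin 6 → E)

/-- The minor `pairMinor` evaluated at vectors defined over `K`. -/
def baseMinor (a b b' : Fin 4 → K) : E :=
  pairMinor w z (algebraMap K E ∘ a) (algebraMap K E ∘ b) (algebraMap K E ∘ b')

theorem finite_baseMinor_fst {x b b' : Fin 4 → K} (h : baseMinor w z x b b' ≠ 0) (y : Fin 4 → K) :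
    {t : K | baseMinor w z (x + t • y) b b' = 0}.Finite := by
  let L (w : Fin 6 → E) (b : Fin 4 → K) : Polynomial E :=
    Polynomial.C (plPair w (plucker (algebraMap K E ∘ x) (algebraMap K E ∘ b))) +
      Polynomial.X * Polynomial.C (plPair w (plucker (algebraMap K E ∘ y) (algebraMap K E ∘ b)))
  have hL (t : K) : (L w b * L z b' - L z b * L w b').eval (algebraMap K E t) =
      baseMinor w z (x + t • y) b b' := by
    simp only [L, baseMinor, pairMinor, algebraMap_comp_add_smul, plPair_plucker_add_smul_left]
    simp
    ring
  simp only [← hL]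
  exact finite_algebraMap_isRoot (e := 0) (by rw [hL]; simpa using h)

theorem finite_baseMinor_snd {a x b' : Fin 4 → K} (h : baseMinor w z a x b' ≠ 0) (y : Fin 4 → K) :
    {t : K | baseMinor w z a (x + t • y) b' = 0}.Finite := by
  let L (w : Fin 6 → E) : Polynomial E :=
    Polynomial.C (plPair w (plucker (algebraMap K E ∘ a) (algebraMap K E ∘ x))) +
      Polynomial.X * Polynomial.C (plPair w (plucker (algebraMap K E ∘ a) (algebraMap K E ∘ y)))
  let c (w : Fin 6 → E) : Polynomial E :=
    Polynomial.C (plPair w (plucker (algebraMap K E ∘ a) (algebraMap K E ∘ b')))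
  have hL (t : K) : (L w * c z - L z * c w).eval (algebraMap K E t) =
      baseMinor w z a (x + t • y) b' := by
    simp only [L, c, baseMinor, pairMinor, algebraMap_comp_add_smul, plPair_plucker_add_smul]
    simp
    ring
  simp only [← hL]
  exact finite_algebraMap_isRoot (e := 0) (by rw [hL]; simpa using h)

theorem baseMinor_swap (a b b' : Fin 4 → K) : baseMinor w z a b' b = -baseMinor w z a b b' := by
  simp only [baseMinor, pairMinor]
  ring

theorem finite_baseMinor_trd {a b x : Fin 4 → K} (h : baseMinor w z a b x ≠ 0) (y : Fin 4 → K) :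
    {t : K | baseMinor w z a b (x + t • y) = 0}.Finite := by
  simp only [baseMinor_swap w z a (x + _) b, neg_eq_zero, baseMinor_swap w z a x b, ne_eq] at h ⊢
  exact finite_baseMinor_snd w z h y

variable {w z}

theorem lineOpen_baseMinor_fst (hwz : ∃ i j, w i * z j ≠ w j * z i) :
    LineOpen K {a : Fin 4 → K | ∃ b b', baseMinor w z a b b' ≠ 0} := by
  refine ⟨exists_pairMinor_ne_zero hwz, ?_⟩
  rintro x ⟨b, b', h⟩ y
  exact (finite_baseMinor_fst w z h y).subset fun t ht => by
    by_contra hc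
    exact ht ⟨b, b', hc⟩

theorem lineOpen_baseMinor_snd {a : Fin 4 → K} (h : ∃ b b', baseMinor w z a b b' ≠ 0) :
    LineOpen K {b : Fin 4 → K | ∃ b', baseMinor w z a b b' ≠ 0} := by
  refine ⟨h, ?_⟩
  rintro x ⟨b', h⟩ y
  exact (finite_baseMinor_snd w z h y).subset fun t ht => by
    by_contra hc
    exact ht ⟨b', hc⟩

theorem lineOpen_baseMinor_trd {a b : Fin 4 → K} (h : ∃ b', baseMinor w z a b b' ≠ 0) :
    LineOpen K {b' : Fin 4 → K | baseMinor w z a b b' ≠ 0} :=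
  ⟨h, fun x hx y => by simpa using finite_baseMinor_trd w z hx y⟩

end Minors

theorem lineOpen_plPair_plucker {w : Fin 6 → K} {a : Fin 4 → K} (h : wedgePt w a ≠ 0) :
    LineOpen K {b : Fin 4 → K | plPair w (plucker a b) ≠ 0} := by
  have hlin : IsLinearMap K fun b => plPair w (plucker a b) :=
    ⟨fun x y => by simp [plPair, plucker]; ring, fun c x => by simp [plPair, plucker]; ring⟩
  refine lineOpen_linear_ne_zero hlin.mk' ?_
  by_contra! hc
  have hc : ∀ b, trivPair (wedgePt w a) b = 0 := fun b => by
    rw [← plPair_plucker]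
    exact hc b
  apply h
  have h0 := hc ![0, 0, 0, 1]
  have h1 := hc ![0, 0, 1, 0]
  have h2 := hc ![0, 1, 0, 0]
  have h3 := hc ![1, 0, 0, 0]
  simp [trivPair] at h0 h1 h2 h3
  ext i
  fin_cases i <;> assumption

theorem lineOpen_transversal [IsAlgClosed K] {F : MvPolynomial (Fin 4) K} (hF : Prime F) :
    LineOpen K {a : Fin 4 → K | eval a F ≠ 0 ∧ ∑ i, C (a i) * pderiv i F ≠ 0} := by
  have hlin : IsLinearMap K fun a : Fin 4 → K => ∑ i, C (a i) * pderiv i F :=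
    ⟨fun x y => by simp [add_mul, Finset.sum_add_distrib], fun c x => by
      simp [mul_assoc, Finset.smul_sum, smul_eq_C_mul]⟩
  refine (lineOpen_eval_ne_zero hF.ne_zero).inter (lineOpen_linear_ne_zero hlin.mk' ?_)
  obtain ⟨i, hi⟩ := exists_pderiv_ne_zero hF
  refine ⟨Pi.single i 1, ?_⟩
  simpa [Pi.single_apply, apply_ite] using hi

theorem hasSurfDeg_of_form [IsAlgClosed K] {S : Set (PP K 4)} (hScl : ZClosed S)
    {F : MvPolynomial (Fin 4) K} {e : ℕ} (hF : F.IsHomogeneous e) (hF' : Prime F)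
    (hFS : ∀ g, g ∈ coneIdeal S ↔ F ∣ g) : HasSurfDeg S e := by
  constructor
  · intro w hw hwS
    obtain ⟨p, hpw, hpS⟩ := Set.not_subset.1 hwS
    obtain ⟨c, hc, rfl⟩ := exists_rep p
    rw [mk_mem_lineOfRep] at hpw
    rw [mk_mem_iff_mem_cone, mem_cone_iff_eval_eq_zero hScl hFS hc] at hpS
    obtain ⟨b, rfl⟩ := hw.exists_plucker_of_mem hc hpw
    have := ncard_surface_line_section hScl hF hFS hpS hw.1
    exact ⟨this.1, this.2.1⟩
  · obtain ⟨a, ha, hda⟩ := (lineOpen_transversal hF').1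
    obtain ⟨R, hR, hRb⟩ := exists_ncard_line_zeros hF hF' ha hda
    have ha0 : a ≠ 0 := by rintro rfl; simp at hda
    have hlin : IsLinearMap K (plucker a) :=
      ⟨fun x y => by ext i; fin_cases i <;> simp [plucker] <;> ring,
        fun c x => plucker_smul_right _ _ _⟩
    obtain ⟨b, hb, hab⟩ := ((lineOpen_eval_ne_zero hR).inter
      (lineOpen_linear_ne_zero hlin.mk' (exists_plucker_ne_zero ha0))).1
    refine ⟨plucker a b, ⟨hab, plQuad_plucker a b⟩, fun h => ?_, ?_⟩
    · have : Projectivization.mk K a ha0 ∈ S :=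
        h ((mk_mem_lineOfRep ha0).2 ((wedgePt_plucker_eq_zero hab).2 ⟨1, 0, by simp⟩))
      rw [mk_mem_iff_mem_cone, mem_cone_iff_eval_eq_zero hScl hFS ha0] at this
      exact ha this
    · rw [(ncard_surface_line_section hScl hF hFS ha hab).2.2, hRb b hb]

/-! ### Counting -/

theorem exists_generic_derivation [IsAlgClosed K] {n : ℕ} {X : Set (PP K n)} (hX : ZIrred X)
    {x y : PP K n} (hx : x ∈ X) (hy : y ∈ X) (hxy : x ≠ y) :
    ∃ (E : Type) (_ : Field E) (_ : Algebra K E) (ξ : Fin n → E) (D : Derivation K E E),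
      (∀ p, aeval ξ p = 0 ↔ p ∈ coneIdeal X) ∧ ∃ i j, ξ i * D (ξ j) ≠ ξ j * D (ξ i) := by
  have := isPrime_coneIdeal hX
  obtain ⟨u, hu⟩ := hasIndep_two hX hx hy hxy
  let B := MvPolynomial (Fin n) K ⧸ coneIdeal X
  let w : Fin n → B := fun i => Ideal.Quotient.mk _ (MvPolynomial.X i)
  have haw (p : MvPolynomial (Fin n) K) : aeval w p = Ideal.Quotient.mk (coneIdeal X) p := by
    have : aeval w = Ideal.Quotient.mkₐ K (coneIdeal X) := by
      apply MvPolynomial.algHom_ext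
      intro i
      rw [aeval_X]
      rfl
    rw [this]
    rfl
  have hw : Algebra.adjoin K (Set.range w) = ⊤ := by
    rw [Algebra.adjoin_range_eq_range_aeval, AlgHom.range_eq_top]
    intro b
    obtain ⟨p, rfl⟩ := Ideal.Quotient.mk_surjective b
    exact ⟨p, haw p⟩
  obtain ⟨D, hD⟩ := exists_derivation_not_proportional (E := FractionRing B) hw hu
  refine ⟨FractionRing B, inferInstance, inferInstance, fun i => algebraMap B _ (w i), D,
    fun p => ?_, hD⟩
  rw [← Ideal.Quotient.eq_zero_iff_mem, ← haw,
    ← (IsFractionRing.injective B (FractionRing B)).eq_iff, map_zero, ← aeval_algebraMap_apply]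
  rfl

/-- The lines of `C` meeting a line `ab` with `a` on no line of `C`, counted through the points
in which `ab` meets the union of the lines of `C`. -/
theorem ncard_tangent_section {C : Set (PP K 6)} (hGr : C ⊆ grass K) {a b : Fin 4 → K} {f : ℕ}
    (ha : ∀ w ∈ cone C, wedgePt w a ≠ 0) (hab : plucker a b ≠ 0)
    (hC : (C ∩ hyp (pairCoeff (plucker a b))).Finite)
    (hS : (sweep C ∩ lineOfRep (plucker a b)).Finite)
    (hf : ∀ p ∈ sweep C ∩ lineOfRep (plucker a b), {x ∈ C | p ∈ lineOf x}.ncard = f) :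
    (C ∩ hyp (pairCoeff (plucker a b))).ncard =
      (sweep C ∩ lineOfRep (plucker a b)).ncard * f := by
  classical
  have hex : ∀ x : PP K 6, ∃ p : PP K 4, x ∈ C ∩ hyp (pairCoeff (plucker a b)) →
      p ∈ lineOfRep (plucker a b) ∧ p ∈ lineOf x := by
    intro x
    by_cases hx : x ∈ C ∩ hyp (pairCoeff (plucker a b))
    · obtain ⟨w, hw, rfl, hwC⟩ := exists_mem_cone hx.1
      have h := (mk_mem_hyp hw).1 hx.2
      rw [sum_pairCoeff] at h
      obtain ⟨s, t, hst, hwst⟩ := exists_comb_of_plPair_eq_zero (plQuad_of_mem_cone hGr hwC) h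
      exact ⟨Projectivization.mk K _ (comb_ne_zero hab hst), fun _ =>
        ⟨(mk_mem_lineOfRep _).2 (wedgePt_plucker_comb _ _ _ _), (mk_mem_lineOf hw _).2 hwst⟩⟩
    · obtain ⟨p⟩ : Nonempty (PP K 4) := inferInstance
      exact ⟨p, fun h => absurd h hx⟩
  choose π hπ using hex
  have huniq : ∀ x ∈ C, ∀ p ∈ lineOfRep (plucker a b), ∀ q ∈ lineOfRep (plucker a b),
      p ∈ lineOf x → q ∈ lineOf x → p = q := by
    intro x hx p hp q hq hpx hqx
    obtain ⟨w, hw, rfl, hwC⟩ := exists_mem_cone hx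
    obtain ⟨u, hu, rfl⟩ := exists_rep p
    obtain ⟨v, hv, rfl⟩ := exists_rep q
    rw [mk_mem_lineOf hw] at hpx hqx
    obtain ⟨s, t, rfl⟩ := (wedgePt_plucker_eq_zero hab).1 ((mk_mem_lineOfRep hu).1 hp)
    obtain ⟨s', t', rfl⟩ := (wedgePt_plucker_eq_zero hab).1 ((mk_mem_lineOfRep hv).1 hq)
    obtain ⟨i, hi⟩ := Function.ne_iff.1 (ha w hwC)
    have h1 := congrFun hpx i
    have h2 := congrFun hqx i
    simp only [wedgePt_add, wedgePt_smul, Pi.add_apply, Pi.smul_apply, smul_eq_mul,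
      Pi.zero_apply] at h1 h2 hi
    have ht' : t' ≠ 0 := by
      rintro rfl
      have : s' = 0 := by simpa [hi] using h2
      simp [this] at hv
    have hst : s * t' = s' * t := mul_right_cancel₀ hi (by linear_combination t' * h1 - t * h2)
    refine (Projectivization.mk_eq_mk_iff' K _ _ _ _).2 ⟨t / t', ?_⟩
    ext j
    simp only [Pi.add_apply, Pi.smul_apply, smul_eq_mul]
    field_simp
    linear_combination -a j * hst
  have hmem : ∀ p ∈ lineOfRep (plucker a b), ∀ x ∈ C, p ∈ lineOf x →
      x ∈ hyp (pairCoeff (plucker a b)) := by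
    intro p hp x hx hpx
    obtain ⟨w, hw, rfl, hwC⟩ := exists_mem_cone hx
    obtain ⟨u, hu, rfl⟩ := exists_rep p
    rw [mk_mem_lineOf hw] at hpx
    obtain ⟨s, t, rfl⟩ := (wedgePt_plucker_eq_zero hab).1 ((mk_mem_lineOfRep hu).1 hp)
    rw [mk_mem_hyp hw, sum_pairCoeff]
    refine plPair_eq_zero_of_wedgePt ?_ hpx
    by_contra! h
    simp [h.1, h.2] at hu
  rw [Set.ncard_eq_toFinset_card _ hC, Set.ncard_eq_toFinset_card _ hS,
    Finset.card_eq_sum_card_fiberwise (f := π) (t := hS.toFinset), ← smul_eq_mul,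
    ← Finset.sum_const]
  · refine Finset.sum_congr rfl fun p hp => ?_
    rw [Set.Finite.mem_toFinset] at hp
    rw [← hf p hp, ← Set.ncard_coe_finset]
    congr 1
    ext x
    simp only [Finset.coe_filter, Set.Finite.mem_toFinset, Set.mem_ofPred_eq]
    constructor
    · rintro ⟨hx, rfl⟩
      exact ⟨hx.1, (hπ x hx).2⟩
    · rintro ⟨hx, hpx⟩
      have hx' : x ∈ C ∩ hyp (pairCoeff (plucker a b)) := ⟨hx, hmem p hp.2 x hx hpx⟩
      exact ⟨hx', huniq x hx _ (hπ x hx').1 _ hp.2 (hπ x hx').2 hpx⟩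
  · intro x hx
    rw [Finset.mem_coe, Set.Finite.mem_toFinset] at hx ⊢
    exact ⟨⟨(x, π x), ⟨hx.1, (hπ x hx).2⟩, rfl⟩, (hπ x hx).1⟩

theorem aeval_linForm_pairCoeff {E : Type} [Field E] [Algebra K E] (ξ : Fin 6 → E)
    (a b : Fin 4 → K) : aeval ξ (linForm (pairCoeff (plucker a b))) =
      plPair ξ (plucker (algebraMap K E ∘ a) (algebraMap K E ∘ b)) := by
  simp [linForm, pairCoeff, plucker, plPair, Fin.sum_univ_succ]
  ring

theorem derivation_aeval_linForm {E : Type} [Field E] [Algebra K E] {n : ℕ} (D : Derivation K E E)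
    (ξ : Fin n → E) (φ : Fin n → K) :
    D (aeval ξ (linForm φ)) = aeval (fun i => D (ξ i)) (linForm φ) := by
  simp [linForm]

theorem degree_eq_mul [IsAlgClosed K] {C : Set (PP K 6)} {d e f : ℕ} (hGr : C ⊆ grass K)
    (hCcl : ZClosed C) (hC : ZIrred C) (hdeg : HasCurveDeg C d) {x y : PP K 6} (hx : x ∈ C)
    (hy : y ∈ C) (hxy : x ≠ y) {F : MvPolynomial (Fin 4) K} (hF : F.IsHomogeneous e)
    (hF' : Prime F) (hFS : ∀ g, g ∈ coneIdeal (sweep C) ↔ F ∣ g)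
    (hgen : GenericPts (sweep C) fun p => {x ∈ C | p ∈ lineOf x}.ncard = f) : d = e * f := by
  classical
  have hScl := zClosed_sweep hCcl
  obtain ⟨φ₀, hφ₀, hφ₀C, hφ₀d⟩ := hdeg.2
  have hT₀ := (hdeg.1 φ₀ hφ₀ hφ₀C).1
  obtain ⟨T, hT, hST, hQ⟩ := hgen
  obtain ⟨g, hgT, hg⟩ : ∃ g ∈ coneIdeal T, ¬ F ∣ g := by
    obtain ⟨p, hpS, hpT⟩ := Set.not_subset.1 hST
    obtain ⟨v, hv, rfl, hvS⟩ := exists_mem_cone hpS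
    obtain ⟨g, hgT, -, hgv⟩ := hT.exists_isHomogeneous hv ((mk_mem_iff_mem_cone hv).not.1 hpT)
    exact ⟨g, hgT, fun h => hgv (mem_coneIdeal.1 ((hFS g).2 h) v hvS)⟩
  obtain ⟨E, _, _, ξ, D, hξ, hξD⟩ := exists_generic_derivation hC hx hy hxy
  obtain ⟨w₀, -, -, hw₀⟩ := exists_mem_cone hx
  let P : Set (PP K 6 × PP K 6) :=
    {p | p.1 ∈ C ∩ hyp φ₀ ∧ p.2 ∈ C ∩ hyp φ₀ ∧ p.1 ≠ p.2}
  have hP : P.Finite := (hT₀.prod hT₀).subset fun p hp => ⟨hp.1, hp.2.1⟩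
  have hPij : ∀ p ∈ P, ∃ i j, p.1.rep i * p.2.rep j ≠ p.1.rep j * p.2.rep i := fun p hp =>
    exists_mul_ne_of_mk_ne p.1.rep_nonzero p.2.rep_nonzero (by simpa using hp.2.2)
  -- the vertex `a` of the pencils of lines
  obtain ⟨a, ⟨⟨haF, hda⟩, haD⟩, haP⟩ := (((lineOpen_transversal hF').inter
    (lineOpen_baseMinor_fst (z := fun i => D (ξ i)) hξD)).inter
    (LineOpen.biInter hP fun p hp => lineOpen_baseMinor_fst (hPij p hp))).1
  have ha0 : a ≠ 0 := by rintro rfl; simp at hda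
  have haS : a ∉ cone (sweep C) := fun h => haF ((mem_cone_iff_eval_eq_zero hScl hFS ha0).1 h)
  have haC : ∀ w ∈ cone C, wedgePt w a ≠ 0 := fun w hw h =>
    haS ((mem_cone_sweep ha0).2 ⟨w, hw, h⟩)
  obtain ⟨R₁, hR₁, hR₁b⟩ := exists_ncard_line_zeros hF hF' haF hda
  obtain ⟨R₂, hR₂, hR₂b⟩ := exists_elimination hF' dvd_rfl hF haF hg
  have hopen := (lineOpen_eval_ne_zero (mul_ne_zero hR₁ hR₂)).inter
    (lineOpen_plPair_plucker (haC w₀ hw₀))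
  obtain ⟨b, ⟨hb, hbD⟩, hbP⟩ := ((hopen.inter (lineOpen_baseMinor_snd haD)).inter
    (LineOpen.biInter hP fun p hp => lineOpen_baseMinor_snd (Set.mem_iInter₂.1 haP p hp))).1
  have hCb := (finite_pairing hdeg hw₀ hb.2).1
  obtain ⟨b', ⟨hbD', hbP'⟩, hCb'⟩ := (((lineOpen_baseMinor_trd hbD).inter
    (LineOpen.biInter hP fun p hp => lineOpen_baseMinor_trd (Set.mem_iInter₂.1 hbP p hp))).inter
    (LineOpen.biInter hCb fun x hx => lineOpen_plPair_plucker
      (haC x.rep ⟨x.rep_nonzero, by rw [x.mk_rep]; exact hx.1⟩))).1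
  let φ : Fin 3 → Fin 6 → K := ![pairCoeff (plucker a b), pairCoeff (plucker a b'), φ₀]
  have hφ0 (w : Fin 6 → K) : linVal φ w 0 = plPair w (plucker a b) := sum_pairCoeff _ _
  have hφ1 (w : Fin 6 → K) : linVal φ w 1 = plPair w (plucker a b') := sum_pairCoeff _ _
  have h01 : ∀ w ∈ cone C, linVal φ w 0 = 0 → linVal φ w 1 ≠ 0 := by
    intro w hw h0 h1
    rw [hφ0] at h0
    rw [hφ1] at h1
    have hmem : Projectivization.mk K w hw.1 ∈ C ∩ hyp (pairCoeff (plucker a b)) :=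
      ⟨hw.2, (mk_mem_hyp hw.1).2 (by rw [sum_pairCoeff, h0])⟩
    refine Set.mem_iInter₂.1 hCb' _ hmem ?_
    rw [← sum_pairCoeff]
    exact (mk_mem_hyp hw.1).2 (by rw [sum_pairCoeff, h1]) _ (Projectivization.rep_nonzero _)
      (Projectivization.mk_rep _)
  have h2 : ∃ w ∈ cone C, linVal φ w 2 ≠ 0 := by
    obtain ⟨p, hpC, hp⟩ := Set.not_subset.1 hφ₀C
    obtain ⟨w, hw, rfl, hwC⟩ := exists_mem_cone hpC
    exact ⟨w, hwC, fun h => hp ((mk_mem_hyp hw).2 h)⟩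
  have hD : aeval ξ (linForm (φ 0)) * D (aeval ξ (linForm (φ 1))) ≠
      aeval ξ (linForm (φ 1)) * D (aeval ξ (linForm (φ 0))) := by
    rw [derivation_aeval_linForm, derivation_aeval_linForm]
    change aeval ξ (linForm (pairCoeff (plucker a b))) *
      aeval (fun i => D (ξ i)) (linForm (pairCoeff (plucker a b'))) ≠
      aeval ξ (linForm (pairCoeff (plucker a b'))) *
      aeval (fun i => D (ξ i)) (linForm (pairCoeff (plucker a b)))
    simp only [aeval_linForm_pairCoeff]
    rw [← sub_ne_zero, mul_comm (plPair ξ _) (plPair _ (plucker (_ ∘ a) (_ ∘ b)))]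
    exact hbD'
  have hsep : ∀ x ∈ C ∩ hyp φ₀, ∀ y ∈ C ∩ hyp φ₀, x ≠ y →
      linVal φ x.rep 0 * linVal φ y.rep 1 ≠ linVal φ y.rep 0 * linVal φ x.rep 1 := by
    intro p hp q hq hpq
    rw [hφ0, hφ0, hφ1, hφ1, ← sub_ne_zero]
    exact Set.mem_iInter₂.1 hbP' (p, q) ⟨hp, hq, hpq⟩
  obtain ⟨R, hR, hRβ⟩ := exists_ncard_le_ncard_pencil_section hCcl hC hx hy hxy h01 h2 hξ hD
    (T := C ∩ hyp φ₀) subset_rfl hsep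
  have hlin : IsLinearMap K fun β : Fin 3 → K => β 1 • b - β 0 • b' :=
    ⟨fun x y => by simp only [Pi.add_apply, add_smul]; abel,
      fun c x => by simp only [Pi.smul_apply, smul_eq_mul, mul_smul, smul_sub]⟩
  obtain ⟨β, hβ, hβb⟩ := ((lineOpen_eval_ne_zero hR).inter (hopen.preimage hlin.mk'
    ⟨![0, 1, 0], by simpa using hb⟩)).1
  replace hβb : β 1 • b - β 0 • b' ∈ {x | eval x (R₁ * R₂) ≠ 0} ∩
    {b | plPair w₀ (plucker a b) ≠ 0} := hβb
  have hφβ : β 1 • φ 0 - β 0 • φ 1 = pairCoeff (plucker a (β 1 • b - β 0 • b')) := by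
    ext i
    fin_cases i <;> simp [φ, pairCoeff, plucker] <;> ring
  set b₁ := β 1 • b - β 0 • b'
  obtain ⟨hfin, hle⟩ := finite_pairing hdeg hw₀ hβb.2
  have hge := hRβ β hβ (by rw [hφβ]; exact hfin)
  rw [hφβ, hφ₀d] at hge
  have hab : plucker a b₁ ≠ 0 := fun h => hβb.2 (by rw [h, plPair_zero_right])
  obtain ⟨hSfin, -, hSe⟩ := ncard_surface_line_section hScl hF hFS haF hab
  have hβR := hβb.1
  simp only [Set.mem_ofPred_eq, map_mul] at hβR
  rw [hR₁b b₁ (left_ne_zero_of_mul hβR)] at hSe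
  rw [← hSe, le_antisymm hge hle]
  refine ncard_tangent_section hGr haC hab hfin hSfin fun p hp => hQ p hp.1 fun hpT => ?_
  obtain ⟨v, hv, rfl, hvS⟩ := exists_mem_cone hp.1
  obtain ⟨s, t, rfl⟩ := (wedgePt_plucker_eq_zero hab).1 ((mk_mem_lineOfRep hv).1 hp.2)
  have ht : t ≠ 0 := by
    rintro rfl
    rw [zero_smul, add_zero] at hvS hv
    have hs : s ≠ 0 := fun h => hv (by rw [h, zero_smul])
    have := smul_mem_cone hvS (inv_ne_zero hs)
    rw [smul_smul, inv_mul_cancel₀ hs, one_smul] at this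
    exact haS this
  have hv' : t⁻¹ • (s • a + t • b₁) = b₁ + (t⁻¹ * s) • a := by
    rw [smul_add, smul_smul, smul_smul, inv_mul_cancel₀ ht, one_smul, add_comm]
  have h1 := smul_mem_cone hvS (inv_ne_zero ht)
  have h2 := smul_mem_cone ((mk_mem_iff_mem_cone hv).1 hpT) (inv_ne_zero ht)
  rw [hv'] at h1 h2
  exact hR₂b b₁ (right_ne_zero_of_mul hβR) _
    ((mem_cone_iff_eval_eq_zero hScl hFS h1.1).1 h1) (mem_coneIdeal.1 hgT _ h2)

theorem incidence_conclusion [IsAlgClosed K] {C : Set (PP K 6)} {d : ℕ} (hd : 2 ≤ d)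
    (hGr : C ⊆ grass K) (hCcl : ZClosed C) (hC : ZIrred C) (hdeg : HasCurveDeg C d) :
    ZClosed2 (incidence C) ∧ ZIrred2 (incidence C) ∧ HasDim2 (incidence C) 2 ∧
      ZClosed (sweep C) ∧ ZIrred (sweep C) ∧ HasDim (sweep C) 2 ∧
      ∃ e, HasSurfDeg (sweep C) e ∧ ∀ f,
        GenericPts (sweep C) (fun p => {x ∈ C | p ∈ lineOf x}.ncard = f) → d = e * f := by
  obtain ⟨φ, hφ, hφC, hφd⟩ := hdeg.2
  obtain ⟨x, hx, y, hy, hxy⟩ := (Set.one_lt_ncard (hdeg.1 φ hφ hφC).1).1 (by omega)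
  obtain ⟨e, F, hF, hF', hFS⟩ := exists_sweep_form hGr hCcl hC hdeg hx.1 hy.1 hxy
  exact ⟨zClosed2_incidence hCcl, zIrred2_incidence hGr hC,
    ⟨dimGE2_incidence hGr hCcl hC hx.1 hy.1 hxy,
      not_dimGE2_incidence hGr hCcl hC (hdeg.1 φ hφ hφC).1⟩,
    zClosed_sweep hCcl, zIrred_sweep hGr hC,
    ⟨dimGE_sweep hGr hCcl hC hx.1 hy.1 hxy, not_dimGE_sweep hGr hdeg hx.1 hy.1 hxy⟩,
    e, hasSurfDeg_of_form (zClosed_sweep hCcl) hF hF' hFS, fun f hgen =>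
      degree_eq_mul hGr hCcl hC hdeg hx.1 hy.1 hxy hF hF' hFS hgen⟩

/-! STATEMENT 0: the incidence variety of an irreducible degree-`d` curve `C ⊂ Gr(2,4)`
(`d ≥ 2`, `C` not contained in any `σ₂(p₀)`) is an irreducible surface; its image `S` in ℙ³
is an irreducible surface of some degree `e`, and if through a general point of `S` there
pass exactly `f` lines of `C`, then `d = e·f`. -/

theorem statement_0 (K : Type) [Field K] [IsAlgClosed K]
    (C : Set (PP K 6)) (d : ℕ) (hd : 2 ≤ d)
    (hCGr : C ⊆ grass K)
    (hCcl : ZClosed C) (hCirr : ZIrred C) (hCdim : HasDim C 1) (hCdeg : HasCurveDeg C d)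
    (hnotsigma : ∀ p₀ : PP K 4, ¬ C ⊆ sigma2 p₀) :
    -- `S̃ = {(w̄,v̄) ∈ C × ℙ³ | w ∧ v = 0}`:
    let St : Set (PP K 6 × PP K 4) := {z | z.1 ∈ C ∧ z.2 ∈ lineOf z.1}
    -- `S = pr₂(S̃)`:
    let S : Set (PP K 4) := Prod.snd '' St
    -- `S̃` is an irreducible (closed) variety of dimension 2:
    ZClosed2 St ∧ ZIrred2 St ∧ HasDim2 St 2 ∧
    -- `S` is an irreducible (closed) surface of some degree `e`, and
    -- `d = e·f` whenever exactly `f` lines of `C` pass through a general point of `S`: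
    ZClosed S ∧ ZIrred S ∧ HasDim S 2 ∧
    ∃ e : ℕ, HasSurfDeg S e ∧
      ∀ f : ℕ, GenericPts S (fun p => ({x ∈ C | p ∈ lineOf x}).ncard = f) →
        d = e * f := by
  exact incidence_conclusion hd hCGr hCcl hCirr hCdeg

end RQS
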